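/- arXiv:2211.09975 — 4 statements merged into one kernel-verified Lean document; each statement's English description precedes it below -/
import Mathlib

section
/- For every real number x ≥ e^{109}, the interval (x, x + 3.8·x^{1/4}] contains a squarefree integer. -/
lemma phi_id (u v w : ℝ) (hu : 0 < u) (hv : 0 < v) (hw : 0 < w) :
    (w-v)/u^2 - (w-u)/v^2 + (v-u)/w^2
      = (v-u)*(w-v)*(w-u)*(1/(u^2*v*w) + 1/(u*v^2*w) + 1/(u*v*w^2)) := by
  field_simp
  ring

lemma first_diff (y u v : ℝ) (m1 m2 : ℕ) (hy : 100 ≤ y) (hu : 0 < u) (huv : u + 1 ≤ v)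
    (hv : v ≤ 2*y^2) (hu2 : 400*y ≤ u^2)
    (h1 : y^4 < m1*u^2) (h1' : m1*u^2 ≤ y^4+3.8*y)
    (h2 : y^4 < m2*v^2) (h2' : m2*v^2 ≤ y^4+3.8*y) :
    0.49*u^3 ≤ (v-u)*y^4 := by
  have hlt : m2 < m1 := by
    by_contra hcon
    push Not at hcon
    have hc : (m1:ℝ) ≤ m2 := by exact_mod_cast hcon
    have e1 : (m1:ℝ)*v^2 ≤ m2*v^2 := by gcongr
    have e2 : (m1:ℝ)*(u+1)^2 ≤ m1*v^2 := by gcongr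
    have e3 : 2*((m1:ℝ)*u) < 3.8*y := by nlinarith [Nat.cast_nonneg (α := ℝ) m1]
    have e4 : (m1:ℝ)*u*u ≤ 1.9*y*(2*y^2) := by
      have : u ≤ 2*y^2 := by linarith
      have : (m1:ℝ)*u ≤ 1.9*y := by linarith
      gcongr
    have : y^4 < 3.8*y^3 := by nlinarith
    have : y^3*100 ≤ y^3*y := by gcongr
    nlinarith [pow_pos (show 0<y by linarith) 3]
  have hlt' : (m2:ℝ) + 1 ≤ m1 := by exact_mod_cast hlt
  have hv0 : 0 < v := by linarith
  have e1 : (m2:ℝ)*u^2 + u^2 ≤ y^4+3.8*y := by nlinarith [sq_nonneg u]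
  have e2 : y^4*u^2 ≤ m2*v^2*u^2 := by gcongr
  have e3 : (m2:ℝ)*u^2*v^2 ≤ (y^4+3.8*y - u^2)*v^2 := by gcongr; linarith
  have e4 : (u^2-3.8*y)*v^2 ≤ y^4*(v^2-u^2) := by nlinarith
  have e5 : 0.99*u^2*v^2 ≤ y^4*(v^2-u^2) := by
    refine le_trans ?_ e4
    gcongr
    linarith
  have e6 : y^4*(v^2-u^2) ≤ y^4*((v-u)*(2*v)) := by
    gcongr
    nlinarith
  have e7 : v*(0.99*u^2*v) ≤ v*(2*((v-u)*y^4)) := by nlinarith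
  have e8 := le_of_mul_le_mul_left e7 hv0
  have e9 : u^2*u ≤ u^2*v := by gcongr; linarith
  nlinarith [pow_pos hu 3]

lemma phi_ge (u v w : ℝ) (hu : 0 < u) (huv : u ≤ v) (hvw : v ≤ w) :
    3/(v^2*w^2) ≤ 1/(u^2*v*w) + 1/(u*v^2*w) + 1/(u*v*w^2) := by
  have hv0 : 0 < v := by linarith
  have hw0 : 0 < w := by linarith
  have huw : u ≤ w := by linarith
  have f1 : 1/(v*w*v*w) ≤ 1/(u*u*v*w) := by gcongr
  have f2 : 1/(w*v^2*w) ≤ 1/(u*v^2*w) := by gcongr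
  have f3 : 1/(v*v*w^2) ≤ 1/(u*v*w^2) := by gcongr
  have e1 : 3/(v^2*w^2) = 1/(v*w*v*w) + 1/(w*v^2*w) + 1/(v*v*w^2) := by field_simp; norm_num
  have e2 : 1/(u*u*v*w) = 1/(u^2*v*w) := by rw [sq]
  linarith

lemma ab_big (y u v w : ℝ) (m1 m2 m3 : ℕ) (hy : 10000 ≤ y) (hu : 0 < u) (huv : u + 1 ≤ v)
    (hvw : v + 1 ≤ w) (hw : w ≤ 2*y^2) (hwu : w ≤ 1.01*u)
    (h1 : y^4 < m1*u^2) (h1' : m1*u^2 ≤ y^4+3.8*y)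
    (h2 : y^4 < m2*v^2) (h2' : m2*v^2 ≤ y^4+3.8*y)
    (h3 : y^4 < m3*w^2) (h3' : m3*w^2 ≤ y^4+3.8*y) :
    3.8*w^2 ≤ 3*y^3*((v-u)*(w-v)) := by
  have hv0 : 0 < v := by linarith
  have hw0 : 0 < w := by linarith
  have hy0 : 0 < y := by linarith
  by_cases hc : 3.8*w^2 ≤ 3*y^3
  · have : 1 ≤ (v-u)*(w-v) := by nlinarith
    have : 3*y^3*1 ≤ 3*y^3*((v-u)*(w-v)) := by gcongr
    linarith
  · push Not at hc
    have w2 : w^2 ≤ 1.0201*u^2 := by nlinarith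
    have u2 : 0.77*y^3 ≤ u^2 := by nlinarith [pow_pos hy0 3]
    have y3 : y^2*10000 ≤ y^2*y := by gcongr
    have y3' : 10000*y ≤ y*y := by gcongr
    have u2' : 400*y ≤ u^2 := by nlinarith
    have a1 := first_diff y u v m1 m2 (by linarith) hu huv (by linarith) u2' h1 h1' h2 h2'
    have a2 := first_diff y v w m2 m3 (by linarith) hv0 hvw (by linarith) (by nlinarith) h2 h2' h3 h3'
    have a3 : 0.49*u^3 ≤ (w-v)*y^4 := by
      have : u^3 ≤ v^3 := by gcongr; linarith
      linarith
    have a4 : (0.49*u^3)*(0.49*u^3) ≤ ((v-u)*y^4)*((w-v)*y^4) :=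
      mul_le_mul a1 a3 (by positivity) (le_trans (by positivity) a1)
    have a5 : (0.77*y^3)*(0.77*y^3) ≤ u^2*u^2 := by gcongr
    have a6 : 0.2401*u^2*(0.77*y^3*(0.77*y^3)) ≤ 0.2401*u^2*(u^2*u^2) := by gcongr
    have a7 : y^6*(0.142*u^2) ≤ y^6*(y^2*((v-u)*(w-v))) := by
      have : 0 ≤ u^2*y^6 := by positivity
      nlinarith
    have a8 := le_of_mul_le_mul_left a7 (by positivity)
    have a9 : y*(0.142*u^2) ≤ y*(y^2*((v-u)*(w-v))) := by gcongr
    have : 10000*(0.142*u^2) ≤ y*(0.142*u^2) := by gcongr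
    have a10 : y*(y^2*((v-u)*(w-v))) = y^3*((v-u)*(w-v)) := by ring
    have a11 : 3*y^3*((v-u)*(w-v)) = 3*(y^3*((v-u)*(w-v))) := by ring
    rw [a11]
    rw [a10] at a9
    linarith [sq_nonneg u]

lemma k_pos (y u v w : ℝ) (m1 m2 m3 : ℕ) (hy : 10000 ≤ y) (hu : 0 < u) (huv : u + 1 ≤ v)
    (hvw : v + 1 ≤ w) (hw : w ≤ 2*y^2) (hwu : w ≤ 1.01*u)
    (h1 : y^4 < m1*u^2) (h1' : m1*u^2 ≤ y^4+3.8*y)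
    (h2 : y^4 < m2*v^2) (h2' : m2*v^2 ≤ y^4+3.8*y)
    (h3 : y^4 < m3*w^2) (h3' : m3*w^2 ≤ y^4+3.8*y) :
    0 < (w-v)*m1 - (w-u)*m2 + (v-u)*m3 := by
  have hv0 : 0 < v := by linarith
  have hw0 : 0 < w := by linarith
  have hy0 : 0 < y := by linarith
  have d1 : y^4/u^2 < m1 := by rw [div_lt_iff₀ (by positivity)]; exact h1
  have d3 : y^4/w^2 < m3 := by rw [div_lt_iff₀ (by positivity)]; exact h3
  have d2 : m2 ≤ (y^4+3.8*y)/v^2 := by rw [le_div_iff₀ (by positivity)]; exact h2'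
  have hab := ab_big y u v w m1 m2 m3 hy hu huv hvw hw hwu h1 h1' h2 h2' h3 h3'
  have key : (w-u)*(3.8*y/v^2) ≤ y^4*((w-v)/u^2 - (w-u)/v^2 + (v-u)/w^2) := by
    rw [phi_id u v w hu hv0 hw0]
    have e := phi_ge u v w hu (by linarith) (by linarith)
    have hp : 0 ≤ (v-u)*(w-v)*(w-u) := by
      apply mul_nonneg (mul_nonneg _ _) <;> linarith
    have e2 : y^4*((v-u)*(w-v)*(w-u)*(3/(v^2*w^2))) ≤ y^4*((v-u)*(w-v)*(w-u)*(1/(u^2*v*w) + 1/(u*v^2*w) + 1/(u*v*w^2))) := by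
      gcongr
    refine le_trans ?_ e2
    have e3 : (w-u)*(3.8*y/v^2) = (w-u)*y/(v^2*w^2)*(3.8*w^2) := by field_simp
    have e4 : y^4*((v-u)*(w-v)*(w-u)*(3/(v^2*w^2))) = (w-u)*y/(v^2*w^2)*(3*y^3*((v-u)*(w-v))) := by
      field_simp
    rw [e3, e4]
    have : 0 ≤ w-u := by linarith
    gcongr
  have q1 : (w-v)*(y^4/u^2) < (w-v)*m1 := by
    apply mul_lt_mul_of_pos_left d1; linarith
  have q3 : (v-u)*(y^4/w^2) < (v-u)*m3 := by
    apply mul_lt_mul_of_pos_left d3; linarith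
  have q2 : (w-u)*m2 ≤ (w-u)*((y^4+3.8*y)/v^2) := by
    apply mul_le_mul_of_nonneg_left d2; linarith
  have q4 : (w-u)*((y^4+3.8*y)/v^2) = (w-u)*(3.8*y/v^2) + y^4*((w-u)/v^2) := by ring
  have q5 : y^4*((w-v)/u^2 - (w-u)/v^2 + (v-u)/w^2) = (w-v)*(y^4/u^2) - y^4*((w-u)/v^2) + (v-u)*(y^4/w^2) := by ring
  linarith

/-- two sided approximation -/
lemma k_approx (y u v w : ℝ) (m1 m2 m3 : ℕ) (hy : 0 < y) (hu : 0 < u) (huv : u ≤ v)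
    (hvw : v ≤ w)
    (h1 : y^4 < m1*u^2) (h1' : m1*u^2 ≤ y^4+3.8*y)
    (h2 : y^4 < m2*v^2) (h2' : m2*v^2 ≤ y^4+3.8*y)
    (h3 : y^4 < m3*w^2) (h3' : m3*w^2 ≤ y^4+3.8*y) :
    |((w-v)*m1 - (w-u)*m2 + (v-u)*m3) - y^4*((v-u)*(w-v)*(w-u)*(1/(u^2*v*w) + 1/(u*v^2*w) + 1/(u*v*w^2)))|
      ≤ (w-u)*(3.8*y/u^2) := by
  have hv0 : 0 < v := by linarith
  have hw0 : 0 < w := by linarith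
  rw [← phi_id u v w hu hv0 hw0]
  have d1 : y^4/u^2 ≤ m1 := by rw [div_le_iff₀ (by positivity)]; exact h1.le
  have d3 : y^4/w^2 ≤ m3 := by rw [div_le_iff₀ (by positivity)]; exact h3.le
  have d2 : y^4/v^2 ≤ m2 := by rw [div_le_iff₀ (by positivity)]; exact h2.le
  have aux : ∀ z, u ≤ z → (y^4+3.8*y)/z^2 ≤ y^4/z^2 + 3.8*y/u^2 := by
    intro z hz
    rw [add_div]
    gcongr
  have d1' : m1 ≤ y^4/u^2 + 3.8*y/u^2 :=
    le_trans (by rw [le_div_iff₀ (by positivity)]; exact h1') (aux u le_rfl)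
  have d2' : m2 ≤ y^4/v^2 + 3.8*y/u^2 :=
    le_trans (by rw [le_div_iff₀ (by positivity)]; exact h2') (aux v huv)
  have d3' : m3 ≤ y^4/w^2 + 3.8*y/u^2 :=
    le_trans (by rw [le_div_iff₀ (by positivity)]; exact h3') (aux w (by linarith))
  have e : y^4*((w-v)/u^2 - (w-u)/v^2 + (v-u)/w^2) = (w-v)*(y^4/u^2) - (w-u)*(y^4/v^2) + (v-u)*(y^4/w^2) := by ring
  rw [e]
  set A := y^4/u^2
  set B := y^4/v^2
  set C := y^4/w^2
  set E := 3.8*y/u^2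
  have hE : 0 ≤ E := by positivity
  rw [abs_le]
  have p : 0 ≤ w - v := by linarith
  have q : 0 ≤ v - u := by linarith
  constructor
  · nlinarith [mul_nonneg p (sub_nonneg.2 d1), mul_nonneg q (sub_nonneg.2 d3), mul_nonneg (add_nonneg p q) (sub_nonneg.2 d2')]
  · nlinarith [mul_nonneg p (sub_nonneg.2 d1'), mul_nonneg q (sub_nonneg.2 d3'), mul_nonneg (add_nonneg p q) (sub_nonneg.2 d2)]

lemma phi_le (u v w : ℝ) (hu : 0 < u) (huv : u ≤ v) (hvw : v ≤ w) :
    1/(u^2*v*w) + 1/(u*v^2*w) + 1/(u*v*w^2) ≤ 3/u^4 := by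
  have hv0 : 0 < v := by linarith
  have hw0 : 0 < w := by linarith
  have huw : u ≤ w := by linarith
  have f1 : 1/(u^2*v*w) ≤ 1/(u^2*u*u) := by gcongr
  have f2 : 1/(u*v^2*w) ≤ 1/(u*u^2*u) := by gcongr
  have f3 : 1/(u*v*w^2) ≤ 1/(u*u*u^2) := by gcongr
  have : 3/u^4 = 1/(u^2*u*u) + 1/(u*u^2*u) + 1/(u*u*u^2) := by field_simp; norm_num
  linarith

lemma abc_le (a b : ℝ) (ha : 0 ≤ a) (hb : 0 ≤ b) : a*b*(a+b) ≤ (a+b)^3/4 := by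
  nlinarith [mul_nonneg (sq_nonneg (a-b)) (add_nonneg ha hb)]

lemma comb_two (B : Finset ℕ) (f : ℕ → ℕ) (N : ℕ) (hf : ∀ u ∈ B, f u < N)
    (h3 : ∀ u ∈ B, ∀ v ∈ B, ∀ w ∈ B, u < v → v < w → f u = f v → f v = f w → False) :
    B.card ≤ 2 * N := by
  have := Finset.card_le_mul_card_image_of_maps_to (s := B) (t := Finset.range N) (f := f)
    (fun a ha => Finset.mem_range.2 (hf a ha)) 2 (by
      intro c _
      by_contra hcon
      push Not at hcon
      rw [Finset.two_lt_card] at hcon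
      obtain ⟨p, hp, q, hq, r, hr, hpq, hpr, hqr⟩ := hcon
      simp only [Finset.mem_filter] at hp hq hr
      have H : ∀ u v w, (u ∈ B ∧ f u = c) → (v ∈ B ∧ f v = c) → (w ∈ B ∧ f w = c) →
          u < v → v < w → False := by
        intro u v w hu hv hw h1 h2
        exact h3 u hu.1 v hv.1 w hw.1 h1 h2 (hu.2.trans hv.2.symm) (hv.2.trans hw.2.symm)
      rcases lt_or_gt_of_ne hpq with h | h <;> rcases lt_or_gt_of_ne hpr with h' | h' <;>
        rcases lt_or_gt_of_ne hqr with h'' | h''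
      · exact H p q r hp hq hr h h''
      · exact H p r q hp hr hq h' h''
      · omega
      · exact H r p q hr hp hq h' h
      · exact H q p r hq hp hr h h'
      · omega
      · exact H q r p hq hr hp h'' h'
      · exact H r q p hr hq hp h'' h)
  simpa using this

lemma diam_card (B : Finset ℕ) (L : ℝ) (hL : 0 ≤ L)
    (h : ∀ u ∈ B, ∀ v ∈ B, u < v → (v:ℝ) - u ≤ L) : (B.card : ℝ) ≤ L + 1 := by
  rcases B.eq_empty_or_nonempty with rfl | hB
  · simp; linarith
  · have hsub : B ⊆ Finset.Icc (B.min' hB) (B.max' hB) := by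
      intro u hu
      rw [Finset.mem_Icc]
      exact ⟨Finset.min'_le _ _ hu, Finset.le_max' _ _ hu⟩
    have hc := Finset.card_le_card hsub
    rw [Nat.card_Icc] at hc
    have hmm : B.min' hB ≤ B.max' hB := Finset.min'_le _ _ (Finset.max'_mem _ _)
    have hc' : (B.card : ℝ) ≤ (B.max' hB : ℝ) + 1 - B.min' hB := by
      have : B.card + B.min' hB ≤ B.max' hB + 1 := by omega
      have : (B.card : ℝ) + B.min' hB ≤ B.max' hB + 1 := by exact_mod_cast this
      linarith
    rcases hmm.eq_or_lt with e | e
    · rw [e] at hc'; linarith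
    · have := h _ (Finset.min'_mem B hB) _ (Finset.max'_mem B hB) e
      linarith

lemma prod_diff (X X' Y Y' α α' β β' : ℝ) (hα : α ≤ X - X') (hα' : α' ≤ Y - Y')
    (h1 : β ≤ X') (h2 : β' ≤ Y) (p1 : 0 ≤ α) (p2 : 0 ≤ α') (p3 : 0 ≤ β) (p4 : 0 ≤ β') :
    α*β' + β*α' ≤ X*Y - X'*Y' := by
  have e1 : α*β' ≤ (X-X')*Y := mul_le_mul hα h2 p4 (le_trans p1 hα)
  have e2 : β*α' ≤ X'*(Y-Y') := mul_le_mul h1 hα' p2 (le_trans p3 h1)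
  nlinarith

lemma inv_diff (p j V : ℝ) (hp : 0 < p) (hj : 0 ≤ j) (hV : p + j ≤ V) :
    j * (1/V)^2 ≤ 1/p - 1/(p+j) := by
  have hV0 : 0 < V := by linarith
  have : 1/p - 1/(p+j) = j * ((1/p)*(1/(p+j))) := by field_simp; ring
  rw [this, sq]
  have : 1/V ≤ 1/p := one_div_le_one_div_of_le hp (by linarith)
  have : 1/V ≤ 1/(p+j) := one_div_le_one_div_of_le (by linarith) hV
  gcongr

lemma quad_diff (p q r s j V : ℝ) (hp : 0 < p) (hq : 0 < q) (hr : 0 < r) (hs : 0 < s)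
    (hj : 0 ≤ j) (p' : p + j ≤ V) (q' : q + j ≤ V) (r' : r + j ≤ V) (s' : s + j ≤ V) :
    4*j*(1/V)^5 ≤ 1/(p*q*r*s) - 1/((p+j)*(q+j)*(r+j)*(s+j)) := by
  have hV0 : 0 < V := by linarith
  have two : ∀ p q : ℝ, 0 < p → 0 < q → p + j ≤ V → q + j ≤ V →
      2*j*(1/V)^3 ≤ (1/p)*(1/q) - (1/(p+j))*(1/(q+j)) := by
    intro p q hp hq hp' hq'
    have := prod_diff (1/p) (1/(p+j)) (1/q) (1/(q+j)) (j*(1/V)^2) (j*(1/V)^2) (1/V) (1/V)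
      (inv_diff p j V hp hj hp') (inv_diff q j V hq hj hq')
      (one_div_le_one_div_of_le (by linarith) hp') (one_div_le_one_div_of_le hq (by linarith))
      (by positivity) (by positivity) (by positivity) (by positivity)
    refine le_trans (le_of_eq ?_) this
    ring
  have A := two p q hp hq p' q'
  have B := two r s hr hs r' s'
  have := prod_diff _ _ _ _ _ _ ((1/V)^2) ((1/V)^2) A B
    (by
      rw [sq]
      have := one_div_le_one_div_of_le (by linarith) p'
      have := one_div_le_one_div_of_le (by linarith) q'
      gcongr)
    (by
      rw [sq]
      have : 1/V ≤ 1/r := one_div_le_one_div_of_le hr (by linarith)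
      have : 1/V ≤ 1/s := one_div_le_one_div_of_le hs (by linarith)
      gcongr) (by positivity) (by positivity) (by positivity) (by positivity)
  have e1 : 1/(p*q*r*s) = (1/p)*(1/q)*((1/r)*(1/s)) := by field_simp
  have e2 : 1/((p+j)*(q+j)*(r+j)*(s+j)) = (1/(p+j))*(1/(q+j))*((1/(r+j))*(1/(s+j))) := by
    have : 0 < p + j := by linarith
    have : 0 < q + j := by linarith
    have : 0 < r + j := by linarith
    have : 0 < s + j := by linarith
    field_simp
  rw [e1, e2]
  refine le_trans (le_of_eq ?_) this
  ring

lemma phi_diff (u v w j V : ℝ) (hu : 0 < u) (huv : u ≤ v) (hvw : v ≤ w) (hj : 0 ≤ j)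
    (hV : w + j ≤ V) :
    12*j*(1/V)^5 ≤ (1/(u^2*v*w) + 1/(u*v^2*w) + 1/(u*v*w^2))
      - (1/((u+j)^2*(v+j)*(w+j)) + 1/((u+j)*(v+j)^2*(w+j)) + 1/((u+j)*(v+j)*(w+j)^2)) := by
  have hv : 0 < v := by linarith
  have hw : 0 < w := by linarith
  have a1 := quad_diff u u v w j V hu hu hv hw hj (by linarith) (by linarith) (by linarith) (by linarith)
  have a2 := quad_diff u v v w j V hu hv hv hw hj (by linarith) (by linarith) (by linarith) (by linarith)
  have a3 := quad_diff u v w w j V hu hv hw hw hj (by linarith) (by linarith) (by linarith) (by linarith)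
  have e1 : u^2*v*w = u*u*v*w := by ring
  have e2 : u*v^2*w = u*v*v*w := by ring
  have e3 : u*v*w^2 = u*v*w*w := by ring
  have e4 : (u+j)^2*(v+j)*(w+j) = (u+j)*(u+j)*(v+j)*(w+j) := by ring
  have e5 : (u+j)*(v+j)^2*(w+j) = (u+j)*(v+j)*(v+j)*(w+j) := by ring
  have e6 : (u+j)*(v+j)*(w+j)^2 = (u+j)*(v+j)*(w+j)*(w+j) := by ring
  rw [e1, e2, e3, e4, e5, e6]
  linarith

def SGood (y : ℝ) (m : ℕ → ℕ) (u : ℕ) : Prop :=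
  y^4 < (m u : ℝ) * (u:ℝ)^2 ∧ (m u : ℝ) * (u:ℝ)^2 ≤ y^4 + 3.8*y ∧ (u:ℝ) ≤ 2*y^2

lemma same_k (y t a b j u k : ℝ) (ht : 0 < t) (hy : 0 < y) (hu : t*y < u) (ha : 1 ≤ a) (hb : 1 ≤ b)
    (hj : 0 ≤ j) (hV : u + a + b + j ≤ 2*t*y)
    (h1 : |k - y^4*(a*b*(a+b)*(1/(u^2*(u+a)*(u+a+b)) + 1/(u*(u+a)^2*(u+a+b)) + 1/(u*(u+a)*(u+a+b)^2)))|
      ≤ (a+b)*(3.8*y/u^2))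
    (h2 : |k - y^4*(a*b*(a+b)*(1/((u+j)^2*(u+a+j)*(u+a+b+j)) + 1/((u+j)*(u+a+j)^2*(u+a+b+j)) + 1/((u+j)*(u+a+j)*(u+a+b+j)^2)))|
      ≤ (a+b)*(3.8*y/(u+j)^2)) :
    j ≤ 20.3*t^3/(a*b) := by
  have hu0 : 0 < u := lt_trans (by positivity) hu
  have pd := phi_diff u (u+a) (u+a+b) j (2*t*y) hu0 (by linarith) (by linarith) hj hV
  set P := (1/(u^2*(u+a)*(u+a+b)) + 1/(u*(u+a)^2*(u+a+b)) + 1/(u*(u+a)*(u+a+b)^2))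
  set Q := (1/((u+j)^2*(u+a+j)*(u+a+b+j)) + 1/((u+j)*(u+a+j)^2*(u+a+b+j)) + 1/((u+j)*(u+a+j)*(u+a+b+j)^2))
  have c1 : (a+b)*(3.8*y/u^2) ≤ (a+b)*(3.8*y/(t*y)^2) := by gcongr
  have c2 : (a+b)*(3.8*y/(u+j)^2) ≤ (a+b)*(3.8*y/(t*y)^2) := by gcongr; linarith
  have d1 := (abs_le.1 (h1.trans c1)).1
  have d2 := (abs_le.1 (h2.trans c2)).2
  have e : y^4*(a*b*(a+b)*(12*j*(1/(2*t*y))^5)) ≤ y^4*(a*b*(a+b)*(P-Q)) := by gcongr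
  have e2 : y^4*(a*b*(a+b)*(12*j*(1/(2*t*y))^5)) ≤ 2*((a+b)*(3.8*y/(t*y)^2)) := by
    linarith
  have e3 : y^4*(a*b*(a+b)*(12*j*(1/(2*t*y))^5)) = ((a+b)/(t^5*y))*(a*b*j*(12/32)) := by
    field_simp; ring
  have e4 : 2*((a+b)*(3.8*y/(t*y)^2)) = ((a+b)/(t^5*y))*(7.6*t^3) := by
    field_simp; norm_num
  rw [e3, e4] at e2
  have e5 := le_of_mul_le_mul_left e2 (by positivity)
  rw [le_div_iff₀ (by positivity)]
  have : 0 < t^3 := by positivity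
  linarith

lemma pair_card (y t : ℝ) (m : ℕ → ℕ) (B : Finset ℕ) (D a b : ℕ) (hy : 5*10^11 ≤ y)
    (ht : 1/2 ≤ t) (ht' : t ≤ 512) (hD : D ≤ 5000) (ha : 1 ≤ a) (hb : 1 ≤ b) (hab : a + b ≤ D)
    (hB : ∀ u ∈ B, SGood y m u ∧ t*y < u ∧ (u:ℝ) ≤ 2*t*y) :
    ((B.filter (fun u => u + a ∈ B ∧ u + a + b ∈ B)).card : ℝ)
      ≤ 0.75*(D:ℝ)^3/t^4 + 61*D/t + 1 := by
  set C := B.filter (fun u => u + a ∈ B ∧ u + a + b ∈ B) with hC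
  have hy0 : 0 < y := by linarith
  have ht0 : 0 < t := by linarith
  have haR : (1:ℝ) ≤ a := by exact_mod_cast ha
  have hbR : (1:ℝ) ≤ b := by exact_mod_cast hb
  have habR : (a:ℝ) + b ≤ D := by exact_mod_cast hab
  have hDR : (D:ℝ) ≤ 5000 := by exact_mod_cast hD
  let k : ℕ → ℤ := fun u => (b:ℤ) * m u - (a+b) * m (u+a) + a * m (u+a+b)
  have facts : ∀ u ∈ C, t*y < u ∧ (u:ℝ)+a+b ≤ 2*t*y ∧ 0 < k u ∧
      |(k u:ℝ) - y^4*(a*b*(a+b)*(1/((u:ℝ)^2*(u+a)*(u+a+b)) + 1/(u*(u+a)^2*(u+a+b)) + 1/(u*(u+a)*(u+a+b)^2)))|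
      ≤ (a+b)*(3.8*y/(u:ℝ)^2) := by
    intro u hu
    rw [hC, Finset.mem_filter] at hu
    obtain ⟨h1, h2, h3⟩ := hu
    obtain ⟨⟨g1, g1', g1''⟩, l1, l1'⟩ := hB u h1
    obtain ⟨⟨g2, g2', g2''⟩, l2, l2'⟩ := hB _ h2
    obtain ⟨⟨g3, g3', g3''⟩, l3, l3'⟩ := hB _ h3
    push_cast at g2 g2' g2'' l2 l2' g3 g3' g3'' l3 l3'
    have hu0 : (0:ℝ) < u := lt_trans (by positivity) l1
    have hty : 2.5*10^11 ≤ t*y := by nlinarith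
    have kp := k_pos y u (u+a) (u+a+b) (m u) (m (u+a)) (m (u+a+b)) (by linarith) hu0 (by linarith)
      (by linarith) g3'' (by linarith) g1 g1' g2 g2' g3 g3'
    have ka := k_approx y u (u+a) (u+a+b) (m u) (m (u+a)) (m (u+a+b)) hy0 hu0 (by linarith)
      (by linarith) g1 g1' g2 g2' g3 g3'
    have s1 : (u:ℝ)+a+b-(u+a) = b := by ring
    have s2 : (u:ℝ)+a+b-u = a+b := by ring
    have s3 : (u:ℝ)+a-u = a := by ring
    rw [s1, s2, s3] at kp ka
    have kc : (k u : ℝ) = b * m u - (a+b) * m (u+a) + a * m (u+a+b) := by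
      simp only [k]; push_cast; ring
    refine ⟨l1, l3', ?_, ?_⟩
    · rw [← kc] at kp; exact_mod_cast kp
    · rw [kc]; exact ka
  set L : ℝ := 20.3*t^3/(a*b) with hL
  have hL0 : 0 ≤ L := by positivity
  set M : ℝ := 3*(a*b*(a+b))/t^4 + D*(3.8/(t^2*y)) with hM
  have hM0 : 0 ≤ M := by positivity
  have hk : ∀ u ∈ C, (k u : ℝ) ≤ M := by
    intro u hu
    obtain ⟨f1, f2, f3, f4⟩ := facts u hu
    have hu0 : (0:ℝ) < u := lt_trans (by positivity) f1
    have := (abs_le.1 f4).2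
    have p := phi_le u (u+a) (u+a+b) hu0 (by linarith) (by linarith)
    have q1 : y^4*(a*b*(a+b)*(1/((u:ℝ)^2*(u+a)*(u+a+b)) + 1/(u*(u+a)^2*(u+a+b)) + 1/(u*(u+a)*(u+a+b)^2)))
      ≤ y^4*(a*b*(a+b)*(3/(t*y)^4)) := by
      refine le_trans (b := y^4*(a*b*(a+b)*(3/(u:ℝ)^4))) (by gcongr) (by gcongr)
    have q2 : (a+b)*(3.8*y/(u:ℝ)^2) ≤ D*(3.8*y/(t*y)^2) := by gcongr
    have q3 : y^4*(a*b*(a+b)*(3/(t*y)^4)) = 3*(a*b*(a+b))/t^4 := by field_simp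
    have q4 : D*(3.8*y/(t*y)^2) = D*(3.8/(t^2*y)) := by field_simp
    rw [q3] at q1
    rw [q4] at q2
    linarith
  have step := Finset.card_le_mul_card_image_of_maps_to (s := C) (t := Finset.Icc 1 ⌊M⌋₊)
    (f := fun u => (k u).toNat)
    (by
      intro u hu
      have := (facts u hu).2.2.1
      rw [Finset.mem_Icc]
      refine ⟨by omega, Nat.le_floor ?_⟩
      refine le_trans (le_of_eq ?_) (hk u hu)
      have e : ((k u).toNat : ℤ) = k u := Int.toNat_of_nonneg this.le
      exact_mod_cast e) ⌊L+1⌋₊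
    (by
      intro c _
      apply Nat.le_floor
      apply diam_card _ _ hL0
      intro u hu v hv huv
      rw [Finset.mem_filter] at hu hv
      obtain ⟨f1, f2, f3, f4⟩ := facts u hu.1
      obtain ⟨g1, g2, g3, g4⟩ := facts v hv.1
      have hkk : k u = k v := by have := hu.2; have := hv.2; omega
      have hR : (u:ℝ) < v := by exact_mod_cast huv
      have e1 : (v:ℝ) = u + (v-u) := by ring
      have e2 : (v:ℝ) + a = u + a + (v-u) := by ring
      have e3 : (v:ℝ) + a + b = u + a + b + (v-u) := by ring
      rw [hkk] at f4
      apply same_k y t a b (v-u) u (k v) ht0 hy0 f1 haR hbR (by linarith) (by linarith) f4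
      rw [← e3, ← e2, ← e1]
      exact g4)
  rw [Nat.card_Icc] at step
  have s1 : (C.card : ℝ) ≤ (⌊L+1⌋₊ : ℝ) * (⌊M⌋₊ : ℝ) := by
    have : ⌊M⌋₊ + 1 - 1 = ⌊M⌋₊ := by omega
    rw [this] at step
    exact_mod_cast step
  have s2 : (C.card : ℝ) ≤ (L+1)*M := by
    refine s1.trans ?_
    gcongr
    · exact Nat.floor_le (by linarith)
    · exact Nat.floor_le hM0
  refine s2.trans ?_
  have m1 : 3*((a:ℝ)*b*(a+b))/t^4 ≤ 0.75*(D:ℝ)^3/t^4 := by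
    gcongr ?_ / _
    have := abc_le a b (by linarith) (by linarith)
    have : ((a:ℝ)+b)^3 ≤ (D:ℝ)^3 := by gcongr
    linarith
  have m2 : L*(3*((a:ℝ)*b*(a+b))/t^4) ≤ 61*D/t := by
    have : L*(3*((a:ℝ)*b*(a+b))/t^4) = 60.9*(a+b)/t := by
      rw [hL]; field_simp; norm_num
    rw [this]
    gcongr ?_ / _
    linarith
  have m3 : (L+1)*(D*(3.8/(t^2*y))) ≤ 1 := by
    have l1 : L ≤ 20.3*t^3 := by
      rw [hL]
      apply div_le_self (by positivity)
      nlinarith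
    have : (L+1)*(D*(3.8/(t^2*y))) ≤ (20.3*t^3+1)*(5000*(3.8/(t^2*(5*10^11)))) := by gcongr
    refine this.trans ?_
    have e : (20.3*t^3+1)*(5000*(3.8/(t^2*(5*10^11)))) = (20.3*t + 1/t^2)*(5000*3.8/(5*10^11)) := by
      field_simp
    rw [e]
    have : 1/t^2 ≤ 1/(1/2)^2 := by gcongr
    have : 20.3*t + 1/t^2 ≤ 20.3*512 + 4 := by linarith
    nlinarith
  have : (L+1)*M = L*(3*((a:ℝ)*b*(a+b))/t^4) + 3*((a:ℝ)*b*(a+b))/t^4 + (L+1)*(D*(3.8/(t^2*y))) := by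
    rw [hM]; ring
  linarith

lemma mid_card (y t : ℝ) (m : ℕ → ℕ) (B : Finset ℕ) (D : ℕ) (hy : 5*10^11 ≤ y)
    (ht : 1/2 ≤ t) (ht' : t ≤ 512) (hD : D ≤ 5000) (hD1 : 1 ≤ D)
    (hB : ∀ u ∈ B, SGood y m u ∧ t*y < u ∧ (u:ℝ) ≤ 2*t*y) :
    (B.card : ℝ) ≤ 2*(t*y/D + 2) + (D:ℝ)^2*(0.75*(D:ℝ)^3/t^4 + 61*D/t + 1) := by
  classical
  have hy0 : 0 < y := by linarith
  have ht0 : 0 < t := by linarith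
  have hD0 : (1:ℝ) ≤ D := by exact_mod_cast hD1
  let I := ((Finset.Icc 1 D) ×ˢ (Finset.Icc 1 D)).filter (fun p => p.1 + p.2 ≤ D)
  let Bad := I.biUnion (fun p => B.filter (fun u => u + p.1 ∈ B ∧ u + p.1 + p.2 ∈ B))
  have bad1 : (Bad.card : ℝ) ≤ (D:ℝ)^2*(0.75*(D:ℝ)^3/t^4 + 61*D/t + 1) := by
    have h1 : (Bad.card : ℝ) ≤ ∑ p ∈ I, ((B.filter (fun u => u + p.1 ∈ B ∧ u + p.1 + p.2 ∈ B)).card : ℝ) := by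
      exact_mod_cast Finset.card_biUnion_le
    have h2 : ∑ p ∈ I, ((B.filter (fun u => u + p.1 ∈ B ∧ u + p.1 + p.2 ∈ B)).card : ℝ)
        ≤ I.card • (0.75*(D:ℝ)^3/t^4 + 61*D/t + 1) := by
      apply Finset.sum_le_card_nsmul
      intro p hp
      simp only [I, Finset.mem_filter, Finset.mem_product, Finset.mem_Icc] at hp
      exact pair_card y t m B D p.1 p.2 hy ht ht' hD hp.1.1.1 hp.1.2.1 hp.2 hB
    have h3 : (I.card : ℝ) ≤ (D:ℝ)^2 := by
      have : I.card ≤ D^2 := by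
        refine (Finset.card_filter_le _ _).trans ?_
        rw [Finset.card_product, Nat.card_Icc, sq]
        simp
      exact_mod_cast this
    rw [nsmul_eq_mul] at h2
    refine h1.trans (h2.trans ?_)
    gcongr
  have good1 : (B \ Bad).card ≤ 2 * (⌊t*y/D⌋₊ + 2) := by
    have hfl : (⌊t*y⌋₊:ℝ) ≤ t*y := Nat.floor_le (by positivity)
    have hfl' : t*y < ⌊t*y⌋₊ + 1 := Nat.lt_floor_add_one _
    have hge : ∀ u ∈ B, ⌊t*y⌋₊ ≤ u := by
      intro u hu
      have := (hB u hu).2.1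
      exact Nat.floor_le_of_le this.le
    apply comb_two _ (fun u => (u - ⌊t*y⌋₊)/D)
    · intro u hu
      rw [Finset.mem_sdiff] at hu
      have h1 := (hB u hu.1).2.2
      have h2 := hge u hu.1
      have : (u - ⌊t*y⌋₊)/D ≤ ⌊t*y/D⌋₊ + 1 := by
        have e : ⌊t*y/D⌋₊ + 1 = ⌊t*y/D + 1⌋₊ := by
          rw [Nat.floor_add_one (by positivity)]
        rw [e]
        apply Nat.le_floor
        refine Nat.cast_div_le.trans ?_
        rw [Nat.cast_sub h2, div_le_iff₀ (by linarith), add_mul, div_mul_cancel₀ _ (by linarith)]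
        linarith
      show (u - ⌊t*y⌋₊)/D < _
      omega
    · intro u hu v hv w hw huv hvw e1 e2
      rw [Finset.mem_sdiff] at hu hv hw
      apply hu.2
      have hu' := hge u hu.1
      have e3 := e1.trans e2
      have hlt : w - u < D := by
        have r1 := Nat.div_add_mod (u - ⌊t*y⌋₊) D
        have r2 := Nat.div_add_mod (w - ⌊t*y⌋₊) D
        have r3 := Nat.mod_lt (w - ⌊t*y⌋₊) (show 0 < D by omega)
        rw [e3] at r1
        omega
      simp only [Bad, I, Finset.mem_biUnion, Finset.mem_filter, Finset.mem_product, Finset.mem_Icc]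
      refine ⟨(v-u, w-v), ⟨⟨⟨by dsimp only; omega, by dsimp only; omega⟩, ⟨by dsimp only; omega, by dsimp only; omega⟩⟩, by dsimp only; omega⟩, hu.1, ?_, ?_⟩
      · have : u + (v-u) = v := by omega
        rw [this]; exact hv.1
      · have : u + (v-u) + (w - v) = w := by omega
        rw [this]; exact hw.1
  have good2 : ((B \ Bad).card : ℝ) ≤ 2*(t*y/D + 2) := by
    have : ((B \ Bad).card : ℝ) ≤ 2 * (⌊t*y/D⌋₊ + 2) := by exact_mod_cast good1
    have h : (⌊t*y/D⌋₊:ℝ) ≤ t*y/D := Nat.floor_le (by positivity)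
    linarith
  have tot : (B.card : ℝ) ≤ (B \ Bad).card + Bad.card := by
    have : B.card ≤ (B \ Bad).card + Bad.card := Finset.card_le_card_sdiff_add_card
    exact_mod_cast this
  linarith

lemma aux7 (p q : ℝ) (hp : 0 < p) (hq : 0 < q) (hpq : p < q) (hc : q^3 ≤ 1.01*p^3) :
    p*q*(q^2+q*p+p^2) ≤ 3.03*p^4 := by
  have a1 : q^2+q*p+p^2 ≤ 3*q^2 := by nlinarith
  have a2 : p*q*(q^2+q*p+p^2) ≤ p*q*(3*q^2) := by gcongr
  have a3 : p*(3*q^3) ≤ p*(3*(1.01*p^3)) := by gcongr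
  have a4 : p*q*(3*q^2) = p*(3*q^3) := by ring
  have a5 : p*(3*(1.01*p^3)) = 3.03*p^4 := by ring
  linarith

lemma basic_triple (y Y p q v : ℝ) (m1 m2 m3 : ℕ) (hy : 5*10^11 ≤ y) (hY : 0 < Y) (hYy : Y^3 = y)
    (hp : 0 < p) (hq : 0 < q) (hu : 512*y < p^3) (huv : p^3 + 1 ≤ v) (hvw : v + 1 ≤ q^3)
    (hw : q^3 ≤ 2*y^2)
    (h1 : y^4 < m1*(p^3)^2) (h1' : m1*(p^3)^2 ≤ y^4+3.8*y)
    (h2 : y^4 < m2*v^2) (h2' : m2*v^2 ≤ y^4+3.8*y)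
    (h3 : y^4 < m3*(q^3)^2) (h3' : m3*(q^3)^2 ≤ y^4+3.8*y)
    (k : ℤ) (hk : (k:ℝ) = (q^3-v)*m1 - (q^3-p^3)*m2 + (v-p^3)*m3) :
    0.359/Y^4 ≤ 1/p - 1/q := by
  have hy0 : 0 < y := by linarith
  have hpq : p < q := by
    apply lt_of_pow_lt_pow_left₀ 3 hq.le; linarith
  by_cases hc : q^3 ≤ 1.01*p^3
  · have hp3 : 0 < p^3 := by positivity
    have kp := k_pos y (p^3) v (q^3) m1 m2 m3 (by linarith) hp3 huv hvw hw hc h1 h1' h2 h2' h3 h3'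
    have ka := k_approx y (p^3) v (q^3) m1 m2 m3 hy0 hp3 (by linarith) (by linarith) h1 h1' h2 h2' h3 h3'
    rw [← hk] at kp ka
    have k1 : (1:ℝ) ≤ k := by
      have : 0 < k := by exact_mod_cast kp
      exact_mod_cast this
    have ka2 := (abs_le.1 ka).2
    have ph := phi_le (p^3) v (q^3) hp3 (by linarith) (by linarith)
    have ab := abc_le (v - p^3) (q^3 - v) (by linarith) (by linarith)
    have r0 : v - p^3 + (q^3 - v) = q^3 - p^3 := by ring
    rw [r0] at ab
    set s := q^3 - p^3 with hs
    have s0 : 0 < s := by linarith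
    have t1 : y^4*((v-p^3)*(q^3-v)*s*(1/((p^3)^2*v*q^3) + 1/((p^3)*v^2*q^3) + 1/((p^3)*v*(q^3)^2)))
        ≤ y^4*(s^3/4*(3/(p^3)^4)) := by
      have hv0 : 0 < v := by linarith
      have hn : 0 ≤ (1/((p^3)^2*v*q^3) + 1/((p^3)*v^2*q^3) + 1/((p^3)*v*(q^3)^2)) := by positivity
      exact mul_le_mul_of_nonneg_left (mul_le_mul ab ph hn (by positivity)) (by positivity)
    have t2 : s*(3.8*y/(p^3)^2) ≤ 0.01 := by
      have : s ≤ 0.01*p^3 := by linarith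
      have : s*(3.8*y/(p^3)^2) ≤ (0.01*p^3)*(3.8*y/(p^3)^2) := by gcongr
      refine this.trans ?_
      have e : (0.01*p^3)*(3.8*y/(p^3)^2) = 0.01*(3.8*y)/p^3 := by field_simp
      rw [e, div_le_iff₀ hp3]
      linarith
    have t3 : 0.99 ≤ y^4*(s^3/4*(3/(p^3)^4)) := by linarith
    have t4 : y^4*(s^3/4*(3/(p^3)^4)) = (s*Y^4/p^4)^3*0.75 := by
      rw [← hYy]; field_simp; norm_num
    rw [t4] at t3
    have t5 : 1.09 ≤ s*Y^4/p^4 := by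
      by_contra hcon
      push Not at hcon
      have : (s*Y^4/p^4)^3 < 1.09^3 := by gcongr
      norm_num at this t3
      linarith
    have t6 : 1/p - 1/q = s/(p*q*(q^2+q*p+p^2)) := by
      rw [hs]; field_simp; ring
    have t7 := aux7 p q hp hq hpq hc
    rw [t6]
    have t8 : s/(3.03*p^4) ≤ s/(p*q*(q^2+q*p+p^2)) := by gcongr
    refine le_trans ?_ t8
    rw [div_le_div_iff₀ (by positivity) (by positivity)]
    rw [le_div_iff₀ (by positivity)] at t5
    linarith [pow_pos hp 4]
  · push Not at hc
    have q1 : 1.003*p ≤ q := by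
      by_contra hcon
      push Not at hcon
      have : q^3 < (1.003*p)^3 := by gcongr
      nlinarith [pow_pos hp 3]
    have q2 : 1/q ≤ 1/(1.003*p) := by gcongr
    have q3 : p ≤ 1.26*Y^2 := by
      by_contra hcon
      push Not at hcon
      have : (1.26*Y^2)^3 < p^3 := by gcongr
      have e : (1.26*Y^2)^3 = 2.000376*y^2 := by rw [← hYy]; ring
      have : p^3 < q^3 := by linarith
      nlinarith
    have q4 : 1000 ≤ Y := by
      by_contra hcon
      push Not at hcon
      have : Y^3 < 1000^3 := by gcongr
      norm_num at this
      linarith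
    have q5 : 1000*Y^3 ≤ Y*Y^3 := by gcongr
    have q6 : 1000*Y^2 ≤ Y*Y^2 := by gcongr
    have e : 1/(1.003*p) = (1/p)*(1/1.003) := by field_simp
    have q7 : 0.359/Y^4 ≤ 0.0029*(1/p) := by
      rw [mul_one_div, div_le_div_iff₀ (by positivity) (by positivity)]
      nlinarith
    have q8 : (1/p)*(1/1.003) ≤ (1/p)*0.9971 := by gcongr; norm_num
    linarith

lemma basic_card (y : ℝ) (m : ℕ → ℕ) (B : Finset ℕ) (hy : 5*10^11 ≤ y)
    (hB : ∀ u ∈ B, SGood y m u ∧ 512*y < u) :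
    (B.card : ℝ) ≤ 0.7*y := by
  have hy0 : 0 < y := by linarith
  have cube : ∀ z : ℝ, 0 < z → 0 < z^((1:ℝ)/3) ∧ (z^((1:ℝ)/3))^3 = z := by
    intro z hz
    refine ⟨by positivity, ?_⟩
    rw [← Real.rpow_natCast, ← Real.rpow_mul hz.le]
    norm_num
  obtain ⟨hY, hYy⟩ := cube y hy0
  set Y := y^((1:ℝ)/3)
  let r : ℕ → ℝ := fun u => (u:ℝ)^((1:ℝ)/3)
  have hr : ∀ u ∈ B, 0 < r u ∧ (r u)^3 = u := by
    intro u hu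
    apply cube
    linarith [(hB u hu).2]
  have bound : ∀ u ∈ B, 1/r u ≤ 1/(8*Y) := by
    intro u hu
    obtain ⟨h1, h2⟩ := hr u hu
    have : 8*Y ≤ r u := by
      by_contra hcon
      push Not at hcon
      have : (r u)^3 < (8*Y)^3 := by gcongr
      rw [h2, mul_pow, hYy] at this
      linarith [(hB u hu).2]
    gcongr
  set δ : ℝ := 0.359/Y^4 with hδ
  have hδ0 : 0 < δ := by positivity
  have main := comb_two B (fun u => ⌊(1/(8*Y) - 1/r u)/δ⌋₊) (⌊y/2.872⌋₊ + 1)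
    (by
      intro u hu
      obtain ⟨h1, h2⟩ := hr u hu
      apply Nat.lt_succ_of_le
      apply Nat.floor_le_floor
      rw [div_le_iff₀ hδ0]
      have e : y/2.872*δ = 1/(8*Y) := by
        rw [hδ, ← hYy]; field_simp; norm_num
      rw [e]
      have : 0 < 1/r u := by positivity
      linarith)
    (by
      intro u hu v hv w hw huv hvw e1 e2
      have e3 := e1.trans e2
      obtain ⟨hu1, hu2⟩ := hr u hu
      obtain ⟨hw1, hw2⟩ := hr w hw
      obtain ⟨⟨g1, g1', g1''⟩, l1⟩ := hB u hu
      obtain ⟨⟨g2, g2', g2''⟩, l2⟩ := hB v hv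
      obtain ⟨⟨g3, g3', g3''⟩, l3⟩ := hB w hw
      have c1 : (u:ℝ) + 1 ≤ v := by exact_mod_cast huv
      have c2 : (v:ℝ) + 1 ≤ w := by exact_mod_cast hvw
      rw [← hu2] at g1 g1' l1 c1
      rw [← hw2] at g3 g3' g3'' c2
      have key := basic_triple y Y (r u) (r w) v (m u) (m v) (m w) hy hY hYy hu1 hw1 l1 c1 c2 g3''
        g1 g1' g2 g2' g3 g3' (((w:ℤ)-v)*m u - ((w:ℤ)-u)*m v + ((v:ℤ)-u)*m w)
        (by rw [hu2, hw2]; push_cast; ring)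
      rw [← hδ] at key
      have f1 : (1/(8*Y) - 1/r u)/δ + 1 ≤ (1/(8*Y) - 1/r w)/δ := by
        rw [div_add_one hδ0.ne']
        gcongr ?_ / _
        linarith
      have f2 : 0 ≤ (1/(8*Y) - 1/r u)/δ := div_nonneg (by linarith [bound u hu]) hδ0.le
      have f3 := Nat.floor_le_floor f1
      rw [Nat.floor_add_one f2] at f3
      omega)
  have main' : (B.card : ℝ) ≤ 2*(⌊y/2.872⌋₊ + 1) := by exact_mod_cast main
  have : (⌊y/2.872⌋₊:ℝ) ≤ y/2.872 := Nat.floor_le (by positivity)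
  have e : y/2.872 ≤ 0.349*y := by
    rw [div_le_iff₀ (by norm_num)]; nlinarith
  linarith

lemma dvd_card (y : ℝ) (hy : 0 < y) (T : Finset ℕ) (hT : ∀ n ∈ T, y^4 < n ∧ (n:ℝ) ≤ y^4 + 3.8*y)
    (d : ℕ) (hd : 1 ≤ d) :
    ((T.filter (fun n => d^2 ∣ n)).card : ℝ) ≤ 3.8*y/(d:ℝ)^2 + 1 := by
  have hd0 : (0:ℝ) < d := by exact_mod_cast hd
  have hd2 : 0 < d^2 := by positivity
  have hinj : Set.InjOn (fun n => n / d^2) (T.filter (fun n => d^2 ∣ n) : Finset ℕ) := by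
    intro p hp q hq h
    simp only [Finset.coe_filter, Set.mem_ofPred_eq] at hp hq
    simp only at h
    rw [← Nat.div_mul_cancel hp.2, ← Nat.div_mul_cancel hq.2, h]
  rw [← Finset.card_image_of_injOn hinj]
  apply diam_card _ _ (by positivity)
  intro u hu v hv _
  rw [Finset.mem_image] at hu hv
  obtain ⟨p, hp, rfl⟩ := hu
  obtain ⟨q, hq, rfl⟩ := hv
  rw [Finset.mem_filter] at hp hq
  rw [Nat.cast_div hp.2 (by positivity), Nat.cast_div hq.2 (by positivity), ← sub_div]
  push_cast
  gcongr ?_ / _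
  linarith [(hT p hp.1).1, (hT q hq.1).2]

lemma odd_sum (K : ℕ) : ∑ k ∈ Finset.Icc 1 K, 1/(2*(k:ℝ)+1)^2 ≤ 1/4 - 1/(4*((K:ℝ)+1)) := by
  induction K with
  | zero => simp
  | succ K ih =>
    rw [Finset.sum_Icc_succ_top (by omega)]
    have : 1/(2*((K+1:ℕ):ℝ)+1)^2 ≤ 1/(4*((K:ℝ)+1)) - 1/(4*(((K+1:ℕ):ℝ)+1)) := by
      push_cast
      have e : 1/(4*((K:ℝ)+1)) - 1/(4*((K:ℝ)+1+1)) = 1/(4*((K:ℝ)+1)*(K+2)) := by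
        field_simp; ring
      rw [e]
      apply one_div_le_one_div_of_le (by positivity)
      nlinarith
    linarith

lemma step_card (y t : ℝ) (m : ℕ → ℕ) (A : Finset ℕ) (D : ℕ) (hy : 5*10^11 ≤ y)
    (ht : 1/2 ≤ t) (ht' : t ≤ 512) (hD : D ≤ 5000) (hD1 : 1 ≤ D)
    (hA : ∀ u ∈ A, SGood y m u) (s : ℝ) (hs : s = 2*t) :
    ((A.filter (fun u : ℕ => t*y < u)).card : ℝ) ≤ 2*(t*y/D + 2) + (D:ℝ)^2*(0.75*(D:ℝ)^3/t^4 + 61*D/t + 1)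
      + ((A.filter (fun u : ℕ => s*y < u)).card : ℝ) := by
  subst hs
  have h := mid_card y t m (A.filter (fun u : ℕ => t*y < u ∧ (u:ℝ) ≤ 2*t*y)) D hy ht ht' hD hD1 (by
    intro u hu
    rw [Finset.mem_filter] at hu
    exact ⟨hA u hu.1, hu.2⟩)
  have hsub : A.filter (fun u : ℕ => t*y < u) ⊆ (A.filter (fun u : ℕ => t*y < u ∧ (u:ℝ) ≤ 2*t*y)) ∪
      (A.filter (fun u : ℕ => 2*t*y < u)) := by
    intro u hu
    rw [Finset.mem_filter] at hu
    rw [Finset.mem_union, Finset.mem_filter, Finset.mem_filter]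
    rcases le_or_gt (u:ℝ) (2*t*y) with h | h
    · exact Or.inl ⟨hu.1, hu.2, h⟩
    · exact Or.inr ⟨hu.1, h⟩
  have c := (Finset.card_le_card hsub).trans (Finset.card_union_le _ _)
  have c' : ((A.filter (fun u : ℕ => t*y < u)).card : ℝ) ≤
    ((A.filter (fun u : ℕ => t*y < u ∧ (u:ℝ) ≤ 2*t*y)).card : ℝ) + ((A.filter (fun u : ℕ => 2*t*y < u)).card : ℝ) := by
    exact_mod_cast c
  linarith

lemma all_card (y : ℝ) (m : ℕ → ℕ) (A : Finset ℕ) (hy : 5*10^11 ≤ y)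
    (hA : ∀ u ∈ A, SGood y m u) :
    ((A.filter (fun u : ℕ => (1/2)*y < u)).card : ℝ) ≤ 1.5*y := by
  have s0 := step_card y (1/2) m A 60 hy (by norm_num) (by norm_num) (by norm_num) (by norm_num) hA 1 (by norm_num)
  have s1 := step_card y 1 m A 100 hy (by norm_num) (by norm_num) (by norm_num) (by norm_num) hA 2 (by norm_num)
  have s2 := step_card y 2 m A 180 hy (by norm_num) (by norm_num) (by norm_num) (by norm_num) hA 4 (by norm_num)
  have s3 := step_card y 4 m A 300 hy (by norm_num) (by norm_num) (by norm_num) (by norm_num) hA 8 (by norm_num)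
  have s4 := step_card y 8 m A 500 hy (by norm_num) (by norm_num) (by norm_num) (by norm_num) hA 16 (by norm_num)
  have s5 := step_card y 16 m A 900 hy (by norm_num) (by norm_num) (by norm_num) (by norm_num) hA 32 (by norm_num)
  have s6 := step_card y 32 m A 1200 hy (by norm_num) (by norm_num) (by norm_num) (by norm_num) hA 64 (by norm_num)
  have s7 := step_card y 64 m A 2000 hy (by norm_num) (by norm_num) (by norm_num) (by norm_num) hA 128 (by norm_num)
  have s8 := step_card y 128 m A 3000 hy (by norm_num) (by norm_num) (by norm_num) (by norm_num) hA 256 (by norm_num)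
  have s9 := step_card y 256 m A 4000 hy (by norm_num) (by norm_num) (by norm_num) (by norm_num) hA 512 (by norm_num)
  have b := basic_card y m (A.filter (fun u : ℕ => 512*y < u)) hy (by
    intro u hu
    rw [Finset.mem_filter] at hu
    exact ⟨hA u hu.1, hu.2⟩)
  push_cast at s0 s1 s2 s3 s4 s5 s6 s7 s8 s9
  linarith

lemma core (y : ℝ) (hy : 5*10^11 ≤ y) :
    ∃ n : ℕ, y^4 < (n:ℝ) ∧ (n:ℝ) ≤ y^4 + 3.8*y ∧ Squarefree n := by
  classical
  by_contra hcon
  push Not at hcon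
  have hy0 : 0 < y := by linarith
  set T := Finset.Ioc ⌊y^4⌋₊ ⌊y^4+3.8*y⌋₊ with hTdef
  have hT : ∀ n ∈ T, y^4 < n ∧ (n:ℝ) ≤ y^4 + 3.8*y := by
    intro n hn
    rw [hTdef, Finset.mem_Ioc, Nat.floor_lt (by positivity), Nat.le_floor_iff (by positivity)] at hn
    exact hn
  have hcard : 3.8*y - 1 ≤ (T.card : ℝ) := by
    have h1 : ⌊y^4⌋₊ ≤ ⌊y^4+3.8*y⌋₊ := Nat.floor_le_floor (by linarith)
    rw [hTdef, Nat.card_Ioc, Nat.cast_sub h1]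
    have h2 := Nat.floor_le (show 0 ≤ y^4 by positivity)
    have h3 := Nat.lt_floor_add_one (y^4+3.8*y)
    linarith
  set K := ⌊y/4⌋₊ with hK
  have hK1 : (K:ℝ) ≤ y/4 := Nat.floor_le (by positivity)
  have hK2 : y/4 < K + 1 := Nat.lt_floor_add_one _
  let A0 := (Finset.range (⌊2*y^2⌋₊+1)).filter (fun u => ∃ n ∈ T, u^2 ∣ n)
  have hA0 : ∀ u ∈ A0, ∃ k : ℕ, y^4 < (k:ℝ)*(u:ℝ)^2 ∧ (k:ℝ)*(u:ℝ)^2 ≤ y^4+3.8*y ∧ (u:ℝ) ≤ 2*y^2 := by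
    intro u hu
    simp only [A0, Finset.mem_filter, Finset.mem_range] at hu
    obtain ⟨h1, n, hn, k, rfl⟩ := hu
    have := hT _ hn
    push_cast at this
    refine ⟨k, by linarith, by linarith, ?_⟩
    exact (Nat.le_floor_iff (by positivity)).1 (by omega)
  have hm : ∃ m : ℕ → ℕ, ∀ u ∈ A0, SGood y m u := by
    choose! m hm using hA0
    exact ⟨m, hm⟩
  obtain ⟨m, hm⟩ := hm
  have hAc := all_card y m A0 hy hm
  set A := A0.filter (fun u : ℕ => (1/2)*y < u) with hA
  have hsub : T ⊆ T.filter (fun n => 2^2 ∣ n) ∪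
      (Finset.Icc 1 K).biUnion (fun k => T.filter (fun n => (2*k+1)^2 ∣ n)) ∪
      A.biUnion (fun u => T.filter (fun n => u^2 ∣ n)) := by
    intro n hn
    obtain ⟨n1, n2⟩ := hT n hn
    have hns := hcon n n1 n2
    rw [Nat.squarefree_iff_prime_squarefree] at hns
    push Not at hns
    obtain ⟨p, hp, hpn⟩ := hns
    rw [← sq] at hpn
    have hn0 : 0 < n := by
      have : (0:ℝ) < n := lt_trans (by positivity) n1
      exact_mod_cast this
    simp only [Finset.mem_union, Finset.mem_biUnion, Finset.mem_filter, Finset.mem_Icc]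
    rcases hp.eq_two_or_odd' with rfl | ⟨k, hk⟩
    · exact Or.inl (Or.inl ⟨hn, hpn⟩)
    · have hk1 : 1 ≤ k := by
        rcases Nat.eq_zero_or_pos k with h | h
        · subst h; exact absurd hp (by rw [hk]; norm_num)
        · exact h
      by_cases hkK : k ≤ K
      · exact Or.inl (Or.inr ⟨k, ⟨hk1, hkK⟩, hn, hk ▸ hpn⟩)
      · refine Or.inr ⟨p, ?_, hn, hpn⟩
        simp only [hA, A0, Finset.mem_filter, Finset.mem_range]
        refine ⟨⟨?_, n, hn, hpn⟩, ?_⟩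
        · apply Nat.lt_succ_of_le
          apply Nat.le_floor
          have h1 : p^2 ≤ n := Nat.le_of_dvd hn0 hpn
          have h2 : (p:ℝ)^2 ≤ n := by exact_mod_cast h1
          apply le_of_sq_le_sq _ (by positivity)
          have : 3.8*y ≤ 3*y^4 := by
            have : y*2 ≤ y*y^3 := by
              gcongr
              exact le_trans (by linarith) (le_self_pow₀ (show 1 ≤ y by linarith) (show 3 ≠ 0 by norm_num))
            have e : y*y^3 = y^4 := by ring
            linarith
          nlinarith
        · have : K + 1 ≤ k := by omega
          have : (K:ℝ) + 1 ≤ k := by exact_mod_cast this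
          have : (p:ℝ) = 2*k+1 := by exact_mod_cast hk
          linarith
  have c1 : T.card ≤ (T.filter (fun n => 2^2 ∣ n)).card +
      (∑ k ∈ Finset.Icc 1 K, (T.filter (fun n => (2*k+1)^2 ∣ n)).card) +
      ∑ u ∈ A, (T.filter (fun n => u^2 ∣ n)).card := by
    refine (Finset.card_le_card hsub).trans ((Finset.card_union_le _ _).trans ?_)
    refine add_le_add ((Finset.card_union_le _ _).trans ?_) Finset.card_biUnion_le
    exact add_le_add le_rfl Finset.card_biUnion_le
  have c2 : ((T.filter (fun n => 2^2 ∣ n)).card : ℝ) ≤ 3.8*y/4 + 1 := by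
    have := dvd_card y hy0 T hT 2 (by norm_num)
    norm_num at this ⊢
    exact this
  have c3 : ∑ k ∈ Finset.Icc 1 K, ((T.filter (fun n => (2*k+1)^2 ∣ n)).card : ℝ) ≤ 3.8*y/4 + y/4 := by
    have h1 : ∑ k ∈ Finset.Icc 1 K, ((T.filter (fun n => (2*k+1)^2 ∣ n)).card : ℝ) ≤
        ∑ k ∈ Finset.Icc 1 K, (3.8*y*(1/(2*(k:ℝ)+1)^2) + 1) := by
      apply Finset.sum_le_sum
      intro k _
      have := dvd_card y hy0 T hT (2*k+1) (by omega)
      push_cast at this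
      rw [mul_one_div]
      exact this
    rw [Finset.sum_add_distrib, ← Finset.mul_sum] at h1
    have h2 := odd_sum K
    have h3 : 0 ≤ 1/(4*((K:ℝ)+1)) := by positivity
    have h4 : 3.8*y*(∑ k ∈ Finset.Icc 1 K, 1/(2*(k:ℝ)+1)^2) ≤ 3.8*y*(1/4) := by
      gcongr
      linarith
    simp only [Finset.sum_const, Nat.card_Icc, nsmul_eq_mul, mul_one, Nat.add_sub_cancel] at h1
    linarith
  have c4 : ∑ u ∈ A, (T.filter (fun n => u^2 ∣ n)).card ≤ A.card := by
    rw [Finset.card_eq_sum_ones]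
    apply Finset.sum_le_sum
    intro u hu
    have hu2 : (1/2)*y < u := by
      rw [hA, Finset.mem_filter] at hu; exact hu.2
    have hu0 : (0:ℝ) < u := lt_trans (by positivity) hu2
    have h := dvd_card y hy0 T hT u (by exact_mod_cast hu0)
    have : 3.8*y/(u:ℝ)^2 < 1 := by
      rw [div_lt_one (by positivity)]
      nlinarith
    have h' : ((T.filter (fun n => u^2 ∣ n)).card : ℝ) < 2 := by linarith
    have h'' : (T.filter (fun n => u^2 ∣ n)).card < 2 := by exact_mod_cast h'
    omega
  have c5 : (T.card : ℝ) ≤ ((T.filter (fun n => 2^2 ∣ n)).card : ℝ) +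
      (∑ k ∈ Finset.Icc 1 K, ((T.filter (fun n => (2*k+1)^2 ∣ n)).card : ℝ)) + A.card := by
    have := c1.trans (add_le_add le_rfl c4)
    exact_mod_cast this
  have c6 := hcard.trans (c5.trans (add_le_add (add_le_add c2 c3) hAc))
  clear_value A T K
  clear hcon hsub c1 c2 c3 c4 c5 hAc hm hA0
  linarith

/-- For every real `x ≥ e^{109}`, the interval `(x, x + 3.8·x^{1/4}]` contains a
squarefree integer. -/
theorem squarefree_in_interval_quarter' (x : ℝ) (hx : Real.exp 109 ≤ x) :
    ∃ n : ℕ, 0 < n ∧ x < (n : ℝ) ∧ (n : ℝ) ≤ x + 3.8 * x ^ ((1 : ℝ) / 4) ∧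
      Squarefree n := by
  have hx0 : 0 < x := lt_of_lt_of_le (Real.exp_pos _) hx
  have hy4 : (x ^ ((1 : ℝ) / 4))^4 = x := by
    rw [← Real.rpow_natCast, ← Real.rpow_mul hx0.le]
    norm_num
  have hy0 : 0 < x ^ ((1 : ℝ) / 4) := by positivity
  set y := x ^ ((1 : ℝ) / 4)
  have hy : 5*10^11 ≤ y := by
    by_contra hcon
    push Not at hcon
    have h1 : y^4 < (5*10^11)^4 := by gcongr
    have h2 : Real.exp 109 = (Real.exp 1)^109 := by
      rw [← Real.exp_nat_mul]; norm_num
    have h3 : (2.718:ℝ)^109 ≤ (Real.exp 1)^109 := by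
      have := Real.exp_one_gt_d9
      gcongr
      linarith
    have h4 : ((5:ℝ)*10^11)^4 ≤ 2.718^109 := by norm_num
    linarith
  obtain ⟨n, h1, h2, h3⟩ := core y hy
  rw [hy4] at h1 h2
  refine ⟨n, ?_, h1, h2, h3⟩
  have : (0:ℝ) < n := lt_trans hx0 h1
  exact_mod_cast this
end

section
/- Let x ≥ e^{41}, 1000 ≤ h ≤ 2·x^{1/3}, let λ ∈ (1, 1.05], let m ≥ 5, and let H, M be reals with m·h ≤ H ≤ M ≤ √(2x). If a, b are integers with 0 < a < 2a ≤ b and u, u + a, u + b, u + a + b are all elements of S(M), then exactly one of the following two conditions holds: a³·b < λ⁶·h·x^{-1}·M⁴, or a³·b > (0.5 − λ/m)·x^{-1}·M⁵. -/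
/-- `Sset x h M N` is the set `S(M,N)` of odd integers `u` with `M < u ≤ N` such that
`1 − h/u² ≤ {x/u²} < 1`, where `{θ}` denotes the fractional part. -/
def Sset (x h M N : ℝ) : Set ℤ :=
  {u : ℤ | Odd u ∧ M < (u : ℝ) ∧ (u : ℝ) ≤ N ∧
    1 - h / (u : ℝ) ^ 2 ≤ Int.fract (x / (u : ℝ) ^ 2) ∧ Int.fract (x / (u : ℝ) ^ 2) < 1}

lemma Sset_rep {x h M N : ℝ} {v : ℤ} (hv : v ∈ Sset x h M N) :
    ∃ (k : ℤ) (e : ℝ), x / (v:ℝ)^2 = k - e ∧ 0 ≤ e ∧ e ≤ h / (v:ℝ)^2 := by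
  obtain ⟨_, _, _, h1, h2⟩ := hv
  refine ⟨⌊x / (v:ℝ)^2⌋ + 1, 1 - Int.fract (x / (v:ℝ)^2), ?_, by linarith, by linarith⟩
  have := Int.floor_add_fract (x / (v:ℝ)^2)
  push_cast
  linarith

lemma term_bd {c v e h M : ℝ} (hM : 0 < M) (hc : 0 ≤ c) (hv : 0 < v) (h0 : 0 < h)
    (he : e ≤ h / v^2) (hcv : c * M < 2 * v^2) : c * e < 2 * h / M := by
  have h1 : c * e ≤ c * (h / v^2) := mul_le_mul_of_nonneg_left he hc
  refine lt_of_le_of_lt h1 ?_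
  rw [← mul_div_assoc, div_lt_div_iff₀ (by positivity) hM]
  nlinarith

lemma F_id (x w a : ℝ) (hw : 0 < w) (ha : 0 < a) :
    (2*w+3*a) * (x/(w+a)^2) - (2*w-a) * (x/w^2) = x * a^3 * (1/(w*(w+a)))^2 := by
  have : w + a ≠ 0 := by positivity
  field_simp
  ring

lemma diff_id (w a b : ℝ) (hw : 0 < w) (ha : 0 < a) (hb : 0 < b) :
    1/(w*(w+a)) - 1/((w+b)*(w+b+a)) = b * ((1/w + 1/(w+b+a)) * (1/((w+a)*(w+b)))) := by
  have : w + a ≠ 0 := by positivity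
  have : w + b ≠ 0 := by positivity
  have : w + b + a ≠ 0 := by positivity
  field_simp
  ring

lemma diff_upper (w a b M : ℝ) (hM : 0 < M) (hw : M < w) (ha : 0 < a) (hb : 0 < b) :
    (1/(w*(w+a)))^2 - (1/((w+b)*(w+b+a)))^2 < 4 * b / M^5 := by
  have hw0 : 0 < w := by linarith
  have e1 : 1/(w*(w+a)) - 1/((w+b)*(w+b+a)) ≤ b * ((1/M+1/M) * (1/(M*M))) := by
    rw [diff_id w a b hw0 ha hb]
    gcongr <;> linarith
  have e2 : 1/(w*(w+a)) + 1/((w+b)*(w+b+a)) < 1/(M*M) + 1/(M*M) := by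
    gcongr <;> linarith
  have e3 : 0 < 1/(w*(w+a)) + 1/((w+b)*(w+b+a)) := by positivity
  calc _ = (1/(w*(w+a)) - 1/((w+b)*(w+b+a))) * (1/(w*(w+a)) + 1/((w+b)*(w+b+a))) := by ring
    _ ≤ (b * ((1/M+1/M) * (1/(M*M)))) * (1/(w*(w+a)) + 1/((w+b)*(w+b+a))) := by gcongr
    _ < (b * ((1/M+1/M) * (1/(M*M)))) * (1/(M*M) + 1/(M*M)) := by gcongr
    _ = _ := by field_simp; ring

lemma diff_lower (w a b N : ℝ) (hw : 0 < w) (hN : w + b + a ≤ N) (ha : 0 < a) (hb : 0 < b) :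
    4 * b / N^5 ≤ (1/(w*(w+a)))^2 - (1/((w+b)*(w+b+a)))^2 := by
  have hN0 : 0 < N := by linarith
  have e1 : b * ((1/N+1/N) * (1/(N*N))) ≤ 1/(w*(w+a)) - 1/((w+b)*(w+b+a)) := by
    rw [diff_id w a b hw ha hb]
    gcongr <;> linarith
  have e2 : 1/(N*N) + 1/(N*N) ≤ 1/(w*(w+a)) + 1/((w+b)*(w+b+a)) := by
    gcongr <;> linarith
  have e3 : 0 ≤ b * ((1/N+1/N) * (1/(N*N))) := by positivity
  calc _ = (b * ((1/N+1/N) * (1/(N*N)))) * (1/(N*N) + 1/(N*N)) := by field_simp; ring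
    _ ≤ (1/(w*(w+a)) - 1/((w+b)*(w+b+a))) * (1/(w*(w+a)) + 1/((w+b)*(w+b+a))) := by
        gcongr
        exact e3.trans e1
    _ = _ := by ring

lemma cA {w A M : ℝ} (hM : 0 < M) (h : M < w) (hA : 0 < A) : (2*w-A)*M < 2*w^2 := by
  nlinarith [mul_pos hA hM, mul_pos hM (sub_pos.2 h), mul_pos (sub_pos.2 h) (sub_pos.2 h)]

lemma cB {w A M : ℝ} (hM : 0 < M) (h : M < w) (hA : 0 < A) : (2*w+3*A)*M < 2*(w+A)^2 := by
  have h1 : (2*w+3*A)*M < (2*w+3*A)*w := mul_lt_mul_of_pos_left h (by linarith)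
  nlinarith [mul_pos hA (hM.trans h), mul_pos hA hA]

set_option maxHeartbeats 4000000 in
/-- Lemma 6 (dichotomy for pairs of pairs): exactly one of the two conditions holds. -/
theorem pair_of_pairs_dichotomy (x h lam m H M : ℝ) (u a b : ℤ)
    (hx : Real.exp 41 ≤ x) (hh1 : (1000 : ℝ) ≤ h) (hh2 : h ≤ 2 * x ^ ((1 : ℝ) / 3))
    (hlam1 : 1 < lam) (hlam2 : lam ≤ 1.05) (hm : (5 : ℝ) ≤ m)
    (hH : m * h ≤ H) (hHM : H ≤ M) (hM : M ≤ Real.sqrt (2 * x))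
    (ha : 0 < a) (hab : 2 * a ≤ b)
    (hu : u ∈ Sset x h M (lam * M)) (hua : u + a ∈ Sset x h M (lam * M))
    (hub : u + b ∈ Sset x h M (lam * M)) (huab : u + a + b ∈ Sset x h M (lam * M)) :
    Xor' ((a : ℝ) ^ 3 * (b : ℝ) < lam ^ 6 * h * x⁻¹ * M ^ 4)
      ((a : ℝ) ^ 3 * (b : ℝ) > (0.5 - lam / m) * x⁻¹ * M ^ 5) := by
  have hx0 : 0 < x := lt_of_lt_of_le (Real.exp_pos _) hx
  have hh0 : 0 < h := by linarith
  have hmM : m * h ≤ M := hH.trans hHM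
  have hM0 : 0 < M := lt_of_lt_of_le (by positivity) hmM
  have hmh : h / M ≤ 1 / m := by
    rw [div_le_div_iff₀ hM0 (by linarith)]; linarith
  have hm5 : 1 / m ≤ 1 / 5 := by gcongr
  have hm0 : 0 < 1 / m := by positivity
  have hl6 : lam ^ 6 ≤ 1.3401 := by
    calc lam ^ 6 ≤ 1.05 ^ 6 := by gcongr
      _ ≤ 1.3401 := by norm_num
  have hl56 : lam ^ 5 ≤ lam ^ 6 := pow_le_pow_right₀ hlam1.le (by norm_num)
  obtain ⟨k0, e0, f0, p0, q0⟩ := Sset_rep hu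
  obtain ⟨k1, e1, f1, p1, q1⟩ := Sset_rep hua
  obtain ⟨k2, e2, f2, p2, q2⟩ := Sset_rep hub
  obtain ⟨k3, e3, f3, p3, q3⟩ := Sset_rep huab
  obtain ⟨o0, g0, -, -, -⟩ := hu
  obtain ⟨o1, -, l1, -, -⟩ := hua
  obtain ⟨-, -, -, -, -⟩ := hub
  obtain ⟨-, -, l3, -, -⟩ := huab
  have haR : (0:ℝ) < a := by exact_mod_cast ha
  have hbR : (0:ℝ) < b := by exact_mod_cast (by omega : 0 < b)
  have hae : Even a := by
    have := o1.sub_odd o0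
    simpa using this
  obtain ⟨c, hc⟩ := hae
  set D : ℤ := ((2*u+3*a)*k1 - (2*u-a)*k0) - ((2*(u+b)+3*a)*k3 - (2*(u+b)-a)*k2) with hD
  have hDe : D = 2 * (((u+3*c)*k1 - (u-c)*k0) - ((u+b+3*c)*k3 - (u+b-c)*k2)) := by
    rw [hD, hc]; ring
  push_cast at f1 q1 f2 q2 f3 q3 l1 l3
  rw [show (u:ℝ) + a + b = u + b + a by ring] at f3 q3 l3
  have hDR : (D:ℝ) = ((2*(u:ℝ)+3*a)*k1 - (2*u-a)*k0) - ((2*(u+b)+3*a)*k3 - (2*(u+b)-a)*k2) := by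
    rw [hD]; push_cast; ring
  clear_value D
  generalize (u:ℝ) = w at *
  generalize (a:ℝ) = A at *
  generalize (b:ℝ) = B at *
  have hw0 : 0 < w := by linarith
  have hlM : lam * M ≤ 1.05 * M := by gcongr
  have hA : A < w := by linarith
  have I1 := F_id x w A hw0 haR
  have I2 := F_id x (w+B) A (by linarith) haR
  rw [f0, f1] at I1
  rw [f2, f3] at I2
  have U := diff_upper w A B M hM0 g0 haR hbR
  have L := diff_lower w A B (lam*M) hw0 l3 haR hbR
  set G := (1/(w*(w+A)))^2 - (1/((w+B)*(w+B+A)))^2 with hG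
  have key : x * A^3 * G = D - ((2*w+3*A)*e1 - (2*w-A)*e0 - (2*(w+B)+3*A)*e3 + (2*(w+B)-A)*e2) := by
    rw [hDR, hG, mul_sub, ← I1, ← I2]; ring
  have t0 : (2*w-A)*e0 < 2*h/M := term_bd hM0 (by linarith) hw0 hh0 q0 (cA hM0 g0 haR)
  have t1 : (2*w+3*A)*e1 < 2*h/M := term_bd hM0 (by linarith) (by linarith) hh0 q1 (cB hM0 g0 haR)
  have t2 : (2*(w+B)-A)*e2 < 2*h/M := term_bd hM0 (by linarith) (by linarith) hh0 q2 (cA hM0 (by linarith) haR)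
  have t3 : (2*(w+B)+3*A)*e3 < 2*h/M := term_bd hM0 (by linarith) (by linarith) hh0 q3 (cB hM0 (by linarith) haR)
  have s0 : 0 ≤ (2*w-A)*e0 := mul_nonneg (by linarith) p0
  have s1 : 0 ≤ (2*w+3*A)*e1 := mul_nonneg (by linarith) p1
  have s2 : 0 ≤ (2*(w+B)-A)*e2 := mul_nonneg (by linarith) p2
  have s3 : 0 ≤ (2*(w+B)+3*A)*e3 := mul_nonneg (by linarith) p3
  have hhM : 2*h/M = 2*(h/M) := by ring
  rw [hhM] at t0 t1 t2 t3
  have hxA : 0 < x * A^3 := by positivity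
  have U' : x * A^3 * G < x * A^3 * (4 * B / M^5) := by gcongr
  have L' : x * A^3 * (4 * B / (lam*M)^5) ≤ x * A^3 * G := by gcongr
  have hG0 : 0 < x * A^3 * G := lt_of_lt_of_le (by positivity) L'
  have hlm : lam / m = lam * (1/m) := by ring
  have excl : lam ^ 6 * h * x⁻¹ * M ^ 4 ≤ (0.5 - lam / m) * x⁻¹ * M ^ 5 := by
    have : lam^6 * (h/M) ≤ 0.5 - lam / m := by
      rw [hlm]
      calc lam^6 * (h/M) ≤ 1.3401 * (1/m) := by gcongr
        _ ≤ _ := by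
          have : lam * (1/m) ≤ 1.05 * (1/m) := by gcongr
          linarith
    calc lam ^ 6 * h * x⁻¹ * M ^ 4 = (lam^6 * (h/M)) * x⁻¹ * M^5 := by field_simp
      _ ≤ _ := by gcongr
  have hDlo : (-1:ℝ) < D := by linarith
  have hDlo' : -1 < D := by exact_mod_cast hDlo
  rcases (by omega : D = 0 ∨ 2 ≤ D) with hD0 | hD2
  · left
    have hlt : A ^ 3 * B < lam ^ 6 * h * x⁻¹ * M ^ 4 := by
      have hz : (D:ℝ) = 0 := by rw [hD0]; simp
      have h4 : x * A^3 * (4 * B / (lam*M)^5) < 4 * (h/M) := by linarith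
      calc A^3*B = (x * A^3 * (4 * B / (lam*M)^5)) * ((lam*M)^5 / (4 * x)) := by
            field_simp
        _ < (4 * (h/M)) * ((lam*M)^5 / (4 * x)) := by gcongr
        _ = lam^5 * h * x⁻¹ * M^4 := by field_simp
        _ ≤ _ := by gcongr
    exact ⟨hlt, not_lt.mpr (hlt.le.trans excl)⟩
  · right
    have hgt : A ^ 3 * B > (0.5 - lam / m) * x⁻¹ * M ^ 5 := by
      have hz : (2:ℝ) ≤ D := by exact_mod_cast hD2
      have h4 : 4 * (0.5 - lam / m) < x * A^3 * (4 * B / M^5) := by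
        have hl1 : 1/m < lam / m := by rw [hlm]; exact lt_mul_of_one_lt_left hm0 hlam1
        linarith
      calc (0.5 - lam / m) * x⁻¹ * M ^ 5 = (4 * (0.5 - lam / m)) * (M^5 / (4*x)) := by
            field_simp
        _ < (x * A^3 * (4 * B / M^5)) * (M^5 / (4*x)) := by gcongr
        _ = _ := by field_simp
    exact ⟨hgt, not_lt.mpr (excl.trans hgt.le)⟩
end

section
/- Let x ≥ e^{116}, set h = 11·x^{1/5}·log x and λ = 1.045, and suppose 5.5·h ≤ M ≤ x^{2/5}. Then |S(M)| ≤ h·(σ₃(M) + σ₄(M)), where σ₃(M) = (0.5298·x^{1/5} + 0.3400·x^{-1/5}·M)·h^{-1} + 0.0308·x^{1/15}·M^{-1/3}, and σ₄(M) = 1.2105·x^{-2/3}·M^{7/3} if M ≤ 5·x^{1/4}, while σ₄(M) = 1.4182·x^{-1/9}·M^{1/9} if M > 5·x^{1/4}. -/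
lemma L1 (x h u α m1 m2 : ℝ) (hα : 0 < α) (hu : α ≤ u)
    (h1 : x < m1 * u ^ 2) (h1' : m1 * u ^ 2 ≤ x + h)
    (h2 : x < m2 * (u + 2 * α) ^ 2) (h2' : m2 * (u + 2 * α) ^ 2 ≤ x + h) :
    |(u + 3 * α) * m2 - (u - α) * m1 - 4 * α ^ 3 * x / (u ^ 2 * (u + 2 * α) ^ 2)| ≤ h / u := by
  have hu0 : 0 < u := by linarith
  have hv0 : 0 < u + 2 * α := by linarith
  obtain ⟨d1, e1⟩ : ∃ d, d = m1 * u ^ 2 - x := ⟨_, rfl⟩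
  obtain ⟨d2, e2⟩ : ∃ d, d = m2 * (u + 2 * α) ^ 2 - x := ⟨_, rfl⟩
  have hm1 : m1 = (x + d1) / u ^ 2 := by field_simp; linarith
  have hm2 : m2 = (x + d2) / (u + 2 * α) ^ 2 := by field_simp; linarith
  have key : (u + 3 * α) * m2 - (u - α) * m1 - 4 * α ^ 3 * x / (u ^ 2 * (u + 2 * α) ^ 2)
      = (u + 3 * α) * d2 / (u + 2 * α) ^ 2 - (u - α) * d1 / u ^ 2 := by
    rw [hm1, hm2]; field_simp; ring
  rw [key]
  have a1 : 0 ≤ (u + 3 * α) * d2 / (u + 2 * α) ^ 2 := by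
    apply div_nonneg _ (by positivity)
    apply mul_nonneg <;> linarith
  have a2 : 0 ≤ (u - α) * d1 / u ^ 2 := by
    apply div_nonneg _ (by positivity)
    apply mul_nonneg <;> linarith
  have hh : 0 ≤ h := by linarith
  have b1 : (u + 3 * α) * d2 / (u + 2 * α) ^ 2 ≤ h / u := by
    rw [div_le_div_iff₀ (by positivity) hu0]
    calc (u + 3 * α) * d2 * u ≤ (u + 3 * α) * h * u := by gcongr; linarith
      _ = h * ((u + 3 * α) * u) := by ring
      _ ≤ h * (u + 2 * α) ^ 2 := by gcongr; nlinarith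
  have b2 : (u - α) * d1 / u ^ 2 ≤ h / u := by
    rw [div_le_div_iff₀ (by positivity) hu0]
    calc (u - α) * d1 * u ≤ (u - α) * h * u := by
          gcongr
          linarith
      _ = h * ((u - α) * u) := by ring
      _ ≤ h * u ^ 2 := by gcongr; nlinarith
  rw [abs_le]; constructor <;> linarith

/-- p ≥ 1 -/
lemma Lp (x h u b : ℝ) (m2 m4 : ℤ) (hx : 0 < x) (hb : 2 ≤ b) (hu : h ≤ u) (hu0 : 0 < u)
    (h2 : x < m2 * u ^ 2) (h4' : m4 * (u + b) ^ 2 ≤ x + h) : m4 + 1 ≤ m2 := by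
  by_contra hc
  have hc' : (m2 : ℝ) ≤ m4 := by exact_mod_cast (by omega : m2 ≤ m4)
  have hm2 : 0 < (m2 : ℝ) := by
    by_contra hn
    have : (m2 : ℝ) * u ^ 2 ≤ 0 := mul_nonpos_of_nonpos_of_nonneg (by linarith) (by positivity)
    linarith
  have hm2' : (1 : ℝ) ≤ m2 := by exact_mod_cast (by exact_mod_cast hm2 : 0 < m2)
  have e1 : (m2 : ℝ) * (u + b) ^ 2 ≤ m4 * (u + b) ^ 2 := by gcongr
  have e2 : 1 * (2 * u * b + b ^ 2) ≤ (m2 : ℝ) * (2 * u * b + b ^ 2) := by gcongr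
  nlinarith

/-- E ≥ 1 from equality of the `α` expressions -/
lemma LEE (x h u : ℝ) (α β : ℝ) (m1 m2 m3 m4 : ℤ) (hx : 0 < x) (hα : 1 ≤ α) (hβ : 1 ≤ β)
    (hu : h ≤ u) (hu0 : α < u)
    (h2 : x < m2 * (u + 2 * α) ^ 2) (h3 : x < m3 * (u + 2 * β) ^ 2)
    (h4 : m4 * (u + 2 * α + 2 * β) ^ 2 ≤ x + h)
    (I : (u + 3 * α) * m2 - (u - α) * m1
      = (u + 2 * β + 3 * α) * m4 - (u + 2 * β - α) * m3) :
    m4 + 1 ≤ m2 ∧ m4 + 1 ≤ m3 ∧ 1 ≤ m1 - m2 - m3 + m4 := by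
  have p := Lp x h (u + 2 * α) (2 * β) m2 m4 hx (by linarith) (by linarith) (by linarith) h2 h4
  have q := Lp x h (u + 2 * β) (2 * α) m3 m4 hx (by linarith) (by linarith) (by linarith) h3
    (by convert h4 using 3; ring)
  refine ⟨p, q, ?_⟩
  have e : (u - α) * ((m1 : ℝ) - m2 - m3 + m4) = 4 * α * (m2 - m4) + 2 * β * (m3 - m4) := by
    linear_combination -I
  have p' : (m4 : ℝ) + 1 ≤ m2 := by exact_mod_cast p
  have q' : (m4 : ℝ) + 1 ≤ m3 := by exact_mod_cast q
  have : 0 < (u - α) * ((m1 : ℝ) - m2 - m3 + m4) := by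
    rw [e]; have : 0 < α * (m2 - m4) := by apply mul_pos <;> linarith
    have : 0 < β * (m3 - m4) := by apply mul_pos <;> linarith
    linarith
  have := pos_of_mul_pos_right this (by linarith)
  have : (0 : ℝ) < ((m1 - m2 - m3 + m4 : ℤ) : ℝ) := by push_cast; exact this
  have : 0 < m1 - m2 - m3 + m4 := by exact_mod_cast this
  omega

lemma Ldouble (x h u : ℝ) (α β : ℤ) (m1 m2 m3 m4 : ℤ) (hx : 0 < x) (hα : 1 ≤ α) (hβ : 1 ≤ β)
    (hne : α ≠ β) (hu : 2 * h ≤ u) (hu0 : α < u)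
    (h1 : x < m1 * u ^ 2) (h1' : m1 * u ^ 2 ≤ x + h)
    (h2 : x < m2 * (u + 2 * α) ^ 2) (h2' : m2 * (u + 2 * α) ^ 2 ≤ x + h)
    (h3 : x < m3 * (u + 2 * β) ^ 2) (h3' : m3 * (u + 2 * β) ^ 2 ≤ x + h)
    (h4 : x < m4 * (u + 2 * α + 2 * β) ^ 2) (h4' : m4 * (u + 2 * α + 2 * β) ^ 2 ≤ x + h)
    (I : (u + 3 * α) * m2 - (u - α) * m1
      = (u + 2 * β + 3 * α) * m4 - (u + 2 * β - α) * m3)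
    (II : (u + 3 * β) * m3 - (u - β) * m1
      = (u + 2 * α + 3 * β) * m4 - (u + 2 * α - β) * m2) : False := by
  have hα' : (1 : ℝ) ≤ α := by exact_mod_cast hα
  have hβ' : (1 : ℝ) ≤ β := by exact_mod_cast hβ
  have hh : 0 < h := by linarith
  obtain ⟨-, -, hE⟩ := LEE x h u α β m1 m2 m3 m4 hx hα' hβ' (by linarith) hu0 h2 h3 h4' I
  have hE' : (1 : ℝ) ≤ m1 - m2 - m3 + m4 := by exact_mod_cast hE
  set E : ℝ := m1 - m2 - m3 + m4 with hEd
  have hp : 6 * (α : ℝ) * (m2 - m4) = (u - 2 * α + β) * E := by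
    rw [hEd]; linear_combination -2 * (-I) + (-II)
  have hq : 6 * (β : ℝ) * (m3 - m4) = (u - 2 * β + α) * E := by
    rw [hEd]; linear_combination -2 * (-II) + (-I)
  obtain ⟨s, hs⟩ : ∃ s : ℝ, s = α + β := ⟨_, rfl⟩
  obtain ⟨d, hd⟩ : ∃ d : ℝ, d = β - α := ⟨_, rfl⟩
  obtain ⟨v, hv⟩ : ∃ v : ℝ, v = u + α + β := ⟨_, rfl⟩
  have key : 4 * v * s * d * E =
      3 * (d * ((m4 * (u + 2 * α + 2 * β) ^ 2 - x) - (m1 * u ^ 2 - x))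
        - s * ((m3 * (u + 2 * β) ^ 2 - x) - (m2 * (u + 2 * α) ^ 2 - x))) := by
    have hm1 : (m1 : ℝ) = E + m2 + m3 - m4 := by rw [hEd]; ring
    rw [hm1, hs, hd, hv]
    linear_combination (-((u + α + β) ^ 2 - (α + β) * (β - α))) * hp
      + ((u + α + β) ^ 2 + (α + β) * (β - α)) * hq
  have hd1 : 1 ≤ |d| := by
    have : (1 : ℤ) ≤ |β - α| := Int.one_le_abs (by omega)
    rw [hd]; exact_mod_cast this
  have hs1 : |d| ≤ s := by rw [hd, hs, abs_le]; constructor <;> linarith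
  have hs0 : 0 < s := by linarith
  have hv0 : u < v := by linarith
  have hvp : 0 < v := by linarith
  have t1 : |(m4 * (u + 2 * α + 2 * β) ^ 2 - x) - (m1 * u ^ 2 - x)| ≤ h := by
    rw [abs_le]; constructor <;> linarith
  have t2 : |(m3 * (u + 2 * β) ^ 2 - x) - (m2 * (u + 2 * α) ^ 2 - x)| ≤ h := by
    rw [abs_le]; constructor <;> linarith
  have k2 : 4 * v * s * |d| * E ≤ 3 * (|d| * h + s * h) := by
    have : 4 * v * s * |d| * E = |4 * v * s * d * E| := by
      rw [abs_mul, abs_mul, abs_mul, abs_of_pos (by linarith : 0 < 4 * v), abs_of_pos hs0,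
        abs_of_pos (by linarith : 0 < E)]
    rw [this, key, abs_mul, abs_of_pos (by norm_num : (0:ℝ) < 3)]
    gcongr
    refine (abs_sub _ _).trans ?_
    rw [abs_mul, abs_mul, abs_of_pos hs0]
    gcongr
  have k3 : 4 * v * s * |d| * 1 ≤ 4 * v * s * |d| * E := by gcongr
  have k4 : 4 * v * s * 1 ≤ 4 * v * s * |d| := by gcongr
  have k5 : |d| * h ≤ s * h := by gcongr
  have k6 : s * (4 * v) ≤ s * (6 * h) := by linarith
  have := le_of_mul_le_mul_left k6 hs0
  linarith

noncomputable def mm (x : ℝ) (u : ℤ) : ℤ := ⌊x / (u : ℝ) ^ 2⌋ + 1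

noncomputable def DD (x : ℝ) (α u : ℤ) : ℤ := (u + 3 * α) * mm x (u + 2 * α) - (u - α) * mm x u

noncomputable def GG (x : ℝ) (α u : ℤ) : ℝ :=
  4 * (α : ℝ) ^ 3 * x / ((u : ℝ) ^ 2 * (u + 2 * α : ℝ) ^ 2)

def Good (x h M : ℝ) (u : ℤ) : Prop :=
  M < (u : ℝ) ∧ (u : ℝ) ≤ 1.045 * M ∧ x < mm x u * (u : ℝ) ^ 2 ∧ mm x u * (u : ℝ) ^ 2 ≤ x + h

lemma good_of_mem (x h M : ℝ) (hM : 0 < M) (u : ℤ) (hu : u ∈ Sset x h M (1.045 * M)) :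
    Good x h M u := by
  obtain ⟨-, h1, h2, h3, -⟩ := hu
  have hu0 : (0 : ℝ) < u := by linarith
  have hu2 : (0 : ℝ) < (u : ℝ) ^ 2 := by positivity
  have e : (mm x u : ℝ) * (u : ℝ) ^ 2 = x + (1 - Int.fract (x / (u : ℝ) ^ 2)) * (u : ℝ) ^ 2 := by
    unfold mm Int.fract; push_cast; field_simp; ring
  refine ⟨h1, h2, ?_, ?_⟩
  · rw [e]
    have := Int.fract_lt_one (x / (u : ℝ) ^ 2)
    have : 0 < (1 - Int.fract (x / (u : ℝ) ^ 2)) * (u : ℝ) ^ 2 := mul_pos (by linarith) hu2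
    linarith
  · rw [e]
    have : (1 - Int.fract (x / (u : ℝ) ^ 2)) * (u : ℝ) ^ 2 ≤ h / (u : ℝ) ^ 2 * (u : ℝ) ^ 2 := by
      gcongr; linarith
    rw [div_mul_cancel₀ _ hu2.ne'] at this
    linarith

lemma D1 (x h M : ℝ) (hM : 0 < M) (α u : ℤ) (hα : 1 ≤ α)
    (g1 : Good x h M u) (g2 : Good x h M (u + 2 * α)) :
    |(DD x α u : ℝ) - GG x α u| ≤ h / u := by
  obtain ⟨a1, a2, a3, a4⟩ := g1
  obtain ⟨b1, b2, b3, b4⟩ := g2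
  have hα' : (1 : ℝ) ≤ α := by exact_mod_cast hα
  push_cast at b1 b2 b3 b4
  have := L1 x h u α (mm x u) (mm x (u + 2 * α)) (by linarith) (by linarith) a3 a4 b3 b4
  unfold DD GG
  push_cast
  exact this

lemma D1' (x h M : ℝ) (hM : 0 < M) (hh : 0 < h) (α u : ℤ) (hα : 1 ≤ α)
    (g1 : Good x h M u) (g2 : Good x h M (u + 2 * α)) :
    |(DD x α u : ℝ) - GG x α u| ≤ h / M := by
  refine (D1 x h M hM α u hα g1 g2).trans ?_
  have := g1.1
  gcongr

/-- upper bound for differences of `1/(p q)^2` -/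
lemma inv_diff_le (M p q a : ℝ) (hM : 0 < M) (hp : M ≤ p) (hq : M ≤ q) (ha : 0 ≤ a) :
    1 / (p ^ 2 * q ^ 2) - 1 / ((p + a) ^ 2 * (q + a) ^ 2) ≤ 4 * a / M ^ 5 := by
  have hp0 : 0 < p := by linarith
  have hq0 : 0 < q := by linarith
  obtain ⟨s, hs⟩ : ∃ s, s = a / (p + a) := ⟨_, rfl⟩
  obtain ⟨t, ht⟩ : ∃ t, t = a / (q + a) := ⟨_, rfl⟩
  have hs0 : 0 ≤ s := by rw [hs]; positivity
  have ht0 : 0 ≤ t := by rw [ht]; positivity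
  have hs1 : s ≤ 1 := by rw [hs, div_le_one (by positivity)]; linarith
  have ht1 : t ≤ 1 := by rw [ht, div_le_one (by positivity)]; linarith
  have hsM : s ≤ a / M := by rw [hs]; gcongr; linarith
  have htM : t ≤ a / M := by rw [ht]; gcongr; linarith
  have e : 1 / (p ^ 2 * q ^ 2) - 1 / ((p + a) ^ 2 * (q + a) ^ 2)
      = (1 - (1 - s) ^ 2 * (1 - t) ^ 2) * (1 / (p ^ 2 * q ^ 2)) := by
    have e1 : 1 - s = p / (p + a) := by rw [hs]; field_simp; ring
    have e2 : 1 - t = q / (q + a) := by rw [ht]; field_simp; ring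
    rw [e1, e2]; field_simp
  have b1 : 1 - (1 - s) ^ 2 * (1 - t) ^ 2 ≤ 2 * s + 2 * t := by
    have : 1 - s - t ≤ (1 - s) * (1 - t) := by nlinarith
    nlinarith [sq_nonneg ((1 - s) * (1 - t) - 1)]
  rw [e]
  calc (1 - (1 - s) ^ 2 * (1 - t) ^ 2) * (1 / (p ^ 2 * q ^ 2))
      ≤ (4 * (a / M)) * (1 / (p ^ 2 * q ^ 2)) := by gcongr; linarith
    _ ≤ (4 * (a / M)) * (1 / (M ^ 2 * M ^ 2)) := by gcongr
    _ = _ := by field_simp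

lemma inv_diff_ge (L p q a : ℝ) (hp : 0 < p) (hq : 0 < q) (ha : 0 ≤ a) (hpL : p + a ≤ L)
    (hqL : q + a ≤ L) :
    4 * a / L ^ 5 ≤ 1 / (p ^ 2 * q ^ 2) - 1 / ((p + a) ^ 2 * (q + a) ^ 2) := by
  have hL : 0 < L := by linarith
  obtain ⟨s, hs⟩ : ∃ s, s = a / L := ⟨_, rfl⟩
  have hs0 : 0 ≤ s := by rw [hs]; positivity
  have h1 : 1 + s ≤ (p + a) / p := by
    rw [add_div, div_self hp.ne', hs]; gcongr; linarith
  have h2 : 1 + s ≤ (q + a) / q := by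
    rw [add_div, div_self hq.ne', hs]; gcongr; linarith
  have e : 1 / (p ^ 2 * q ^ 2) - 1 / ((p + a) ^ 2 * (q + a) ^ 2)
      = (((p + a) / p) ^ 2 * ((q + a) / q) ^ 2 - 1) * (1 / ((p + a) ^ 2 * (q + a) ^ 2)) := by
    field_simp
  rw [e]
  have h3 : 4 * s ≤ ((p + a) / p) ^ 2 * ((q + a) / q) ^ 2 - 1 := by
    have : (1 + s) ^ 2 * (1 + s) ^ 2 ≤ ((p + a) / p) ^ 2 * ((q + a) / q) ^ 2 := by gcongr
    nlinarith [sq_nonneg s, sq_nonneg (s ^ 2), mul_nonneg hs0 (sq_nonneg s)]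
  calc 4 * a / L ^ 5 = 4 * s * (1 / (L ^ 2 * L ^ 2)) := by rw [hs]; field_simp
    _ ≤ 4 * s * (1 / ((p + a) ^ 2 * (q + a) ^ 2)) := by gcongr
    _ ≤ _ := by gcongr

lemma D2 (x h M : ℝ) (hx : 0 < x) (hM : 0 < M) (hh : 0 < h) (hMh : 11 * h ≤ 2 * M) (α β u : ℤ)
    (hα : 1 ≤ α) (hβ : 1 ≤ β) (hne : α ≠ β)
    (g1 : Good x h M u) (g2 : Good x h M (u + 2 * α)) (g3 : Good x h M (u + 2 * β))
    (g4 : Good x h M (u + 2 * α + 2 * β)) (hD : DD x α u = DD x α (u + 2 * β)) :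
    7 / 11 ≤ 32 * α * (β : ℝ) ^ 3 * x / M ^ 5 := by
  have hα' : (1 : ℝ) ≤ α := by exact_mod_cast hα
  have hβ' : (1 : ℝ) ≤ β := by exact_mod_cast hβ
  have g4' : Good x h M (u + 2 * β + 2 * α) := by convert g4 using 1; ring
  have hneq : DD x β u ≠ DD x β (u + 2 * α) := by
    intro hD2
    have I : ((DD x α u : ℤ) : ℝ) = (DD x α (u + 2 * β) : ℤ) := by rw [hD]
    have II : ((DD x β u : ℤ) : ℝ) = (DD x β (u + 2 * α) : ℤ) := by rw [hD2]
    unfold DD at I II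
    rw [show u + 2 * β + 2 * α = u + 2 * α + 2 * β by ring] at I
    push_cast at I II
    obtain ⟨a1, a2, a3, a4⟩ := g1
    obtain ⟨b1, b2, b3, b4⟩ := g2
    obtain ⟨c1, c2, c3, c4⟩ := g3
    obtain ⟨d1, d2, d3, d4⟩ := g4
    push_cast at b1 b2 b3 b4 c1 c2 c3 c4 d1 d2 d3 d4
    exact Ldouble x h u α β (mm x u) (mm x (u + 2 * α)) (mm x (u + 2 * β))
      (mm x (u + 2 * α + 2 * β)) hx hα hβ hne (by linarith) (by linarith) a3 a4 b3 b4 c3 c4 d3 d4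
      I II
  have e1 := D1' x h M hM hh β u hβ g1 g3
  have e2 := D1' x h M hM hh β (u + 2 * α) hβ g2 g4
  have e3 : (1 : ℝ) ≤ |(DD x β u : ℝ) - DD x β (u + 2 * α)| := by
    exact_mod_cast Int.one_le_abs (sub_ne_zero.mpr hneq)
  have hhM : h / M ≤ 2 / 11 := by rw [div_le_div_iff₀ hM (by norm_num)]; linarith
  have e4 := inv_diff_le M u (u + 2 * β) (2 * α) hM g1.1.le (by linarith [g1.1]) (by linarith)
  have e6 := inv_diff_ge (u + 2 * β + 2 * α) u (u + 2 * β) (2 * α) (by linarith [g1.1])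
    (by linarith [g1.1]) (by linarith) (by linarith) (by linarith)
  have hg0 : 0 ≤ GG x β u - GG x β (u + 2 * α) := by
    have : 0 ≤ 4 * (2 * (α : ℝ)) / (u + 2 * β + 2 * α : ℝ) ^ 5 := by
      have := g1.1
      have : (0:ℝ) < u := by linarith
      positivity
    have e5 : GG x β u - GG x β (u + 2 * α) = 4 * (β : ℝ) ^ 3 * x *
      (1 / ((u : ℝ) ^ 2 * (u + 2 * β : ℝ) ^ 2) -
        1 / ((u + 2 * α : ℝ) ^ 2 * (u + 2 * β + 2 * α : ℝ) ^ 2)) := by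
      unfold GG; push_cast; rw [show (u : ℝ) + 2 * α + 2 * β = u + 2 * β + 2 * α by ring]; ring
    rw [e5]; apply mul_nonneg (by positivity); linarith
  have e5 : GG x β u - GG x β (u + 2 * α) ≤ 32 * α * (β : ℝ) ^ 3 * x / M ^ 5 := by
    have e5 : GG x β u - GG x β (u + 2 * α) = 4 * (β : ℝ) ^ 3 * x *
      (1 / ((u : ℝ) ^ 2 * (u + 2 * β : ℝ) ^ 2) -
        1 / ((u + 2 * α : ℝ) ^ 2 * (u + 2 * β + 2 * α : ℝ) ^ 2)) := by
      unfold GG; push_cast; rw [show (u : ℝ) + 2 * α + 2 * β = u + 2 * β + 2 * α by ring]; ring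
    rw [e5]
    calc _ ≤ 4 * (β : ℝ) ^ 3 * x * (4 * (2 * α) / M ^ 5) := by gcongr
      _ = _ := by ring
  rw [abs_le] at e1 e2
  rw [le_abs] at e3
  rcases e3 with e3 | e3 <;> linarith

lemma D3 (x h M : ℝ) (hx : 0 < x) (hM : 0 < M) (hh : 0 < h) (α β u : ℤ)
    (hα : 1 ≤ α) (hβ : 1 ≤ β)
    (g1 : Good x h M u) (g2 : Good x h M (u + 2 * α)) (g3 : Good x h M (u + 2 * β))
    (g4 : Good x h M (u + 2 * α + 2 * β)) (hD : DD x α u = DD x α (u + 2 * β)) :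
    32 * (α : ℝ) ^ 3 * β * x / (1.045 * M) ^ 5 ≤ 2 * (h / M) := by
  have hα' : (1 : ℝ) ≤ α := by exact_mod_cast hα
  have hβ' : (1 : ℝ) ≤ β := by exact_mod_cast hβ
  have g4' : Good x h M (u + 2 * β + 2 * α) := by convert g4 using 1; ring
  have e1 := D1' x h M hM hh α u hα g1 g2
  have e2 := D1' x h M hM hh α (u + 2 * β) hα g3 g4'
  have hL := g4.2.1
  push_cast at hL
  have e6 := inv_diff_ge (1.045 * M) u (u + 2 * α) (2 * β) (by linarith [g1.1])
    (by linarith [g1.1]) (by linarith) (by linarith) (by linarith)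
  have e5 : GG x α u - GG x α (u + 2 * β) = 4 * (α : ℝ) ^ 3 * x *
      (1 / ((u : ℝ) ^ 2 * (u + 2 * α : ℝ) ^ 2) -
        1 / ((u + 2 * β : ℝ) ^ 2 * (u + 2 * α + 2 * β : ℝ) ^ 2)) := by
      unfold GG; push_cast; rw [show (u : ℝ) + 2 * β + 2 * α = u + 2 * α + 2 * β by ring]; ring
  have e7 : 32 * (α : ℝ) ^ 3 * β * x / (1.045 * M) ^ 5 ≤ GG x α u - GG x α (u + 2 * β) := by
    rw [e5]
    calc _ = 4 * (α : ℝ) ^ 3 * x * (4 * (2 * β) / (1.045 * M) ^ 5) := by ring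
      _ ≤ _ := by gcongr
  rw [hD] at e1
  rw [abs_le] at e1 e2
  linarith

lemma sq_diff_le (M p b : ℝ) (hM : 0 < M) (hp : M ≤ p) (hb : 0 ≤ b) :
    1 / p ^ 2 - 1 / (p + b) ^ 2 ≤ 2 * b / M ^ 3 := by
  have hp0 : 0 < p := by linarith
  calc 1 / p ^ 2 - 1 / (p + b) ^ 2 ≤ 2 * b / p ^ 3 := by
        rw [div_sub_div _ _ (by positivity) (by positivity), div_le_div_iff₀ (by positivity) (by positivity)]
        have : 0 ≤ p ^ 2 * b ^ 2 * (3 * p + 2 * b) := by positivity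
        nlinarith
    _ ≤ _ := by gcongr

lemma D4 (x h M : ℝ) (hx : 0 < x) (hM : 0 < M) (hh : 0 < h) (hMh : 11 * h ≤ 2 * M) (α β u : ℤ)
    (hα : 1 ≤ α) (hβ : 1 ≤ β)
    (g1 : Good x h M u) (g2 : Good x h M (u + 2 * α)) (g3 : Good x h M (u + 2 * β))
    (g4 : Good x h M (u + 2 * α + 2 * β)) (hD : DD x α u = DD x α (u + 2 * β)) :
    M ^ 4 ≤ 28 * α * β * x := by
  have hα' : (1 : ℝ) ≤ α := by exact_mod_cast hα
  have hβ' : (1 : ℝ) ≤ β := by exact_mod_cast hβ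
  have I : ((DD x α u : ℤ) : ℝ) = (DD x α (u + 2 * β) : ℤ) := by rw [hD]
  unfold DD at I
  rw [show u + 2 * β + 2 * α = u + 2 * α + 2 * β by ring] at I
  push_cast at I
  obtain ⟨a1, a2, a3, a4⟩ := g1
  obtain ⟨b1, b2, b3, b4⟩ := g2
  obtain ⟨c1, c2, c3, c4⟩ := g3
  obtain ⟨d1, d2, d3, d4⟩ := g4
  push_cast at b1 b2 b3 b4 c1 c2 c3 c4 d1 d2 d3 d4
  obtain ⟨-, -, hE⟩ := LEE x h u α β (mm x u) (mm x (u + 2 * α)) (mm x (u + 2 * β))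
      (mm x (u + 2 * α + 2 * β)) hx hα' hβ' (by linarith) (by linarith) b3 c3 d4 I
  have hE' : (1 : ℝ) ≤ mm x u - mm x (u + 2 * α) - mm x (u + 2 * β) + mm x (u + 2 * α + 2 * β) := by
    exact_mod_cast hE
  have main : ∀ (p b : ℝ) (m m' : ℤ), M < p → 0 < b → m * p ^ 2 ≤ x + h → x < m' * (p + b) ^ 2 →
      (m : ℝ) - m' ≤ 2 * b * x / M ^ 3 + h / M ^ 2 := by
    intro p b m m' hp hb k1 k2
    have hp0 : 0 < p := by linarith
    have j1 : (m : ℝ) ≤ (x + h) / p ^ 2 := by rw [le_div_iff₀ (by positivity)]; exact k1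
    have j2 : x / (p + b) ^ 2 < m' := by rw [div_lt_iff₀ (by positivity)]; exact k2
    have j3 := sq_diff_le M p b hM hp.le hb.le
    have j4 : h / p ^ 2 ≤ h / M ^ 2 := by gcongr
    have j5 : x * (1 / p ^ 2 - 1 / (p + b) ^ 2) ≤ x * (2 * b / M ^ 3) := by gcongr
    have j6 : x * (1 / p ^ 2 - 1 / (p + b) ^ 2) = x / p ^ 2 - x / (p + b) ^ 2 := by ring
    have j7 : x * (2 * b / M ^ 3) = 2 * b * x / M ^ 3 := by ring
    rw [add_div] at j1
    linarith
  have p1 := main (u + 2 * α) (2 * β) _ _ b1 (by linarith) b4 d3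
  have q1 := main (u + 2 * β) (2 * α) _ _ c1 (by linarith) c4 (by convert d3 using 3; ring)
  obtain ⟨y, hy⟩ : ∃ y, y = x / M ^ 3 := ⟨_, rfl⟩
  obtain ⟨z, hz⟩ : ∃ z, z = h / M ^ 2 := ⟨_, rfl⟩
  have hz0 : 0 < z := by rw [hz]; positivity
  have hy0 : 0 < y := by rw [hy]; positivity
  have hzM : M * z ≤ 2 / 11 := by
    rw [hz, show M * (h / M ^ 2) = h / M by field_simp, div_le_div_iff₀ hM (by norm_num)]; linarith
  rw [mul_div_assoc, ← hy, ← hz] at p1 q1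
  have e : (u - α : ℝ) * ((mm x u : ℝ) - mm x (u + 2 * α) - mm x (u + 2 * β) + mm x (u + 2 * α + 2 * β))
     = 4 * α * (mm x (u + 2 * α) - mm x (u + 2 * α + 2 * β))
       + 2 * β * (mm x (u + 2 * β) - mm x (u + 2 * α + 2 * β)) := by
    linear_combination -I
  have e1 : (u - α : ℝ) * 1 ≤ (u - α : ℝ) * ((mm x u : ℝ) - mm x (u + 2 * α) - mm x (u + 2 * β) + mm x (u + 2 * α + 2 * β)) := by
    apply mul_le_mul_of_nonneg_left hE'; linarith
  have e2 : 4 * (α : ℝ) * (mm x (u + 2 * α) - mm x (u + 2 * α + 2 * β)) ≤ 4 * α * (2 * (2 * β) * y + z) := by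
    gcongr
  have e3 : 2 * (β : ℝ) * (mm x (u + 2 * β) - mm x (u + 2 * α + 2 * β)) ≤ 2 * β * (2 * (2 * α) * y + z) := by
    gcongr
  have e4 : (4 * α + 2 * β : ℝ) * z ≤ (0.135 * M) * z := by gcongr; linarith
  have e5 : 0.95 * M ≤ 24 * α * β * y := by nlinarith
  have e6 : M ^ 4 = M * M ^ 3 := by ring
  have e7 : x = y * M ^ 3 := by rw [hy]; field_simp
  rw [e6]
  have : M ≤ 28 * α * β * y := by
    have : 0 < (α : ℝ) * β * y := by positivity
    nlinarith
  calc M * M ^ 3 ≤ (28 * α * β * y) * M ^ 3 := by gcongr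
    _ = 28 * α * β * x := by rw [hy]; field_simp

lemma block (T : Finset ℤ) (p L B : ℝ) (m : ℕ) (hB : 0 < B) (hL : 0 ≤ L)
    (h1 : ∀ u ∈ T, p ≤ (u : ℝ) ∧ (u : ℝ) ≤ p + L)
    (h2 : ∀ s ⊆ T, (∀ u ∈ s, ∀ v ∈ s, (v : ℝ) - u < B) → s.card ≤ m) :
    (T.card : ℝ) ≤ m * (1 + L / B) := by
  have key : T.card ≤ m * (Finset.range (⌊L / B⌋₊ + 1)).card := by
    apply Finset.card_le_mul_card_image_of_maps_to (f := fun u : ℤ => ⌊((u : ℝ) - p) / B⌋₊)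
    · intro u hu
      have := h1 u hu
      rw [Finset.mem_range]
      apply Nat.lt_succ_of_le
      apply Nat.floor_le_floor
      gcongr
      linarith
    · intro i hi
      apply h2 _ (Finset.filter_subset _ _)
      intro u hu v hv
      simp only [Finset.mem_filter] at hu hv
      have hu1 := h1 u hu.1
      have hv1 := h1 v hv.1
      have a1 : (i : ℝ) ≤ ((u : ℝ) - p) / B := by
        rw [← hu.2]; apply Nat.floor_le; apply div_nonneg _ hB.le; linarith
      have a2 : ((v : ℝ) - p) / B < i + 1 := by
        rw [← hv.2]; apply Nat.lt_floor_add_one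
      rw [le_div_iff₀ hB] at a1
      rw [div_lt_iff₀ hB] at a2
      linarith
  rw [Finset.card_range] at key
  have : (T.card : ℝ) ≤ m * ((⌊L / B⌋₊ : ℝ) + 1) := by exact_mod_cast key
  have f := Nat.floor_le (div_nonneg hL hB.le)
  calc (T.card : ℝ) ≤ m * ((⌊L / B⌋₊ : ℝ) + 1) := this
    _ ≤ m * (1 + L / B) := mul_le_mul_of_nonneg_left (by linarith) (by positivity)

lemma exists_base (T : Finset ℤ) (L : ℝ) (hL : 0 ≤ L)
    (h : ∀ u ∈ T, ∀ v ∈ T, u < v → (v : ℝ) - u ≤ L) :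
    ∃ p : ℝ, ∀ u ∈ T, p ≤ (u : ℝ) ∧ (u : ℝ) ≤ p + L := by
  rcases T.eq_empty_or_nonempty with rfl | hne
  · exact ⟨0, by simp⟩
  · refine ⟨(T.min' hne : ℤ), fun u hu => ?_⟩
    have a := T.min'_le u hu
    refine ⟨by exact_mod_cast a, ?_⟩
    rcases a.lt_or_eq with a | a
    · have := h _ (T.min'_mem hne) u hu a
      linarith
    · rw [← a]; linarith

lemma cluster1 (T : Finset ℤ) (L B : ℝ) (hB : 0 < B) (hL : 0 ≤ L)
    (h1 : ∀ u ∈ T, ∀ v ∈ T, u < v → (v : ℝ) - u ≤ L)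
    (h2 : ∀ u ∈ T, ∀ v ∈ T, u < v → B ≤ (v : ℝ) - u) :
    (T.card : ℝ) ≤ 1 + L / B := by
  obtain ⟨p, hp⟩ := exists_base T L hL h1
  have := block T p L B 1 hB hL hp ?_
  · simpa using this
  · intro s hs hd
    rw [Finset.card_le_one]
    intro a ha b hb
    by_contra hne
    rcases lt_or_gt_of_ne hne with h | h
    · linarith [h2 a (hs ha) b (hs hb) h, hd a ha b hb]
    · linarith [h2 b (hs hb) a (hs ha) h, hd b hb a ha]

lemma cluster2 (T : Finset ℤ) (L B : ℝ) (c : ℤ) (hB : 0 < B) (hL : 0 ≤ L)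
    (h1 : ∀ u ∈ T, ∀ v ∈ T, u < v → (v : ℝ) - u ≤ L)
    (h2 : ∀ u ∈ T, ∀ v ∈ T, u < v → v - u = c ∨ B ≤ (v : ℝ) - u) :
    (T.card : ℝ) ≤ 2 + 2 * (L / B) := by
  obtain ⟨p, hp⟩ := exists_base T L hL h1
  have := block T p L B 2 hB hL hp ?_
  · push_cast at this; linarith
  · intro s hs hd
    by_contra hc
    obtain ⟨x, y, z, hx, hy, hz, hxy, hxz, hyz⟩ := Finset.two_lt_card_iff.mp (by omega : 2 < s.card)
    have F : ∀ u ∈ s, ∀ v ∈ s, u < v → v - u = c := by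
      intro u hu v hv huv
      rcases h2 u (hs hu) v (hs hv) huv with h | h
      · exact h
      · linarith [hd u hu v hv]
    have f1 := F x hx y hy
    have f2 := F y hy x hx
    have f3 := F x hx z hz
    have f4 := F z hz x hx
    have f5 := F y hy z hz
    have f6 := F z hz y hy
    omega

/-- data for a set of pairs with fixed even difference -/
def IsT (x h M : ℝ) (α : ℤ) (T : Finset ℤ) : Prop :=
  ∀ u ∈ T, Odd u ∧ Good x h M u ∧ Good x h M (u + 2 * α)

lemma pairT (x h M : ℝ) (hx : 0 < x) (hM : 0 < M) (hh : 0 < h) (hMh : 11 * h ≤ 2 * M) (α : ℤ)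
    (hα : 1 ≤ α) (B : ℝ) (hB : 0 < B) (hB3 : 44 * α * x * B ^ 3 ≤ 7 * M ^ 5)
    (u v : ℤ) (hu : Odd u ∧ Good x h M u ∧ Good x h M (u + 2 * α))
    (hv : Odd v ∧ Good x h M v ∧ Good x h M (v + 2 * α)) (huv : u < v) (hD : DD x α u = DD x α v) :
    (v - u = 2 * α ∨ B ≤ (v : ℝ) - u) ∧ (v : ℝ) - u ≤ 1.045 ^ 5 * h * M ^ 4 / (8 * (α : ℝ) ^ 3 * x)
     ∧ M ^ 4 / (14 * α * x) ≤ (v : ℝ) - u := by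
  obtain ⟨u1, u2, u3⟩ := hu
  obtain ⟨v1, v2, v3⟩ := hv
  have hα' : (1 : ℝ) ≤ α := by exact_mod_cast hα
  obtain ⟨β, hβ⟩ : ∃ β, v = u + 2 * β := by
    obtain ⟨i, hi⟩ := u1
    obtain ⟨j, hj⟩ := v1
    exact ⟨j - i, by omega⟩
  have hβ1 : 1 ≤ β := by omega
  have hβ' : (1 : ℝ) ≤ β := by exact_mod_cast hβ1
  subst hβ
  have v3' : Good x h M (u + 2 * α + 2 * β) := by convert v3 using 1; ring
  have e : (((u + 2 * β : ℤ) : ℝ)) - u = 2 * β := by push_cast; ring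
  rw [e]
  refine ⟨?_, ?_, ?_⟩
  · by_cases hne : α = β
    · left; rw [hne]; ring
    · right
      have := D2 x h M hx hM hh hMh α β u hα hβ1 hne u2 u3 v2 v3' hD
      rw [div_le_div_iff₀ (by norm_num) (by positivity)] at this
      have h3 : B ^ 3 ≤ (2 * β : ℝ) ^ 3 := by
        have : 44 * α * x * B ^ 3 ≤ 44 * α * x * (2 * β : ℝ) ^ 3 := by linarith
        exact le_of_mul_le_mul_left this (by positivity)
      exact le_of_pow_le_pow_left₀ (by norm_num) (by positivity) h3
  · have := D3 x h M hx hM hh α β u hα hβ1 u2 u3 v2 v3' hD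
    rw [← mul_div_assoc, div_le_div_iff₀ (by positivity) hM] at this
    rw [le_div_iff₀ (by positivity)]
    have : M * (2 * β * (8 * (α : ℝ) ^ 3 * x)) ≤ M * (1.045 ^ 5 * h * M ^ 4) := by
      linarith
    exact le_of_mul_le_mul_left this hM
  · have := D4 x h M hx hM hh hMh α β u hα hβ1 u2 u3 v2 v3' hD
    rw [div_le_iff₀ (by positivity)]
    linarith

lemma GG_bounds (x h M : ℝ) (hx : 0 < x) (hM : 0 < M) (α u : ℤ) (hα : 1 ≤ α)
    (g1 : Good x h M u) (g2 : Good x h M (u + 2 * α)) :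
    4 * (α : ℝ) ^ 3 * x / M ^ 4 * (1 - 0.16145) ≤ GG x α u ∧ GG x α u ≤ 4 * (α : ℝ) ^ 3 * x / M ^ 4 := by
  have hα' : (1 : ℝ) ≤ α := by exact_mod_cast hα
  have a := g1.1
  have b := g2.2.1
  push_cast at b
  have hu0 : (0 : ℝ) < u := by linarith
  unfold GG
  constructor
  · calc 4 * (α : ℝ) ^ 3 * x / M ^ 4 * (1 - 0.16145)
        ≤ 4 * (α : ℝ) ^ 3 * x / M ^ 4 * (1 / 1.045 ^ 4) := by gcongr; norm_num
      _ = 4 * (α : ℝ) ^ 3 * x / ((1.045 * M) ^ 2 * (1.045 * M) ^ 2) := by field_simp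
      _ ≤ _ := by gcongr; linarith
  · calc 4 * (α : ℝ) ^ 3 * x / ((u : ℝ) ^ 2 * (u + 2 * α : ℝ) ^ 2)
        ≤ 4 * (α : ℝ) ^ 3 * x / (M ^ 2 * M ^ 2) := by gcongr; linarith
      _ = _ := by ring

lemma T1 (x h M : ℝ) (hx : 0 < x) (hM : 0 < M) (hh : 0 < h) (hMh : 11 * h ≤ 2 * M) (α : ℤ)
    (hα : 1 ≤ α) (B : ℝ) (hB : 0 < B) (hB3 : 44 * α * x * B ^ 3 ≤ 7 * M ^ 5)
    (T : Finset ℤ) (hT : IsT x h M α T) :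
    (T.card : ℝ) ≤ (0.16145 * (4 * (α : ℝ) ^ 3 * x / M ^ 4) + 15 / 11) *
      (2 + 2 * (1.045 ^ 5 * h * M ^ 4 / (8 * (α : ℝ) ^ 3 * x) / B)) := by
  classical
  have hα' : (1 : ℝ) ≤ α := by exact_mod_cast hα
  set L := 1.045 ^ 5 * h * M ^ 4 / (8 * (α : ℝ) ^ 3 * x) with hL
  have hL0 : 0 ≤ L := by positivity
  set G := 4 * (α : ℝ) ^ 3 * x / M ^ 4 with hG
  have hG0 : 0 ≤ G := by positivity
  have hhM : h / M ≤ 2 / 11 := by rw [div_le_div_iff₀ hM (by norm_num)]; linarith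
  rw [Finset.card_eq_sum_card_image (DD x α) T]
  push_cast
  have fib : ∀ k ∈ T.image (DD x α), ((T.filter (fun u => DD x α u = k)).card : ℝ) ≤ 2 + 2 * (L / B) := by
    intro k _
    apply cluster2 _ L B (2 * α) hB hL0
    · intro u hu v hv huv
      rw [Finset.mem_filter] at hu hv
      exact (pairT x h M hx hM hh hMh α hα B hB hB3 u v (hT u hu.1) (hT v hv.1) huv
        (by rw [hu.2, hv.2])).2.1
    · intro u hu v hv huv
      rw [Finset.mem_filter] at hu hv
      exact (pairT x h M hx hM hh hMh α hα B hB hB3 u v (hT u hu.1) (hT v hv.1) huv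
        (by rw [hu.2, hv.2])).1
  have s1 := Finset.sum_le_card_nsmul _ _ _ fib
  rw [nsmul_eq_mul] at s1
  refine s1.trans ?_
  gcongr
  have sub : T.image (DD x α) ⊆ Finset.Icc ⌈G * (1 - 0.16145) - 2 / 11⌉ ⌊G + 2 / 11⌋ := by
    intro k hk
    obtain ⟨u, hu, rfl⟩ := Finset.mem_image.mp hk
    obtain ⟨u1, u2, u3⟩ := hT u hu
    have b := GG_bounds x h M hx hM α u hα u2 u3
    have d := D1' x h M hM hh α u hα u2 u3
    rw [abs_le] at d
    rw [Finset.mem_Icc]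
    constructor
    · apply Int.ceil_le.mpr; linarith
    · apply Int.le_floor.mpr; linarith
  have c1 := Finset.card_le_card sub
  rw [Int.card_Icc] at c1
  have c2 : ((T.image (DD x α)).card : ℝ) ≤ ((⌊G + 2 / 11⌋ + 1 - ⌈G * (1 - 0.16145) - 2 / 11⌉).toNat : ℝ) := by
    exact_mod_cast c1
  refine c2.trans ?_
  have c3 : (((⌊G + 2 / 11⌋ + 1 - ⌈G * (1 - 0.16145) - 2 / 11⌉).toNat : ℤ) : ℝ)
      = ((max (⌊G + 2 / 11⌋ + 1 - ⌈G * (1 - 0.16145) - 2 / 11⌉) 0 : ℤ) : ℝ) := by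
    rw [Int.toNat_eq_max]
  rw [Int.cast_natCast] at c3
  rw [c3]
  push_cast
  apply max_le
  · have := Int.floor_le (G + 2 / 11)
    have := Int.le_ceil (G * (1 - 0.16145) - 2 / 11)
    linarith
  · positivity

lemma T2 (x h M : ℝ) (hx : 0 < x) (hM : 0 < M) (hh : 0 < h) (hMh : 11 * h ≤ 2 * M) (α : ℤ)
    (hα : 1 ≤ α) (B : ℝ) (hB : 0 < B) (hB3 : 44 * α * x * B ^ 3 ≤ 7 * M ^ 5)
    (T : Finset ℤ) (hT : IsT x h M α T) (hs : 4 * (α : ℝ) ^ 3 * x / M ^ 4 ≤ 0.8) :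
    (T.card : ℝ) ≤ 2 + 2 * (0.045 * M / B) ∧
    (T.card : ℝ) ≤ 1 + 0.045 * M / (M ^ 4 / (14 * α * x)) ∧
    (T.Nonempty → 4 * (α : ℝ) ^ 3 * x ≤ h * (1.045 * M) ^ 3) := by
  have hα' : (1 : ℝ) ≤ α := by exact_mod_cast hα
  have hhM : h / M ≤ 2 / 11 := by rw [div_le_div_iff₀ hM (by norm_num)]; linarith
  have zero : ∀ u ∈ T, DD x α u = 0 := by
    intro u hu
    obtain ⟨u1, u2, u3⟩ := hT u hu
    have b := GG_bounds x h M hx hM α u hα u2 u3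
    have d := D1' x h M hM hh α u hα u2 u3
    have : 0 ≤ 4 * (α : ℝ) ^ 3 * x / M ^ 4 := by positivity
    rw [abs_le] at d
    have e1 : (DD x α u : ℝ) < 1 := by linarith
    have e2 : (-1 : ℝ) < DD x α u := by linarith
    have e1' : DD x α u < 1 := by exact_mod_cast e1
    have e2' : -1 < DD x α u := by exact_mod_cast e2
    omega
  have dist : ∀ u ∈ T, ∀ v ∈ T, u < v → (v : ℝ) - u ≤ 0.045 * M := by
    intro u hu v hv _
    have a := (hT u hu).2.1.1
    have b := (hT v hv).2.1.2.1
    linarith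
  refine ⟨?_, ?_, ?_⟩
  · apply cluster2 _ _ B (2 * α) hB (by positivity) dist
    intro u hu v hv huv
    exact (pairT x h M hx hM hh hMh α hα B hB hB3 u v (hT u hu) (hT v hv) huv
        (by rw [zero u hu, zero v hv])).1
  · apply cluster1 _ _ _ (by positivity) (by positivity) dist
    intro u hu v hv huv
    exact (pairT x h M hx hM hh hMh α hα B hB hB3 u v (hT u hu) (hT v hv) huv
        (by rw [zero u hu, zero v hv])).2.2
  · rintro ⟨u, hu⟩
    obtain ⟨u1, u2, u3⟩ := hT u hu
    have d := D1 x h M hM α u hα u2 u3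
    rw [zero u hu] at d
    have a := u2.1
    have b := u3.2.1
    push_cast at b
    have hu0 : (0 : ℝ) < u := by linarith
    rw [abs_le] at d
    have d2 : GG x α u ≤ h / u := by have := d.1; push_cast at this; linarith
    unfold GG at d2
    rw [div_le_div_iff₀ (by positivity) hu0] at d2
    have d3 : 4 * (α : ℝ) ^ 3 * x ≤ h * (u * (u + 2 * α) ^ 2) := by
      have : (u : ℝ) * (4 * (α : ℝ) ^ 3 * x) ≤ u * (h * (u * (u + 2 * α) ^ 2)) := by linarith
      exact le_of_mul_le_mul_left this hu0
    refine d3.trans ?_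
    gcongr
    calc (u : ℝ) * (u + 2 * α) ^ 2 ≤ (1.045 * M) * (1.045 * M) ^ 2 := by gcongr; linarith
      _ = _ := by ring

noncomputable def qq (j : ℕ) : ℝ := (j : ℝ) ^ ((1 : ℝ) / 3)

lemma qq_cube (j : ℕ) : qq j ^ 3 = j := by
  unfold qq
  rw [← Real.rpow_natCast, ← Real.rpow_mul (by positivity)]
  norm_num

lemma qq_nonneg (j : ℕ) : 0 ≤ qq j := by unfold qq; positivity

lemma qq_mono {i j : ℕ} (h : i ≤ j) : qq i ≤ qq j := by
  unfold qq
  apply Real.rpow_le_rpow (by positivity) (by exact_mod_cast h) (by norm_num)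

lemma qq_pos {j : ℕ} (h : 1 ≤ j) : 0 < qq j := by
  unfold qq
  apply Real.rpow_pos_of_pos
  exact_mod_cast h

lemma tel (p q : ℝ) (hp : 0 < p) (hq : 0 < q) (h : q ^ 3 = p ^ 3 + 1) :
    1 / q ^ 8 ≤ 0.6 * (1 / p ^ 5 - 1 / q ^ 5) := by
  have key : 0 ≤ 3 * q ^ 8 - 8 * p ^ 5 * q ^ 3 + 5 * p ^ 8 := by
    have : 3 * q ^ 8 - 8 * p ^ 5 * q ^ 3 + 5 * p ^ 8 = (q - p) ^ 2 * (3*q^6+6*q^5*p+9*q^4*p^2+12*q^3*p^3+15*q^2*p^4+10*q*p^5+5*p^6) := by ring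
    rw [this]; positivity
  have e : 0.6 * (1 / p ^ 5 - 1 / q ^ 5) - 1 / q ^ 8 =
     (3 * q ^ 3 * (q ^ 5 - p ^ 5) - 5 * p ^ 5) / (5 * p ^ 5 * q ^ 8) := by
    field_simp; ring
  have : 0 ≤ (3 * q ^ 3 * (q ^ 5 - p ^ 5) - 5 * p ^ 5) / (5 * p ^ 5 * q ^ 8) := by
    apply div_nonneg _ (by positivity)
    have : p ^ 5 * q ^ 3 = p ^ 5 * (p ^ 3 + 1) := by rw [h]
    nlinarith
  linarith

lemma tailsum (q0 : ℝ) (h0 : 0 < q0) (K : ℕ) :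
    ∑ j ∈ Finset.Icc 1 K, (if q0 ≤ qq j then 1 / qq j ^ 8 else 0) ≤
      1 / q0 ^ 8 + 0.6 * (1 / q0 ^ 5) := by
  have : ∑ j ∈ Finset.Icc 1 K, (if q0 ≤ qq j then 1 / qq j ^ 8 else 0) ≤
      (if q0 ≤ qq K then 1 / q0 ^ 8 + 0.6 * (1 / q0 ^ 5 - 1 / qq K ^ 5) else 0) := by
    induction K with
    | zero =>
      simp [qq, h0.not_ge]
    | succ n ih =>
      rw [Finset.sum_Icc_succ_top (by omega)]
      have mon := qq_mono (Nat.le_succ n)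
      have c1 := qq_cube n
      have c2 := qq_cube (n + 1)
      by_cases h1 : q0 ≤ qq n
      · have h2 : q0 ≤ qq (n + 1) := h1.trans mon
        rw [if_pos h1] at ih
        rw [if_pos h2, if_pos h2]
        have := tel (qq n) (qq (n + 1)) (by linarith) (by linarith) (by rw [c1, c2]; push_cast; ring)
        linarith
      · rw [if_neg h1] at ih
        by_cases h2 : q0 ≤ qq (n + 1)
        · rw [if_pos h2, if_pos h2]
          have a1 : 1 / qq (n + 1) ^ 8 ≤ 1 / q0 ^ 8 := by gcongr
          have a2 : 1 / qq (n + 1) ^ 5 ≤ 1 / q0 ^ 5 := by gcongr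
          linarith
        · rw [if_neg h2, if_neg h2]; linarith
  refine this.trans ?_
  split_ifs with h
  · have : 0 ≤ 1 / qq K ^ 5 := by have := qq_nonneg K; positivity
    linarith
  · positivity

lemma fullsum (K : ℕ) :
    ∑ j ∈ Finset.Icc 1 K, 1 / qq j ^ 8 ≤ 1.3645 := by
  have t := tailsum 1.25 (by norm_num) K
  have : ∑ j ∈ Finset.Icc 1 K, 1 / qq j ^ 8 ≤ ∑ j ∈ Finset.Icc 1 K,
     ((if (1.25:ℝ) ≤ qq j then 1 / qq j ^ 8 else 0) + (if j = 1 then 1 else 0)) := by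
    apply Finset.sum_le_sum
    intro j hj
    rw [Finset.mem_Icc] at hj
    by_cases h : j = 1
    · subst h
      have : qq 1 = 1 := by simp [qq]
      rw [this]; norm_num
    · have h2 : 2 ≤ j := by omega
      have : (1.25 : ℝ) ≤ qq j := by
        apply le_of_pow_le_pow_left₀ (n := 3) (by norm_num) (qq_nonneg j)
        rw [qq_cube]
        have : (2 : ℝ) ≤ j := by exact_mod_cast h2
        norm_num; linarith
      rw [if_pos this, if_neg h]; linarith
  rw [Finset.sum_add_distrib] at this
  have s2 : ∑ j ∈ Finset.Icc 1 K, (if j = 1 then (1:ℝ) else 0) ≤ 1 := by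
    rw [Finset.sum_ite_eq']
    split_ifs <;> norm_num
  norm_num at t ⊢
  norm_num at this s2
  linarith

lemma headsum (qm : ℝ) (hm : 0 ≤ qm) (K : ℕ) (g : ℝ → ℝ) (c : ℝ) (hc : 0 ≤ c)
    (hg : ∀ q, 0 ≤ q → q ≤ qm → g q ≤ c) :
    ∑ j ∈ Finset.Icc 1 K, (if qq j ≤ qm then g (qq j) else 0) ≤ qm ^ 3 * c := by
  rw [← Finset.sum_filter]
  have h1 : ∑ j ∈ (Finset.Icc 1 K).filter (fun j => qq j ≤ qm), g (qq j) ≤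
     ((Finset.Icc 1 K).filter (fun j => qq j ≤ qm)).card • c := by
    apply Finset.sum_le_card_nsmul
    intro j hj
    rw [Finset.mem_filter] at hj
    exact hg _ (qq_nonneg j) hj.2
  rw [nsmul_eq_mul] at h1
  refine h1.trans ?_
  apply mul_le_mul_of_nonneg_right _ hc
  have h2 : ((Finset.Icc 1 K).filter (fun j => qq j ≤ qm)) ⊆ Finset.Icc 1 ⌊qm ^ 3⌋₊ := by
    intro j hj
    rw [Finset.mem_filter, Finset.mem_Icc] at hj
    rw [Finset.mem_Icc]
    refine ⟨hj.1.1, ?_⟩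
    apply Nat.le_floor
    rw [← qq_cube]
    have := qq_nonneg j
    have := hj.2
    gcongr
  have h3 := Finset.card_le_card h2
  rw [Nat.card_Icc] at h3
  have h4 := Nat.floor_le (show 0 ≤ qm ^ 3 by positivity)
  have : (((Finset.Icc 1 K).filter (fun j => qq j ≤ qm)).card : ℝ) ≤ (⌊qm ^ 3⌋₊ : ℝ) := by
    exact_mod_cast h3
  linarith

/-- T1 in new variables -/
lemma T1' (r s η : ℝ) (hr : 0 < r) (hs : 0 < s) (hη : 0 < η) (hMh : 11 * η ^ 9 ≤ 2 * s ^ 9)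
    (j : ℕ) (hj : 1 ≤ j) (T : Finset ℤ) (hT : IsT (r ^ 45) (η ^ 9 * r ^ 9) (s ^ 9 * r ^ 9) j T) :
    (T.card : ℝ) ≤ 30 / 11 + 1.2916 * (qq j ^ 9 * r ^ 9 / s ^ 36)
      + 0.3714 * (η ^ 9 * r ^ 9 * qq j / s ^ 15) + 0.7842 * (η ^ 9 * s ^ 21) * (1 / qq j ^ 8) := by
  have hq := qq_pos hj
  have c := qq_cube j
  have := T1 (r ^ 45) (η ^ 9 * r ^ 9) (s ^ 9 * r ^ 9) (by positivity) (by positivity) (by positivity)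
    (by have : 0 < r ^ 9 := by positivity
        nlinarith) j (by exact_mod_cast hj) (0.5418 * s ^ 15 / qq j) (by positivity) ?_ T hT
  · push_cast at this
    rw [← c] at this
    refine this.trans ?_
    have e1 : 4 * (qq j ^ 3) ^ 3 * r ^ 45 / (s ^ 9 * r ^ 9) ^ 4 = 4 * (qq j ^ 9 * r ^ 9 / s ^ 36) := by
      field_simp
    have e2 : 1.045 ^ 5 * (η ^ 9 * r ^ 9) * (s ^ 9 * r ^ 9) ^ 4 / (8 * (qq j ^ 3) ^ 3 * r ^ 45) / (0.5418 * s ^ 15 / qq j)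
       = 1.045 ^ 5 / 8 / 0.5418 * (η ^ 9 * s ^ 21 * (1 / qq j ^ 8)) := by
      field_simp
    rw [e1, e2]
    have e3 : (qq j ^ 9 * r ^ 9 / s ^ 36) * (η ^ 9 * s ^ 21 * (1 / qq j ^ 8)) =
      η ^ 9 * r ^ 9 * qq j / s ^ 15 := by field_simp
    have p1 : 0 < qq j ^ 9 * r ^ 9 / s ^ 36 := by positivity
    have p2 : 0 < η ^ 9 * s ^ 21 * (1 / qq j ^ 8) := by positivity
    have p3 : 0 < η ^ 9 * r ^ 9 * qq j / s ^ 15 := by positivity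
    rw [mul_assoc 0.7842]
    generalize qq j ^ 9 * r ^ 9 / s ^ 36 = X at *
    generalize η ^ 9 * s ^ 21 * (1 / qq j ^ 8) = Y at *
    generalize η ^ 9 * r ^ 9 * qq j / s ^ 15 = Z at *
    have : (0.16145 * (4 * X) + 15 / 11) * (2 + 2 * (1.045 ^ 5 / 8 / 0.5418 * Y)) =
      30 / 11 + 1.2916 * X + 0.16145 * 8 * (1.045 ^ 5 / 8 / 0.5418) * (X * Y) + 30 / 11 * (1.045 ^ 5 / 8 / 0.5418) * Y := by ring
    rw [this, e3]
    norm_num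
    linarith
  · push_cast
    rw [← c]
    have : 44 * qq j ^ 3 * r ^ 45 * (0.5418 * s ^ 15 / qq j) ^ 3 = 44 * 0.5418 ^ 3 * (r ^ 45 * s ^ 45) := by
      field_simp
    rw [this]
    have : 7 * (s ^ 9 * r ^ 9) ^ 5 = 7 * (r ^ 45 * s ^ 45) := by ring
    rw [this]
    have : 0 < r ^ 45 * s ^ 45 := by positivity
    norm_num
    linarith

lemma T2' (r s η : ℝ) (hr : 0 < r) (hs : 0 < s) (hη : 0 < η) (hMh : 11 * η ^ 9 ≤ 2 * s ^ 9)
    (j : ℕ) (hj : 1 ≤ j) (T : Finset ℤ) (hT : IsT (r ^ 45) (η ^ 9 * r ^ 9) (s ^ 9 * r ^ 9) j T)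
    (hq0 : qq j ≤ 0.836 * s ^ 4 / r) :
    (T.card : ℝ) ≤ 2 + (if qq j ≤ 0.87 * η * s ^ 3 / r then 0.1662 * (r ^ 9 / s ^ 6) * qq j else 0) ∧
    (T.card : ℝ) ≤ 2 + (if qq j ≤ 0.87 * η * s ^ 3 / r then 0.63 * (r ^ 18 / s ^ 27) * qq j ^ 3 else 0)
     := by
  have hq := qq_pos hj
  have c := qq_cube j
  have := T2 (r ^ 45) (η ^ 9 * r ^ 9) (s ^ 9 * r ^ 9) (by positivity) (by positivity) (by positivity)
    (by have : 0 < r ^ 9 := by positivity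
        nlinarith) j (by exact_mod_cast hj) (0.5418 * s ^ 15 / qq j) (by positivity) ?_ T hT ?_
  · obtain ⟨t1, t2, t3⟩ := this
    push_cast at t1 t2 t3
    rw [← c] at t2 t3
    by_cases hqm : qq j ≤ 0.87 * η * s ^ 3 / r
    · rw [if_pos hqm, if_pos hqm]
      constructor
      · refine t1.trans ?_
        have e : 2 * (0.045 * (s ^ 9 * r ^ 9) / (0.5418 * s ^ 15 / qq j)) = 0.09 / 0.5418 * (r ^ 9 / s ^ 6 * qq j) := by
          field_simp; norm_num
        rw [e, mul_assoc]
        gcongr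
        norm_num
      · refine t2.trans ?_
        have e : 0.045 * (s ^ 9 * r ^ 9) / ((s ^ 9 * r ^ 9) ^ 4 / (14 * qq j ^ 3 * r ^ 45)) = 0.63 * (r ^ 18 / s ^ 27) * qq j ^ 3 := by
          field_simp; norm_num
        rw [e]
        linarith
    · have : T = ∅ := by
        by_contra hne
        apply hqm
        have t := t3 (Finset.nonempty_iff_ne_empty.mpr hne)
        apply le_of_pow_le_pow_left₀ (n := 9) (by norm_num) (by positivity)
        have e : (0.87 * η * s ^ 3 / r) ^ 9 = 0.87 ^ 9 * (η ^ 9 * s ^ 27) / r ^ 9 := by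
          field_simp
        rw [e, le_div_iff₀ (by positivity)]
        have e1 : 4 * (qq j ^ 3) ^ 3 * r ^ 45 = 4 * (qq j ^ 9 * r ^ 9) * r ^ 36 := by ring
        have e2 : η ^ 9 * r ^ 9 * (1.045 * (s ^ 9 * r ^ 9)) ^ 3 = 1.045 ^ 3 * (η ^ 9 * s ^ 27) * r ^ 36 := by ring
        rw [e1, e2] at t
        have t := le_of_mul_le_mul_right t (by positivity)
        have : 0 < η ^ 9 * s ^ 27 := by positivity
        norm_num at t ⊢
        linarith
      rw [this, if_neg hqm, if_neg hqm]
      norm_num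
  · push_cast
    rw [← c]
    have : 44 * qq j ^ 3 * r ^ 45 * (0.5418 * s ^ 15 / qq j) ^ 3 = 44 * 0.5418 ^ 3 * (r ^ 45 * s ^ 45) := by
      field_simp
    rw [this]
    have : 7 * (s ^ 9 * r ^ 9) ^ 5 = 7 * (r ^ 45 * s ^ 45) := by ring
    rw [this]
    have : 0 < r ^ 45 * s ^ 45 := by positivity
    norm_num
    linarith
  · push_cast
    rw [← c]
    have e1 : 4 * (qq j ^ 3) ^ 3 * r ^ 45 / (s ^ 9 * r ^ 9) ^ 4 = 4 * (qq j / (s ^ 4 / r)) ^ 9 := by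
      field_simp
    rw [e1]
    have : qq j / (s ^ 4 / r) ≤ 0.836 := by
      rw [div_le_iff₀ (by positivity)]
      linarith [mul_div_assoc (0.836:ℝ) (s ^ 4) r]
    calc 4 * (qq j / (s ^ 4 / r)) ^ 9 ≤ 4 * 0.836 ^ 9 := by gcongr
      _ ≤ 0.8 := by norm_num

lemma union_bound (S : Finset ℤ) (hodd : ∀ u ∈ S, Odd u) (K : ℕ) :
    (S.card : ℝ) ≤ ((S.filter (fun u => ∀ v ∈ S, u < v → 2 * ((K:ℤ) + 1) ≤ v - u)).card : ℝ) +
      ∑ j ∈ Finset.Icc 1 K, ((S.filter (fun u => u + 2 * (j : ℤ) ∈ S)).card : ℝ) := by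
  classical
  have hsub : S ⊆ (S.filter (fun u => ∀ v ∈ S, u < v → 2 * ((K:ℤ) + 1) ≤ v - u)) ∪
      (Finset.Icc 1 K).biUnion (fun j => S.filter (fun u => u + 2 * (j : ℤ) ∈ S)) := by
    intro u hu
    rw [Finset.mem_union]
    by_cases h : ∀ v ∈ S, u < v → 2 * ((K:ℤ) + 1) ≤ v - u
    · left; rw [Finset.mem_filter]; exact ⟨hu, h⟩
    · right
      push Not at h
      obtain ⟨v, hv, huv, hlt⟩ := h
      rw [Finset.mem_biUnion]
      obtain ⟨a, ha⟩ := hodd u hu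
      obtain ⟨b, hb⟩ := hodd v hv
      refine ⟨(b - a).toNat, ?_, ?_⟩
      · rw [Finset.mem_Icc]; omega
      · rw [Finset.mem_filter]
        refine ⟨hu, ?_⟩
        have : u + 2 * ((b - a).toNat : ℤ) = v := by omega
        rw [this]; exact hv
  have h1 := Finset.card_le_card hsub
  have h2 := h1.trans (Finset.card_union_le _ _)
  have h3 := h2.trans (Nat.add_le_add_left Finset.card_biUnion_le _)
  exact_mod_cast h3

lemma sumconst (K : ℕ) (A c : ℝ) (hK : (K : ℝ) ≤ A) (hc : 0 ≤ c) (f : ℕ → ℝ)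
    (hf : ∀ j ∈ Finset.Icc 1 K, f j ≤ c) : ∑ j ∈ Finset.Icc 1 K, f j ≤ A * c := by
  have := Finset.sum_le_card_nsmul _ f c hf
  rw [Nat.card_Icc, nsmul_eq_mul] at this
  simp only [Nat.add_sub_cancel] at this
  exact this.trans (mul_le_mul_of_nonneg_right hK hc)

/-- common part of the sum -/
lemma common (r s η : ℝ) (hr : 0 < r) (hs : 0 < s) (hη : 0 < η) (K : ℕ)
    (hK : (K : ℝ) ≤ (0.492 * s ^ 3) ^ 3) :
    ∑ j ∈ Finset.Icc 1 K, (30 / 11 + 1.2916 * (qq j ^ 9 * r ^ 9 / s ^ 36)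
      + 0.3714 * (η ^ 9 * r ^ 9 * qq j / s ^ 15)) ≤
      0.34 * s ^ 9 + 0.0003 * r ^ 9 + 0.0218 * (η ^ 9 * r ^ 9 / s ^ 3) := by
  have := sumconst K _ (30 / 11 + 1.2916 * ((0.492 * s ^ 3) ^ 9 * r ^ 9 / s ^ 36)
      + 0.3714 * (η ^ 9 * r ^ 9 * (0.492 * s ^ 3) / s ^ 15)) hK (by positivity)
      (fun j => 30 / 11 + 1.2916 * (qq j ^ 9 * r ^ 9 / s ^ 36)
      + 0.3714 * (η ^ 9 * r ^ 9 * qq j / s ^ 15)) ?_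
  · refine this.trans ?_
    have e : (0.492 * s ^ 3) ^ 3 * (30 / 11 + 1.2916 * ((0.492 * s ^ 3) ^ 9 * r ^ 9 / s ^ 36)
      + 0.3714 * (η ^ 9 * r ^ 9 * (0.492 * s ^ 3) / s ^ 15)) =
      (0.492 ^ 3 * 30 / 11) * s ^ 9 + (1.2916 * 0.492 ^ 12) * r ^ 9 + (0.3714 * 0.492 ^ 4) * (η ^ 9 * r ^ 9 / s ^ 3) := by
      field_simp
    rw [e]
    gcongr <;> norm_num
  · intro j hj
    rw [Finset.mem_Icc] at hj
    have : qq j ≤ 0.492 * s ^ 3 := by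
      apply le_of_pow_le_pow_left₀ (n := 3) (by norm_num) (by positivity)
      rw [qq_cube]
      refine le_trans ?_ hK
      exact_mod_cast hj.2
    have := qq_nonneg j
    gcongr

lemma hd1 (r s η : ℝ) (hr : 0 < r) (hs : 0 < s) (hη : 0 < η) (K : ℕ) :
    ∑ j ∈ Finset.Icc 1 K, (if qq j ≤ 0.87 * η * s ^ 3 / r then 0.1662 * (r ^ 9 / s ^ 6) * qq j else 0)
     ≤ 0.0953 * (η ^ 4 * s ^ 6 * r ^ 5) := by
  have := headsum (0.87 * η * s ^ 3 / r) (by positivity) K (fun q => 0.1662 * (r ^ 9 / s ^ 6) * q)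
    (0.1662 * (r ^ 9 / s ^ 6) * (0.87 * η * s ^ 3 / r)) (by positivity) ?_
  · refine this.trans ?_
    have e : (0.87 * η * s ^ 3 / r) ^ 3 * (0.1662 * (r ^ 9 / s ^ 6) * (0.87 * η * s ^ 3 / r)) =
      (0.87 ^ 4 * 0.1662) * (η ^ 4 * s ^ 6 * r ^ 5) := by field_simp
    rw [e]; gcongr; norm_num
  · intro q h0 h1
    gcongr

lemma hd2 (r s η : ℝ) (hr : 0 < r) (hs : 0 < s) (hη : 0 < η) (K : ℕ) :
    ∑ j ∈ Finset.Icc 1 K, (if qq j ≤ 0.87 * η * s ^ 3 / r then 0.63 * (r ^ 18 / s ^ 27) * qq j ^ 3 else 0)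
     ≤ 0.2734 * (η ^ 6 * r ^ 12 / s ^ 9) := by
  have := headsum (0.87 * η * s ^ 3 / r) (by positivity) K (fun q => 0.63 * (r ^ 18 / s ^ 27) * q ^ 3)
    (0.63 * (r ^ 18 / s ^ 27) * (0.87 * η * s ^ 3 / r) ^ 3) (by positivity) ?_
  · refine this.trans ?_
    have e : (0.87 * η * s ^ 3 / r) ^ 3 * (0.63 * (r ^ 18 / s ^ 27) * (0.87 * η * s ^ 3 / r) ^ 3) =
      (0.87 ^ 6 * 0.63) * (η ^ 6 * r ^ 12 / s ^ 9) := by field_simp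
    rw [e]; gcongr; norm_num
  · intro q h0 h1
    gcongr

lemma minb (r s η : ℝ) (hr : 0 < r) (hs : 0 < s) (hη : 0 < η) (hbig : η ^ 36 ≤ 400 * r ^ 9) :
    0.0953 * (η ^ 4 * s ^ 6 * r ^ 5) ≤ 0.33 * r ^ 9 ∨
    0.2734 * (η ^ 6 * r ^ 12 / s ^ 9) ≤ 0.33 * r ^ 9 := by
  by_cases h : η ^ 4 * s ^ 6 ≤ 3.46 * r ^ 4
  · left
    calc 0.0953 * (η ^ 4 * s ^ 6 * r ^ 5) = 0.0953 * (η ^ 4 * s ^ 6) * r ^ 5 := by ring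
      _ ≤ 0.0953 * (3.46 * r ^ 4) * r ^ 5 := by gcongr
      _ = 0.329738 * r ^ 9 := by ring
      _ ≤ _ := by gcongr; norm_num
  · right
    push Not at h
    -- η^6 r^3 ≤ 1.2 s^9
    have b : η ^ 12 ≤ 7.4 * r ^ 3 := by
      apply le_of_pow_le_pow_left₀ (n := 3) (by norm_num) (by positivity)
      have : (0:ℝ) < r ^ 9 := by positivity
      calc (η ^ 12) ^ 3 = η ^ 36 := by ring
        _ ≤ 400 * r ^ 9 := hbig
        _ ≤ 7.4 ^ 3 * r ^ 9 := by gcongr; norm_num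
        _ = _ := by ring
    have k : η ^ 6 * r ^ 3 ≤ 1.2 * s ^ 9 := by
      apply le_of_pow_le_pow_left₀ (n := 2) (by norm_num) (by positivity)
      have h3 : (3.46 * r ^ 4) ^ 3 ≤ (η ^ 4 * s ^ 6) ^ 3 := by gcongr
      have h4 : η ^ 24 * r ^ 6 ≤ 7.4 ^ 2 * r ^ 12 := by
        calc η ^ 24 * r ^ 6 = (η ^ 12) ^ 2 * r ^ 6 := by ring
          _ ≤ (7.4 * r ^ 3) ^ 2 * r ^ 6 := by gcongr
          _ = _ := by ring
      have p12 : 0 < r ^ 12 := by positivity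
      have : η ^ 12 * (η ^ 6 * r ^ 3) ^ 2 ≤ η ^ 12 * (1.2 * s ^ 9) ^ 2 := by
        calc η ^ 12 * (η ^ 6 * r ^ 3) ^ 2 = η ^ 24 * r ^ 6 := by ring
          _ ≤ 7.4 ^ 2 * r ^ 12 := h4
          _ ≤ 1.2 ^ 2 * (3.46 * r ^ 4) ^ 3 := by ring_nf; linarith
          _ ≤ 1.2 ^ 2 * (η ^ 4 * s ^ 6) ^ 3 := by gcongr
          _ = _ := by ring
      exact le_of_mul_le_mul_left this (by positivity)
    have : η ^ 6 * r ^ 12 / s ^ 9 ≤ 1.2 * r ^ 9 := by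
      rw [div_le_iff₀ (by positivity)]
      calc η ^ 6 * r ^ 12 = (η ^ 6 * r ^ 3) * r ^ 9 := by ring
        _ ≤ (1.2 * s ^ 9) * r ^ 9 := by gcongr
        _ = _ := by ring
    have : 0 < r ^ 9 := by positivity
    linarith

lemma tl (r s η : ℝ) (hr : 0 < r) (hs : 0 < s) (hη : 0 < η) (h : 7018 ≤ s ^ 9) (hsr : s ≤ r) (K : ℕ) :
    ∑ j ∈ Finset.Icc 1 K, 0.7842 * (η ^ 9 * s ^ 21) * (if 0.836 * s ^ 4 / r ≤ qq j then 1 / qq j ^ 8 else 0)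
     ≤ 1.4182 * (η ^ 9 * s * r ^ 5) + 0.009 * (η ^ 9 * r ^ 9 / s ^ 3) := by
  rw [← Finset.mul_sum]
  have t := tailsum (0.836 * s ^ 4 / r) (by positivity) K
  calc _ ≤ 0.7842 * (η ^ 9 * s ^ 21) * (1 / (0.836 * s ^ 4 / r) ^ 8 + 0.6 * (1 / (0.836 * s ^ 4 / r) ^ 5)) := by gcongr
    _ = 0.7842 / 0.836 ^ 8 * (η ^ 9 * r ^ 8 / s ^ 11) + 0.7842 * 0.6 / 0.836 ^ 5 * (η ^ 9 * s * r ^ 5) := by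
      field_simp; try ring
    _ ≤ 0.009 * (η ^ 9 * r ^ 9 / s ^ 3) + 1.4182 * (η ^ 9 * s * r ^ 5) := by
      gcongr ?_ + ?_ * _
      · have e : η ^ 9 * r ^ 9 / s ^ 3 = (r * s ^ 8) * (η ^ 9 * r ^ 8 / s ^ 11) := by field_simp
        rw [e, ← mul_assoc]
        gcongr
        have : s ^ 9 ≤ r * s ^ 8 := by
          calc s ^ 9 = s * s ^ 8 := by ring
            _ ≤ _ := by gcongr
        norm_num at this ⊢
        linarith
      · norm_num
    _ = _ := by ring

theorem core_s14 (r s η : ℝ) (hr : 0 < r) (hs : 0 < s) (hη : 0 < η) (hMh : 11 * η ^ 9 ≤ 2 * s ^ 9)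
    (h : 7018 ≤ s ^ 9) (hsr : s ≤ r) (hbig : η ^ 36 ≤ 400 * r ^ 9) :
    ((Sset (r ^ 45) (η ^ 9 * r ^ 9) (s ^ 9 * r ^ 9) (1.045 * (s ^ 9 * r ^ 9))).ncard : ℝ) ≤
      0.5298 * r ^ 9 + 0.34 * s ^ 9 + 0.0308 * (η ^ 9 * r ^ 9 / s ^ 3) + 1.2105 * (η ^ 9 * s ^ 21) ∧
    ((Sset (r ^ 45) (η ^ 9 * r ^ 9) (s ^ 9 * r ^ 9) (1.045 * (s ^ 9 * r ^ 9))).ncard : ℝ) ≤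
      0.5298 * r ^ 9 + 0.34 * s ^ 9 + 0.0308 * (η ^ 9 * r ^ 9 / s ^ 3) + 1.4182 * (η ^ 9 * s * r ^ 5) := by
  classical
  have hM : 0 < s ^ 9 * r ^ 9 := by positivity
  set M := s ^ 9 * r ^ 9 with hMdef
  set Q := Sset (r ^ 45) (η ^ 9 * r ^ 9) M (1.045 * M) with hQ
  have hfin : Q.Finite := by
    apply (Set.finite_Icc (⌊M⌋) (⌈1.045 * M⌉)).subset
    intro u hu
    have h1 := hu.2.1
    have h2 := hu.2.2.1
    constructor
    · have := Int.floor_le M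
      have : (⌊M⌋ : ℝ) ≤ u := by linarith
      exact_mod_cast this
    · have := Int.le_ceil (1.045 * M)
      have : (u : ℝ) ≤ ⌈1.045 * M⌉ := by linarith
      exact_mod_cast this
  rw [Set.ncard_eq_toFinset_card Q hfin]
  set S := hfin.toFinset with hS
  have hSm : ∀ u, u ∈ S ↔ u ∈ Q := fun u => hfin.mem_toFinset
  have hgood : ∀ u ∈ S, Good (r ^ 45) (η ^ 9 * r ^ 9) M u := by
    intro u hu
    exact good_of_mem _ _ _ hM u ((hSm u).1 hu)
  have hodd : ∀ u ∈ S, Odd u := fun u hu => ((hSm u).1 hu).1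
  obtain ⟨K, hKd⟩ : ∃ K, K = ⌊(0.492 * s ^ 3) ^ 3⌋₊ := ⟨_, rfl⟩
  have hK : (K : ℝ) ≤ (0.492 * s ^ 3) ^ 3 := by
    rw [hKd]; apply Nat.floor_le; positivity
  have hK2 : (0.492 * s ^ 3) ^ 3 < (K : ℝ) + 1 := by
    rw [hKd]; apply Nat.lt_floor_add_one
  have ub := union_bound S hodd K
  have r9 : s ^ 9 ≤ r ^ 9 := by gcongr
  have tinf : ((S.filter (fun u => ∀ v ∈ S, u < v → 2 * ((K:ℤ) + 1) ≤ v - u)).card : ℝ) ≤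
      1 + 0.189 * r ^ 9 := by
    have := cluster1 (S.filter (fun u => ∀ v ∈ S, u < v → 2 * ((K:ℤ) + 1) ≤ v - u)) (0.045 * M)
      (2 * (0.492 * s ^ 3) ^ 3) (by positivity) (by positivity) ?_ ?_
    · refine this.trans ?_
      have e : 0.045 * M / (2 * (0.492 * s ^ 3) ^ 3) = 0.045 / (2 * 0.492 ^ 3) * r ^ 9 := by
        rw [hMdef]; field_simp
      rw [e]
      gcongr
      norm_num
    · intro u hu v hv _
      rw [Finset.mem_filter] at hu hv
      have a := (hgood u hu.1).1
      have b := (hgood v hv.1).2.1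
      linarith
    · intro u hu v hv huv
      rw [Finset.mem_filter] at hu hv
      have := hu.2 v hv.1 huv
      have : (2 * ((K : ℝ) + 1)) ≤ (v : ℝ) - u := by exact_mod_cast this
      linarith
  have hT : ∀ j : ℕ, IsT (r ^ 45) (η ^ 9 * r ^ 9) M j (S.filter (fun u => u + 2 * (j : ℤ) ∈ S)) := by
    intro j u hu
    rw [Finset.mem_filter] at hu
    refine ⟨hodd u hu.1, hgood u hu.1, ?_⟩
    have := hgood _ hu.2
    exact_mod_cast this
  have cm := common r s η hr hs hη K hK
  constructor
  · have s1 : ∑ j ∈ Finset.Icc 1 K, ((S.filter (fun u => u + 2 * (j : ℤ) ∈ S)).card : ℝ) ≤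
       ∑ j ∈ Finset.Icc 1 K, ((30 / 11 + 1.2916 * (qq j ^ 9 * r ^ 9 / s ^ 36)
      + 0.3714 * (η ^ 9 * r ^ 9 * qq j / s ^ 15)) + 0.7842 * (η ^ 9 * s ^ 21) * (1 / qq j ^ 8)) := by
      apply Finset.sum_le_sum
      intro j hj
      exact T1' r s η hr hs hη hMh j (Finset.mem_Icc.1 hj).1 _ (hT j)
    rw [Finset.sum_add_distrib, ← Finset.mul_sum] at s1
    have f := fullsum K
    have f2 : 0.7842 * (η ^ 9 * s ^ 21) * ∑ j ∈ Finset.Icc 1 K, 1 / qq j ^ 8 ≤ 0.7842 * (η ^ 9 * s ^ 21) * 1.3645 := by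
      gcongr
    have p1 : 0 < η ^ 9 * s ^ 21 := by positivity
    have p2 : 0 < η ^ 9 * r ^ 9 / s ^ 3 := by positivity
    linarith
  · have pj : ∀ j ∈ Finset.Icc 1 K, 0 ≤ 1.2916 * (qq j ^ 9 * r ^ 9 / s ^ 36)
      + 0.3714 * (η ^ 9 * r ^ 9 * qq j / s ^ 15) := by
      intro j _
      have := qq_nonneg j
      positivity
    have tt := tl r s η hr hs hη h hsr K
    have p2 : 0 < η ^ 9 * r ^ 9 / s ^ 3 := by positivity
    rcases minb r s η hr hs hη hbig with hm | hm
    · have s1 : ∑ j ∈ Finset.Icc 1 K, ((S.filter (fun u => u + 2 * (j : ℤ) ∈ S)).card : ℝ) ≤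
       ∑ j ∈ Finset.Icc 1 K, (((30 / 11 + 1.2916 * (qq j ^ 9 * r ^ 9 / s ^ 36)
      + 0.3714 * (η ^ 9 * r ^ 9 * qq j / s ^ 15)) + 0.7842 * (η ^ 9 * s ^ 21) * (if 0.836 * s ^ 4 / r ≤ qq j then 1 / qq j ^ 8 else 0)) +
       (if qq j ≤ 0.87 * η * s ^ 3 / r then 0.1662 * (r ^ 9 / s ^ 6) * qq j else 0)) := by
        apply Finset.sum_le_sum
        intro j hj
        have j1 := (Finset.mem_Icc.1 hj).1
        have := pj j hj
        by_cases hq : 0.836 * s ^ 4 / r ≤ qq j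
        · have t := T1' r s η hr hs hη hMh j j1 _ (hT j)
          rw [if_pos hq]
          have : 0 ≤ (if qq j ≤ 0.87 * η * s ^ 3 / r then 0.1662 * (r ^ 9 / s ^ 6) * qq j else 0) := by
            have := qq_nonneg j
            split_ifs <;> positivity
          linarith
        · have t := (T2' r s η hr hs hη hMh j j1 _ (hT j) (not_le.1 hq).le).1
          rw [if_neg hq]
          linarith
      rw [Finset.sum_add_distrib, Finset.sum_add_distrib] at s1
      have := hd1 r s η hr hs hη K
      linarith
    · have s1 : ∑ j ∈ Finset.Icc 1 K, ((S.filter (fun u => u + 2 * (j : ℤ) ∈ S)).card : ℝ) ≤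
       ∑ j ∈ Finset.Icc 1 K, (((30 / 11 + 1.2916 * (qq j ^ 9 * r ^ 9 / s ^ 36)
      + 0.3714 * (η ^ 9 * r ^ 9 * qq j / s ^ 15)) + 0.7842 * (η ^ 9 * s ^ 21) * (if 0.836 * s ^ 4 / r ≤ qq j then 1 / qq j ^ 8 else 0)) +
       (if qq j ≤ 0.87 * η * s ^ 3 / r then 0.63 * (r ^ 18 / s ^ 27) * qq j ^ 3 else 0)) := by
        apply Finset.sum_le_sum
        intro j hj
        have j1 := (Finset.mem_Icc.1 hj).1
        have := pj j hj
        by_cases hq : 0.836 * s ^ 4 / r ≤ qq j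
        · have t := T1' r s η hr hs hη hMh j j1 _ (hT j)
          rw [if_pos hq]
          have : 0 ≤ (if qq j ≤ 0.87 * η * s ^ 3 / r then 0.63 * (r ^ 18 / s ^ 27) * qq j ^ 3 else 0) := by
            have := qq_nonneg j
            split_ifs <;> positivity
          linarith
        · have t := (T2' r s η hr hs hη hMh j j1 _ (hT j) (not_le.1 hq).le).2
          rw [if_neg hq]
          linarith
      rw [Finset.sum_add_distrib, Finset.sum_add_distrib] at s1
      have := hd2 r s η hr hs hη K
      linarith

lemma logbig (l : ℝ) (hl : 116 ≤ l) : (11 * l) ^ 4 ≤ 400 * Real.exp (l / 5) := by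
  have h1 : l / 116 ≤ Real.exp (l / 116 - 1) := by
    have := Real.add_one_le_exp (l / 116 - 1)
    linarith
  have h2 : (l / 116) ^ 4 ≤ Real.exp ((l - 116) / 5) := by
    calc (l / 116) ^ 4 ≤ (Real.exp (l / 116 - 1)) ^ 4 := by gcongr
      _ = Real.exp (4 * (l / 116 - 1)) := by rw [← Real.exp_nat_mul]; norm_num
      _ ≤ Real.exp ((l - 116) / 5) := by apply Real.exp_le_exp.mpr; linarith
  have h3 : (2.7182 : ℝ) ^ 23 ≤ Real.exp 23 := by
    have e : Real.exp 23 = Real.exp 1 ^ 23 := by rw [← Real.exp_nat_mul]; norm_num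
    rw [e]
    have := Real.exp_one_gt_d9
    gcongr
    linarith
  have h4 : Real.exp (l / 5) = Real.exp 0.2 * Real.exp 23 * Real.exp ((l - 116) / 5) := by
    rw [← Real.exp_add, ← Real.exp_add]; congr 1; ring
  have h5 : 1 ≤ Real.exp 0.2 := by apply Real.one_le_exp; norm_num
  rw [h4]
  calc (11 * l) ^ 4 = (11 * 116) ^ 4 * (l / 116) ^ 4 := by ring
    _ ≤ (11 * 116) ^ 4 * Real.exp ((l - 116) / 5) := by gcongr
    _ ≤ (400 * (1 * 2.7182 ^ 23)) * Real.exp ((l - 116) / 5) := by gcongr; norm_num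
    _ ≤ (400 * (Real.exp 0.2 * Real.exp 23)) * Real.exp ((l - 116) / 5) := by gcongr
    _ = _ := by ring

lemma rpow_of_pow (y a : ℝ) (n : ℕ) (k : ℕ) (c : ℝ) (ha : 0 ≤ a) (hy : y = a ^ n) (hc : n * c = k) :
    y ^ c = a ^ k := by
  rw [hy, ← Real.rpow_natCast a n, ← Real.rpow_mul ha, hc, Real.rpow_natCast]

lemma rpow_of_pow_neg (y a : ℝ) (n : ℕ) (k : ℕ) (c : ℝ) (ha : 0 ≤ a) (hy : y = a ^ n) (hc : n * c = -k) :
    y ^ c = 1 / a ^ k := by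
  rw [hy, ← Real.rpow_natCast a n, ← Real.rpow_mul ha, hc, Real.rpow_neg ha, Real.rpow_natCast, one_div]

open Classical in
/-- Proposition 1: the main bound on `|S(M)|`. -/
theorem card_Sset_main (x M : ℝ) (hx : Real.exp 116 ≤ x)
    (hM1 : 5.5 * (11 * x ^ ((1 : ℝ) / 5) * Real.log x) ≤ M) (hM2 : M ≤ x ^ ((2 : ℝ) / 5)) :
    ((Sset x (11 * x ^ ((1 : ℝ) / 5) * Real.log x) M (1.045 * M)).ncard : ℝ) ≤
      (11 * x ^ ((1 : ℝ) / 5) * Real.log x) *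
        (((0.5298 * x ^ ((1 : ℝ) / 5) + 0.3400 * x ^ (-(1 : ℝ) / 5) * M) /
            (11 * x ^ ((1 : ℝ) / 5) * Real.log x) +
          0.0308 * x ^ ((1 : ℝ) / 15) * M ^ (-(1 : ℝ) / 3)) +
        (if M ≤ 5 * x ^ ((1 : ℝ) / 4) then 1.2105 * x ^ (-(2 : ℝ) / 3) * M ^ ((7 : ℝ) / 3)
          else 1.4182 * x ^ (-(1 : ℝ) / 9) * M ^ ((1 : ℝ) / 9))) := by
  have hx0 : 0 < x := (Real.exp_pos _).trans_le hx
  have hl : 116 ≤ Real.log x := by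
    rw [Real.le_log_iff_exp_le hx0]; exact hx
  have hR : x ^ ((1 : ℝ) / 5) = Real.exp (Real.log x / 5) := by
    rw [Real.rpow_def_of_pos hx0]; congr 1; ring
  obtain ⟨r, hrd⟩ : ∃ r, r = x ^ ((1 : ℝ) / 45) := ⟨_, rfl⟩
  have hr : 0 < r := by rw [hrd]; positivity
  have xr : x = r ^ 45 := by
    rw [hrd, ← Real.rpow_natCast, ← Real.rpow_mul hx0.le]; norm_num
  have x5 : x ^ ((1 : ℝ) / 5) = r ^ 9 := rpow_of_pow x r 45 9 _ hr.le xr (by norm_num)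
  have x25 : x ^ ((2 : ℝ) / 5) = r ^ 18 := rpow_of_pow x r 45 18 _ hr.le xr (by norm_num)
  have xm5 : x ^ (-(1 : ℝ) / 5) = 1 / r ^ 9 := rpow_of_pow_neg x r 45 9 _ hr.le xr (by norm_num)
  have x15 : x ^ ((1 : ℝ) / 15) = r ^ 3 := rpow_of_pow x r 45 3 _ hr.le xr (by norm_num)
  have xm23 : x ^ (-(2 : ℝ) / 3) = 1 / r ^ 30 := rpow_of_pow_neg x r 45 30 _ hr.le xr (by norm_num)
  have xm9 : x ^ (-(1 : ℝ) / 9) = 1 / r ^ 5 := rpow_of_pow_neg x r 45 5 _ hr.le xr (by norm_num)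
  have hbig0 := logbig _ hl
  rw [← hR, x5] at hbig0
  rw [x5] at hM1
  rw [x25] at hM2
  rw [x5, xm5, x15, xm23, xm9]
  have r9 : 0 < r ^ 9 := by positivity
  have hM0 : 0 < M := by
    refine lt_of_lt_of_le ?_ hM1
    positivity
  obtain ⟨s, hsd⟩ : ∃ s, s = (M / r ^ 9) ^ ((1 : ℝ) / 9) := ⟨_, rfl⟩
  obtain ⟨η, hηd⟩ : ∃ η, η = (11 * Real.log x) ^ ((1 : ℝ) / 9) := ⟨_, rfl⟩
  have hs : 0 < s := by rw [hsd]; positivity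
  have hη : 0 < η := by
    rw [hηd]; apply Real.rpow_pos_of_pos; linarith
  have s9 : s ^ 9 = M / r ^ 9 := by
    rw [hsd, ← Real.rpow_natCast, ← Real.rpow_mul (by positivity)]; norm_num
  have η9 : η ^ 9 = 11 * Real.log x := by
    rw [hηd, ← Real.rpow_natCast, ← Real.rpow_mul (by linarith)]; norm_num
  have Ms : M = s ^ 9 * r ^ 9 := by rw [s9]; field_simp
  have Ms' : M = (s * r) ^ 9 := by rw [Ms]; ring
  have M3 : M ^ (-(1 : ℝ) / 3) = 1 / (s * r) ^ 3 := rpow_of_pow_neg M (s * r) 9 3 _ (by positivity) Ms' (by norm_num)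
  have M73 : M ^ ((7 : ℝ) / 3) = (s * r) ^ 21 := rpow_of_pow M (s * r) 9 21 _ (by positivity) Ms' (by norm_num)
  have M9 : M ^ ((1 : ℝ) / 9) = (s * r) ^ 1 := rpow_of_pow M (s * r) 9 1 _ (by positivity) Ms' (by norm_num)
  have hh : 11 * r ^ 9 * Real.log x = η ^ 9 * r ^ 9 := by rw [η9]; ring
  rw [M3, M73, M9, hh]
  rw [hh] at hM1
  have k1 : 11 * η ^ 9 ≤ 2 * s ^ 9 := by
    rw [Ms] at hM1
    have : 5.5 * η ^ 9 ≤ s ^ 9 := le_of_mul_le_mul_right (by linarith : 5.5 * η ^ 9 * r ^ 9 ≤ s ^ 9 * r ^ 9) r9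
    linarith
  have k2 : 7018 ≤ s ^ 9 := by linarith
  have k3 : s ≤ r := by
    apply le_of_pow_le_pow_left₀ (n := 9) (by norm_num) hr.le
    rw [Ms] at hM2
    exact le_of_mul_le_mul_right (by linarith [show r ^ 9 * r ^ 9 = r ^ 18 by ring] : s ^ 9 * r ^ 9 ≤ r ^ 9 * r ^ 9) r9
  have k4 : η ^ 36 ≤ 400 * r ^ 9 := by
    rw [← η9] at hbig0
    linarith [show (η ^ 9) ^ 4 = η ^ 36 by ring]
  have C := core_s14 r s η hr hs hη k1 k2 k3 k4
  rw [← xr, ← Ms] at C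
  have base : ∀ t : ℝ, η ^ 9 * r ^ 9 * ((0.5298 * r ^ 9 + 0.3400 * (1 / r ^ 9) * M) / (η ^ 9 * r ^ 9) + 0.0308 * r ^ 3 * (1 / (s * r) ^ 3) + t)
     = 0.5298 * r ^ 9 + 0.34 * s ^ 9 + 0.0308 * (η ^ 9 * r ^ 9 / s ^ 3) + η ^ 9 * r ^ 9 * t := by
    intro t
    rw [Ms]; field_simp; ring
  rw [base]
  split_ifs
  · refine C.1.trans (le_of_eq ?_)
    congr 1
    field_simp
  · refine C.2.trans (le_of_eq ?_)
    congr 1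
    field_simp
end

section
/- Let x ≥ e^{116}, set h = 11·x^{1/5}·log x and λ = 1.045, and suppose 5.5·h ≤ M ≤ x^{2/5}. Let a be an integer with A ≤ a ≤ B, where A = 1.3860·x^{-1/3}·M^{4/3} and B = 0.17·x^{-1/5}·M. Then |T(M; a)| < 0.4346·a^{1/3}·h·x^{1/3}·M^{-5/3} + 0.2904·a³·x·M^{-4} + 2.9918·a^{-8/3}·h·x^{-2/3}·M^{7/3} + 2. -/
/-- `S1set x h lam M` is the subset `S₁(M)` of `S(M) = S(M, λM)` consisting of the
elements of even index when `S(M)` is listed in increasing order; equivalently, the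
elements `u ∈ S(M)` preceded by an even number of elements of `S(M)`. -/
def S1set (x h lam M : ℝ) : Set ℤ :=
  {u ∈ Sset x h M (lam * M) | Even ({v ∈ Sset x h M (lam * M) | v < u}.ncard)}

/-- `Tset x h lam M a` is the set `T(M; a)` of `u` such that `u` and `u + a` are
consecutive elements of `S₁(M)`. -/
def Tset (x h lam M : ℝ) (a : ℤ) : Set ℤ :=
  {u : ℤ | u ∈ S1set x h lam M ∧ u + a ∈ S1set x h lam M ∧
    ∀ v ∈ S1set x h lam M, ¬(u < v ∧ v < u + a)}


lemma aux_card_triples (A : Finset ℤ) (s D : ℝ) (hs : 0 < s) (hD : 0 ≤ D)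
    (hd : ∀ u ∈ A, ∀ v ∈ A, (v : ℝ) - u ≤ D)
    (ht : ∀ u ∈ A, ∀ v ∈ A, ∀ w ∈ A, u < v → v < w → s ≤ (w : ℝ) - u) :
    (A.card : ℝ) ≤ 2 + 2 * (D / s) := by
  rcases A.eq_empty_or_nonempty with rfl | hne
  · simp; positivity
  set m := A.min' hne with hm
  have hmA : m ∈ A := A.min'_mem hne
  set φ : ℤ → ℤ := fun u => ⌊((u : ℝ) - m) / s⌋ with hφ
  have h1 : A.card ≤ 2 * (A.image φ).card := by
    apply Finset.card_le_mul_card_image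
    intro j _
    by_contra hcon
    push Not at hcon
    obtain ⟨p, q, r, hp, hq, hr, hpq, hpr, hqr⟩ := Finset.two_lt_card_iff.1 hcon
    simp only [Finset.mem_filter] at hp hq hr
    have key : ∀ u v : ℤ, φ u = j → φ v = j → (v : ℝ) - u < s := by
      intro u v hu hv
      have a1 := Int.lt_floor_add_one (((v : ℝ) - m) / s)
      have a2 := Int.floor_le (((u : ℝ) - m) / s)
      simp only [hφ] at hu hv
      rw [hv] at a1; rw [hu] at a2
      rw [div_lt_iff₀ hs] at a1
      rw [le_div_iff₀ hs] at a2
      nlinarith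
    have key2 : ∀ u v w : ℤ, (u ∈ A ∧ φ u = j) → (v ∈ A ∧ φ v = j) → (w ∈ A ∧ φ w = j) →
        u < v → v < w → False := by
      intro u v w hu hv hw h1 h2
      have := ht u hu.1 v hv.1 w hw.1 h1 h2
      have := key u w hu.2 hw.2
      linarith
    rcases lt_or_gt_of_ne hpq with h1 | h1 <;> rcases lt_or_gt_of_ne hpr with h2 | h2 <;>
      rcases lt_or_gt_of_ne hqr with h3 | h3
    · exact key2 p q r hp hq hr h1 h3
    · exact key2 p r q hp hr hq h2 h3
    · omega
    · exact key2 r p q hr hp hq h2 h1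
    · exact key2 q p r hq hp hr h1 h2
    · omega
    · exact key2 q r p hq hr hp h3 h2
    · exact key2 r q p hr hq hp h3 h1
  have h2 : A.image φ ⊆ Finset.Icc 0 ⌊D / s⌋ := by
    intro j hj
    obtain ⟨u, hu, rfl⟩ := Finset.mem_image.1 hj
    have hmu : (m : ℝ) ≤ u := by exact_mod_cast A.min'_le u hu
    rw [Finset.mem_Icc]
    constructor
    · apply Int.floor_nonneg.2
      apply div_nonneg (by linarith) hs.le
    · apply Int.floor_le_floor
      apply div_le_div_of_nonneg_right (hd m hmA u hu) hs.le
  have h3 := Finset.card_le_card h2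
  rw [Int.card_Icc] at h3
  have h4 : (0:ℤ) ≤ ⌊D / s⌋ := Int.floor_nonneg.2 (div_nonneg hD hs.le)
  have h5 : ((⌊D / s⌋ + 1 - 0).toNat : ℝ) ≤ D / s + 1 := by
    have e : (((⌊D / s⌋ + 1 - 0).toNat : ℤ) : ℝ) = ((⌊D / s⌋ + 1 : ℤ) : ℝ) := by
      congr 1; omega
    have := Int.floor_le (D / s)
    push_cast at e
    rw [e]; linarith
  have h6 : ((A.image φ).card : ℝ) ≤ D / s + 1 := le_trans (by exact_mod_cast h3) h5
  have h7 : (A.card : ℝ) ≤ 2 * ((A.image φ).card : ℝ) := by exact_mod_cast h1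
  linarith

lemma aux_card_intervals (A : Finset ℤ) (M l y R : ℝ) (hl : 0 < l) (hy : 0 ≤ y) (hR : 0 < R)
    (hA : ∀ u ∈ A, M < (u : ℝ) ∧ (u : ℝ) ≤ M + y * l)
    (hI : ∀ B ⊆ A, (∀ u ∈ B, ∀ v ∈ B, (v : ℝ) - u < l) → (B.card : ℝ) ≤ R) :
    (A.card : ℝ) < (y + 1) * R := by
  set φ : ℤ → ℤ := fun u => ⌈((u : ℝ) - M) / l⌉ with hφ
  have h1 : A.card ≤ ⌊R⌋₊ * (A.image φ).card := by
    apply Finset.card_le_mul_card_image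
    intro j _
    apply Nat.le_floor
    apply hI _ (Finset.filter_subset _ _)
    intro u hu v hv
    simp only [Finset.mem_filter] at hu hv
    have a1 := Int.ceil_lt_add_one (((u : ℝ) - M) / l)
    have a2 := Int.le_ceil (((v : ℝ) - M) / l)
    have hu2 := hu.2
    have hv2 := hv.2
    simp only [hφ] at hu2 hv2
    rw [hu2] at a1; rw [hv2] at a2
    rw [← sub_lt_iff_lt_add, lt_div_iff₀ hl] at a1
    rw [div_le_iff₀ hl] at a2
    nlinarith
  have h2 : A.image φ ⊆ Finset.Icc 1 ⌈y⌉ := by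
    intro j hj
    obtain ⟨u, hu, rfl⟩ := Finset.mem_image.1 hj
    obtain ⟨b1, b2⟩ := hA u hu
    rw [Finset.mem_Icc]
    constructor
    · have : 0 < ⌈((u : ℝ) - M) / l⌉ := Int.ceil_pos.2 (div_pos (by linarith) hl)
      exact this
    · apply Int.ceil_le_ceil
      rw [div_le_iff₀ hl]; linarith
  have h3 := Finset.card_le_card h2
  rw [Int.card_Icc] at h3
  have h4 : (0:ℤ) ≤ ⌈y⌉ := Int.ceil_nonneg hy
  have h5 : ((⌈y⌉ + 1 - 1).toNat : ℝ) < y + 1 := by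
    have e : (((⌈y⌉ + 1 - 1).toNat : ℤ) : ℝ) = ((⌈y⌉ : ℤ) : ℝ) := by
      congr 1; omega
    have := Int.ceil_lt_add_one y
    push_cast at e
    rw [e]; linarith
  have h6 : ((A.image φ).card : ℝ) < y + 1 := lt_of_le_of_lt (by exact_mod_cast h3) h5
  have h7 : (A.card : ℝ) ≤ (⌊R⌋₊ : ℝ) * ((A.image φ).card : ℝ) := by exact_mod_cast h1
  have h8 := Nat.floor_le hR.le
  have h9 : (0:ℝ) ≤ ((A.image φ).card : ℝ) := by positivity
  nlinarith

/-- Bounds on products of five reciprocals. -/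
lemma aux_prod5 (M W p q r s t : ℝ) (hM : 0 < M) (hp : M ≤ p ∧ p ≤ W) (hq : M ≤ q ∧ q ≤ W)
    (hr : M ≤ r ∧ r ≤ W) (hs : M ≤ s ∧ s ≤ W) (ht : M ≤ t ∧ t ≤ W) :
    1 / W ^ 5 ≤ 1 / (p * q * r * s * t) ∧ 1 / (p * q * r * s * t) ≤ 1 / M ^ 5 := by
  obtain ⟨p1, p2⟩ := hp
  obtain ⟨q1, q2⟩ := hq
  obtain ⟨r1, r2⟩ := hr
  obtain ⟨s1, s2⟩ := hs
  obtain ⟨t1, t2⟩ := ht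
  have hp : 0 < p := by linarith
  have hq : 0 < q := by linarith
  have hr : 0 < r := by linarith
  have hs : 0 < s := by linarith
  have ht : 0 < t := by linarith
  have hW : 0 < W := by linarith
  constructor
  · apply one_div_le_one_div_of_le (by positivity)
    calc p * q * r * s * t ≤ W * W * W * W * W := by gcongr
      _ = W ^ 5 := by ring
  · apply one_div_le_one_div_of_le (by positivity)
    calc M ^ 5 = M * M * M * M * M := by ring
      _ ≤ p * q * r * s * t := by gcongr

lemma aux_g (M W u v a : ℝ) (hM : 0 < M) (ha : 0 ≤ a) (hu : M ≤ u) (huv : u ≤ v)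
    (hv : v + a ≤ W) :
    4 * (v - u) / W ^ 5 ≤ 1 / (u ^ 2 * (u + a) ^ 2) - 1 / (v ^ 2 * (v + a) ^ 2) ∧
    1 / (u ^ 2 * (u + a) ^ 2) - 1 / (v ^ 2 * (v + a) ^ 2) ≤ 4 * (v - u) / M ^ 5 := by
  have Hu : M ≤ u ∧ u ≤ W := ⟨by linarith, by linarith⟩
  have Hv : M ≤ v ∧ v ≤ W := ⟨by linarith, by linarith⟩
  have Hua : M ≤ u + a ∧ u + a ≤ W := ⟨by linarith, by linarith⟩
  have Hva : M ≤ v + a ∧ v + a ≤ W := ⟨by linarith, by linarith⟩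
  have u0 : 0 < u := by linarith
  have v0 : 0 < v := by linarith
  have ua0 : 0 < u + a := by linarith
  have va0 : 0 < v + a := by linarith
  have e : 1 / (u ^ 2 * (u + a) ^ 2) - 1 / (v ^ 2 * (v + a) ^ 2) =
    (v - u) * (1 / (u * v * (v + a) * v * (v + a)) + 1 / (u * (u + a) * v * (v + a) * (v + a))
      + 1 / (u * u * (u + a) * v * (v + a)) + 1 / (u * (u + a) * u * (u + a) * (v + a))) := by
    field_simp
    ring
  have A1 := aux_prod5 M W _ _ _ _ _ hM Hu Hv Hva Hv Hva
  have A2 := aux_prod5 M W _ _ _ _ _ hM Hu Hua Hv Hva Hva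
  have A3 := aux_prod5 M W _ _ _ _ _ hM Hu Hu Hua Hv Hva
  have A4 := aux_prod5 M W _ _ _ _ _ hM Hu Hua Hu Hua Hva
  have h0 : 0 ≤ v - u := by linarith
  rw [e]
  constructor
  · rw [show 4 * (v - u) / W ^ 5 = (v - u) * (4 * (1 / W ^ 5)) by ring]
    apply mul_le_mul_of_nonneg_left _ h0
    linarith [A1.1, A2.1, A3.1, A4.1]
  · rw [show 4 * (v - u) / M ^ 5 = (v - u) * (4 * (1 / M ^ 5)) by ring]
    apply mul_le_mul_of_nonneg_left _ h0
    linarith [A1.2, A2.2, A3.2, A4.2]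

lemma aux_shift4 (M W p q r s a : ℝ) (hM : 0 < M) (ha : 0 ≤ a) (hp : M ≤ p ∧ p + a ≤ W)
    (hq : M ≤ q ∧ q + a ≤ W) (hr : M ≤ r ∧ r + a ≤ W) (hs : M ≤ s ∧ s + a ≤ W) :
    4 * a / W ^ 5 ≤ 1 / (p * q * r * s) - 1 / ((p + a) * (q + a) * (r + a) * (s + a)) ∧
    1 / (p * q * r * s) - 1 / ((p + a) * (q + a) * (r + a) * (s + a)) ≤ 4 * a / M ^ 5 := by
  have Hp : M ≤ p ∧ p ≤ W := ⟨by linarith, by linarith⟩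
  have Hq : M ≤ q ∧ q ≤ W := ⟨by linarith, by linarith⟩
  have Hr : M ≤ r ∧ r ≤ W := ⟨by linarith, by linarith⟩
  have Hs : M ≤ s ∧ s ≤ W := ⟨by linarith, by linarith⟩
  have Kp : M ≤ p + a ∧ p + a ≤ W := ⟨by linarith, by linarith⟩
  have Kq : M ≤ q + a ∧ q + a ≤ W := ⟨by linarith, by linarith⟩
  have Kr : M ≤ r + a ∧ r + a ≤ W := ⟨by linarith, by linarith⟩
  have Ks : M ≤ s + a ∧ s + a ≤ W := ⟨by linarith, by linarith⟩
  have p0 : 0 < p := by linarith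
  have q0 : 0 < q := by linarith
  have r0 : 0 < r := by linarith
  have s0 : 0 < s := by linarith
  have pa : 0 < p + a := by linarith
  have qa : 0 < q + a := by linarith
  have ra : 0 < r + a := by linarith
  have sa : 0 < s + a := by linarith
  have e : 1 / (p * q * r * s) - 1 / ((p + a) * (q + a) * (r + a) * (s + a)) =
    a * (1 / (p * (p + a) * q * r * s) + 1 / ((p + a) * q * (q + a) * r * s)
      + 1 / ((p + a) * (q + a) * r * (r + a) * s)
      + 1 / ((p + a) * (q + a) * (r + a) * s * (s + a))) := by
    field_simp
    ring
  have A1 := aux_prod5 M W _ _ _ _ _ hM Hp Kp Hq Hr Hs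
  have A2 := aux_prod5 M W _ _ _ _ _ hM Kp Hq Kq Hr Hs
  have A3 := aux_prod5 M W _ _ _ _ _ hM Kp Kq Hr Kr Hs
  have A4 := aux_prod5 M W _ _ _ _ _ hM Kp Kq Kr Hs Ks
  rw [e]
  constructor
  · rw [show 4 * a / W ^ 5 = a * (4 * (1 / W ^ 5)) by ring]
    apply mul_le_mul_of_nonneg_left _ ha
    linarith [A1.1, A2.1, A3.1, A4.1]
  · rw [show 4 * a / M ^ 5 = a * (4 * (1 / M ^ 5)) by ring]
    apply mul_le_mul_of_nonneg_left _ ha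
    linarith [A1.2, A2.2, A3.2, A4.2]

lemma aux_dd (u v w : ℝ) (hu : 0 < u) (hv : 0 < v) (hw : 0 < w) :
    (w - v) * (1 / u ^ 2) - (w - u) * (1 / v ^ 2) + (v - u) * (1 / w ^ 2) =
    (v - u) * (w - v) * (w - u) *
      (1 / (u * u * v * w) + 1 / (u * v * v * w) + 1 / (u * v * w * w)) := by
  field_simp
  ring

lemma aux_G (M W u v w a : ℝ) (hM : 0 < M) (ha : 0 ≤ a) (hu : M ≤ u) (huv : u ≤ v)
    (hvw : v ≤ w) (hw : w + a ≤ W) :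
    (v - u) * (w - v) * (w - u) * (12 * a / W ^ 5) ≤
      (w - v) * (1 / u ^ 2 - 1 / (u + a) ^ 2) - (w - u) * (1 / v ^ 2 - 1 / (v + a) ^ 2)
        + (v - u) * (1 / w ^ 2 - 1 / (w + a) ^ 2) ∧
    (w - v) * (1 / u ^ 2 - 1 / (u + a) ^ 2) - (w - u) * (1 / v ^ 2 - 1 / (v + a) ^ 2)
        + (v - u) * (1 / w ^ 2 - 1 / (w + a) ^ 2) ≤
      (v - u) * (w - v) * (w - u) * (12 * a / M ^ 5) := by
  have B1 := aux_dd u v w (by linarith) (by linarith) (by linarith)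
  have B2 := aux_dd (u + a) (v + a) (w + a) (by linarith) (by linarith) (by linarith)
  have Hu : M ≤ u ∧ u + a ≤ W := ⟨by linarith, by linarith⟩
  have Hv : M ≤ v ∧ v + a ≤ W := ⟨by linarith, by linarith⟩
  have Hw : M ≤ w ∧ w + a ≤ W := ⟨by linarith, by linarith⟩
  have A1 := aux_shift4 M W _ _ _ _ a hM ha Hu Hu Hv Hw
  have A2 := aux_shift4 M W _ _ _ _ a hM ha Hu Hv Hv Hw
  have A3 := aux_shift4 M W _ _ _ _ a hM ha Hu Hv Hw Hw
  have h0 : 0 ≤ (v - u) * (w - v) * (w - u) :=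
    mul_nonneg (mul_nonneg (by linarith) (by linarith)) (by linarith)
  rw [show (w + a) - (v + a) = w - v by ring, show (w + a) - (u + a) = w - u by ring,
    show (v + a) - (u + a) = v - u by ring] at B2
  have e : (w - v) * (1 / u ^ 2 - 1 / (u + a) ^ 2) - (w - u) * (1 / v ^ 2 - 1 / (v + a) ^ 2)
        + (v - u) * (1 / w ^ 2 - 1 / (w + a) ^ 2) = (v - u) * (w - v) * (w - u) *
      ((1 / (u * u * v * w) + 1 / (u * v * v * w) + 1 / (u * v * w * w)) -
      (1 / ((u + a) * (u + a) * (v + a) * (w + a)) + 1 / ((u + a) * (v + a) * (v + a) * (w + a))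
        + 1 / ((u + a) * (v + a) * (w + a) * (w + a)))) := by
    linear_combination B1 - B2
  rw [e]
  constructor
  · apply mul_le_mul_of_nonneg_left _ h0
    have : 12 * a / W ^ 5 = 3 * (4 * a / W ^ 5) := by ring
    linarith [A1.1, A2.1, A3.1]
  · apply mul_le_mul_of_nonneg_left _ h0
    have : 12 * a / M ^ 5 = 3 * (4 * a / M ^ 5) := by ring
    linarith [A1.2, A2.2, A3.2]

/-- `u` is close to a divisor-square: `x < m u² ≤ x + h` in divided form. -/
def auxNear (x h : ℝ) (u m : ℤ) : Prop :=
  0 < (m : ℝ) - x / (u : ℝ) ^ 2 ∧ (m : ℝ) - x / (u : ℝ) ^ 2 ≤ h / (u : ℝ) ^ 2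

lemma aux_mem {x h M N : ℝ} {u : ℤ} (hu : u ∈ Sset x h M N) :
    Odd u ∧ M < (u : ℝ) ∧ (u : ℝ) ≤ N ∧ ∃ m : ℤ, auxNear x h u m := by
  obtain ⟨h1, h2, h3, h4, h5⟩ := hu
  refine ⟨h1, h2, h3, ⌊x / (u : ℝ) ^ 2⌋ + 1, ?_, ?_⟩
  · rw [Int.fract] at h5; push_cast; linarith
  · rw [Int.fract] at h4; push_cast; linarith

lemma aux_N {x h M : ℝ} {u α m n : ℤ} (hM : 0 < M) (hh : 0 < h) (hα : 0 < α) (hu : M < (u : ℝ))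
    (hαu : (α : ℝ) < u) (hm : auxNear x h u m) (hn : auxNear x h (u + 2 * α) n) :
    |((m * (u - α) - n * (u + 3 * α) : ℤ) : ℝ) +
      x * (2 * α : ℝ) ^ 3 / 2 * (1 / ((u : ℝ) ^ 2 * ((u : ℝ) + 2 * α) ^ 2))| < h / M := by
  obtain ⟨m1, m2⟩ := hm
  obtain ⟨n1, n2⟩ := hn
  push_cast at *
  have hα' : (0:ℝ) < α := by exact_mod_cast hα
  generalize (u : ℝ) = u at *
  generalize (α : ℝ) = α at *
  have u0 : 0 < u := by linarith
  have ua0 : 0 < u + 2 * α := by linarith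
  set t := (m : ℝ) - x / u ^ 2 with ht
  set t' := (n : ℝ) - x / (u + 2 * α) ^ 2 with ht'
  have e : (m : ℝ) * (u - α) - n * (u + 3 * α) +
      x * (2 * α) ^ 3 / 2 * (1 / (u ^ 2 * (u + 2 * α) ^ 2)) =
      t * (u - α) - t' * (u + 3 * α) := by
    rw [ht, ht']; field_simp; ring
  rw [e]
  have huM : h / u < h / M := div_lt_div_of_pos_left hh hM hu
  have b1 : 0 < t * (u - α) := mul_pos m1 (by linarith)
  have b2 : t * (u - α) ≤ h / u := by
    calc t * (u - α) ≤ h / u ^ 2 * u := by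
          apply mul_le_mul m2 (by linarith) (by linarith) (by positivity)
      _ = h / u := by field_simp
  have b3 : 0 < t' * (u + 3 * α) := mul_pos n1 (by linarith)
  have b4 : t' * (u + 3 * α) ≤ h / u := by
    calc t' * (u + 3 * α) ≤ h / (u + 2 * α) ^ 2 * (u + 3 * α) := by
          apply mul_le_mul_of_nonneg_right n2 (by linarith)
      _ ≤ h / u := by
          rw [div_mul_eq_mul_div, div_le_div_iff₀ (by positivity) u0]
          nlinarith [mul_pos hh hα', mul_pos (mul_pos hh hα') u0, mul_pos (mul_pos hh hα') hα']
  rw [abs_lt]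
  constructor <;> linarith

lemma aux_diam {x h M X : ℝ} {u v α m n m' n' : ℤ} (hM : 0 < M) (hx : 0 < x) (hh : 0 < h)
    (hα : 0 < α) (hX : 0 < X) (hXe : (2 * α : ℝ) ^ 3 * x = X * M ^ 4) (hhM : 5.5 * h ≤ M)
    (hu : M < (u : ℝ)) (huv : u ≤ v) (hv : (v : ℝ) + 2 * α ≤ 1.045 * M)
    (hm : auxNear x h u m) (hn : auxNear x h (u + 2 * α) n)
    (hm' : auxNear x h v m') (hn' : auxNear x h (v + 2 * α) n')
    (hl : (v : ℝ) - u < 0.045 * M / (0.1452 * X)) :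
    (v : ℝ) - u ≤ 1.24619 * h / X := by
  have huv' : (u : ℝ) ≤ v := by exact_mod_cast huv
  have hα' : (0:ℝ) < α := by exact_mod_cast hα
  have C1 := aux_N hM hh hα hu (by linarith) hm hn
  have C2 := aux_N hM hh hα (lt_of_lt_of_le hu huv') (by linarith) hm' hn'
  set p : ℤ := m * (u - α) - n * (u + 3 * α)
  set q : ℤ := m' * (v - α) - n' * (v + 3 * α)
  obtain ⟨g1, g2⟩ := aux_g M (1.045 * M) u v (2 * α) hM (by linarith) hu.le huv' hv
  set gu := 1 / ((u : ℝ) ^ 2 * ((u : ℝ) + 2 * α) ^ 2)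
  set gv := 1 / ((v : ℝ) ^ 2 * ((v : ℝ) + 2 * α) ^ 2)
  have hc : x * (2 * α : ℝ) ^ 3 / 2 = X * M ^ 4 / 2 := by rw [← hXe]; ring
  rw [hc] at C1 C2
  have hXM : 0 < X * M ^ 4 / 2 := by positivity
  have g2' : X * M ^ 4 / 2 * (gu - gv) < 0.62 := by
    calc X * M ^ 4 / 2 * (gu - gv) ≤ X * M ^ 4 / 2 * (4 * (v - u) / M ^ 5) :=
          mul_le_mul_of_nonneg_left g2 hXM.le
      _ = 2 * X / M * (v - u) := by field_simp; norm_num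
      _ < 2 * X / M * (0.045 * M / (0.1452 * X)) := by
          apply mul_lt_mul_of_pos_left hl; positivity
      _ = 2 * 0.045 / 0.1452 := by field_simp
      _ < 0.62 := by norm_num
  have g1' : 2 * X / M * (v - u) / 1.045 ^ 5 ≤ X * M ^ 4 / 2 * (gu - gv) := by
    calc 2 * X / M * (v - u) / 1.045 ^ 5 = X * M ^ 4 / 2 * (4 * (v - u) / (1.045 * M) ^ 5) := by
          field_simp; norm_num; ring
      _ ≤ _ := mul_le_mul_of_nonneg_left g1 hXM.le
  have hhM' : h / M ≤ 1 / 5.5 := by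
    rw [div_le_div_iff₀ hM (by norm_num)]; linarith
  have h0 : 0 ≤ 2 * X / M * (v - u) / 1.045 ^ 5 := by
    have : (0:ℝ) ≤ v - u := by linarith
    positivity
  rw [abs_lt] at C1 C2
  have hpq : p = q := by
    have k1 : ((q - p : ℤ) : ℝ) < 1 := by push_cast; linarith [C1.1, C2.2]
    have k2 : (-1 : ℝ) < ((q - p : ℤ) : ℝ) := by push_cast; linarith [C1.2, C2.1]
    have k1' : q - p < 1 := by exact_mod_cast k1
    have k2' : -1 < q - p := by exact_mod_cast k2
    omega
  rw [hpq] at C1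
  have hf : 2 * X / M * (v - u) / 1.045 ^ 5 < 2 * (h / M) := by linarith [C1.2, C2.1]
  rw [le_div_iff₀ hX]
  have hf2 : 2 * X / M * (v - u) / 1.045 ^ 5 * (M * 1.045 ^ 5 / 2) <
      2 * (h / M) * (M * 1.045 ^ 5 / 2) := mul_lt_mul_of_pos_right hf (by positivity)
  have e1 : 2 * X / M * (v - u) / 1.045 ^ 5 * (M * 1.045 ^ 5 / 2) = (v - u) * X := by
    field_simp
  have e2 : 2 * (h / M) * (M * 1.045 ^ 5 / 2) = 1.045 ^ 5 * h := by field_simp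
  rw [e1, e2] at hf2
  have : (1.045:ℝ) ^ 5 * h ≤ 1.24619 * h := by
    apply mul_le_mul_of_nonneg_right _ hh.le; norm_num
  linarith

lemma aux_F {x h M : ℝ} {u α m n : ℤ} (hM : 0 < M) (hh : 0 < h) (hα : 0 < α) (hu : M < (u : ℝ))
    (hm : auxNear x h u m) (hn : auxNear x h (u + 2 * α) n) :
    |((m : ℝ) - n) - x * (1 / (u : ℝ) ^ 2 - 1 / ((u : ℝ) + 2 * α) ^ 2)| < h / M ^ 2 := by
  obtain ⟨m1, m2⟩ := hm
  obtain ⟨n1, n2⟩ := hn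
  push_cast at *
  have hα' : (0:ℝ) < α := by exact_mod_cast hα
  have a1 : h / (u : ℝ) ^ 2 < h / M ^ 2 := by
    apply div_lt_div_of_pos_left hh (by positivity); gcongr
  have a2 : h / ((u : ℝ) + 2 * α) ^ 2 < h / M ^ 2 := by
    apply div_lt_div_of_pos_left hh (by positivity); gcongr; linarith
  have e : ((m : ℝ) - n) - x * (1 / (u : ℝ) ^ 2 - 1 / ((u : ℝ) + 2 * α) ^ 2) =
    (m - x / (u : ℝ) ^ 2) - (n - x / ((u : ℝ) + 2 * α) ^ 2) := by ring
  rw [e, abs_lt]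
  constructor <;> linarith

set_option maxHeartbeats 2000000 in
lemma aux_triple {x h M X : ℝ} {u b c α m n m' n' m'' n'' : ℤ} (hM : 0 < M) (hx : 0 < x)
    (hh : 0 < h) (hα : 0 < α) (hX : 2.6624 ≤ X) (hXe : (2 * α : ℝ) ^ 3 * x = X * M ^ 4)
    (hhM : 5.5 * h ≤ M)
    (hu : M < (u : ℝ)) (hb : α ≤ b) (hc : α ≤ c)
    (hw : (u : ℝ) + 2 * b + 2 * c + 2 * α ≤ 1.045 * M)
    (hm : auxNear x h u m) (hn : auxNear x h (u + 2 * α) n)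
    (hm' : auxNear x h (u + 2 * b) m') (hn' : auxNear x h (u + 2 * b + 2 * α) n')
    (hm'' : auxNear x h (u + 2 * b + 2 * c) m'') (hn'' : auxNear x h (u + 2 * b + 2 * c + 2 * α) n'')
    (hl : (2 * b + 2 * c : ℝ) ≤ 1.24619 * h / X) :
    0.6563 * M ^ 5 ≤ (2 * α) * x * (2 * b + 2 * c : ℝ) ^ 3 := by
  have hα' : (0:ℝ) < α := by exact_mod_cast hα
  have hb' : (α:ℝ) ≤ b := by exact_mod_cast hb
  have hc' : (α:ℝ) ≤ c := by exact_mod_cast hc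
  have F1 := aux_F hM hh hα hu hm hn
  have F2 := aux_F hM hh hα (by push_cast; linarith) hm' hn'
  have F3 := aux_F hM hh hα (by push_cast; linarith) hm'' hn''
  push_cast at F2 F3
  obtain ⟨G1, G2⟩ := aux_G M (1.045 * M) u (u + 2 * b) (u + 2 * b + 2 * c) (2 * α) hM (by linarith)
    hu.le (by linarith) (by linarith) hw
  rw [show (u : ℝ) + 2 * b + 2 * c - (u + 2 * b) = 2 * c by ring,
    show (u : ℝ) + 2 * b + 2 * c - u = 2 * b + 2 * c by ring,
    show (u : ℝ) + 2 * b - u = 2 * b by ring] at G1 G2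
  generalize hf1 : 1 / (u : ℝ) ^ 2 - 1 / ((u : ℝ) + 2 * α) ^ 2 = f1 at *
  generalize hf2 : 1 / ((u : ℝ) + 2 * b) ^ 2 - 1 / ((u : ℝ) + 2 * b + 2 * α) ^ 2 = f2 at *
  generalize hf3 : 1 / ((u : ℝ) + 2 * b + 2 * c) ^ 2 -
    1 / ((u : ℝ) + 2 * b + 2 * c + 2 * α) ^ 2 = f3 at *
  set G : ℤ := c * (m - n) - (b + c) * (m' - n') + b * (m'' - n'') with hG
  have hGr : (G : ℝ) = c * ((m : ℝ) - n) - (b + c) * ((m' : ℝ) - n') + b * ((m'' : ℝ) - n'') := by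
    rw [hG]; push_cast; ring
  rw [abs_lt] at F1 F2 F3
  have c0 : (0:ℝ) < c := by linarith
  have b0 : (0:ℝ) < b := by linarith
  have E : |(G : ℝ) - x * (c * f1 - (b + c) * f2 + b * f3)| ≤ (2 * b + 2 * c) * (h / M ^ 2) := by
    have e : (G : ℝ) - x * (c * f1 - (b + c) * f2 + b * f3) =
      c * ((m : ℝ) - n - x * f1) - (b + c) * ((m' : ℝ) - n' - x * f2) +
        b * ((m'' : ℝ) - n'' - x * f3) := by rw [hGr]; ring
    rw [e, abs_le]
    have bc0 : (0:ℝ) < b + c := by linarith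
    have t1 := mul_lt_mul_of_pos_left F1.1 c0
    have t2 := mul_lt_mul_of_pos_left F1.2 c0
    have t3 := mul_lt_mul_of_pos_left F2.1 bc0
    have t4 := mul_lt_mul_of_pos_left F2.2 bc0
    have t5 := mul_lt_mul_of_pos_left F3.1 b0
    have t6 := mul_lt_mul_of_pos_left F3.2 b0
    constructor <;> linarith
  rw [abs_le] at E
  have hhM' : h / M ≤ 1 / 5.5 := by
    rw [div_le_div_iff₀ hM (by norm_num)]; linarith
  have hhM0 : 0 < h / M := by positivity
  have X0 : 0 < X := by linarith
  -- positivity of G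
  have L1 : x * ((2 * b) * (2 * c) * (2 * b + 2 * c) * (12 * (2 * α) / (1.045 * M) ^ 5)) ≤
      2 * (x * (c * f1 - (b + c) * f2 + b * f3)) := by
    have := mul_le_mul_of_nonneg_left G1 hx.le
    linarith
  have L2 : 2 * (x * (c * f1 - (b + c) * f2 + b * f3)) ≤
      x * ((2 * b) * (2 * c) * (2 * b + 2 * c) * (12 * (2 * α) / M ^ 5)) := by
    have := mul_le_mul_of_nonneg_left G2 hx.le
    linarith
  have d0 : (0:ℝ) < 2 * b + 2 * c := by linarith
  have P1 : (2 * b + 2 * c) * (9 * X / M) ≤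
      x * ((2 * b) * (2 * c) * (2 * b + 2 * c) * (12 * (2 * α) / (1.045 * M) ^ 5)) := by
    have hbc : (2 * α : ℝ) * (2 * α) ≤ 2 * b * (2 * c) := by
      apply mul_le_mul <;> linarith
    calc (2 * b + 2 * c) * (9 * X / M) ≤ (2 * b + 2 * c) * (12 * X / M / 1.045 ^ 5) := by
          apply mul_le_mul_of_nonneg_left _ d0.le
          rw [le_div_iff₀ (by norm_num)]
          have : 0 < X / M := by positivity
          rw [mul_div_assoc, mul_div_assoc]
          norm_num
          nlinarith
      _ = (2 * b + 2 * c) * (12 * (X * M ^ 4) / (1.045 * M) ^ 5) := by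
          congr 1; field_simp
      _ = x * ((2 * α * (2 * α)) * (2 * b + 2 * c) * (12 * (2 * α) / (1.045 * M) ^ 5)) := by
          rw [← hXe]; ring
      _ ≤ _ := by gcongr
  have P2 : 2 * ((2 * b + 2 * c) * (h / M ^ 2)) < (2 * b + 2 * c) * (9 * X / M) := by
    rw [show 2 * ((2 * b + 2 * c : ℝ) * (h / M ^ 2)) = (2 * b + 2 * c) * (2 * (h / M) / M) by
      field_simp]
    apply mul_lt_mul_of_pos_left _ d0
    apply div_lt_div_of_pos_right _ hM
    norm_num at hhM' ⊢
    linarith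
  have hGpos : (0:ℝ) < G := by linarith [E.1]
  have hG1 : (1:ℝ) ≤ G := by
    have : 0 < G := by exact_mod_cast hGpos
    exact_mod_cast this
  have Q1 : (2 * b + 2 * c : ℝ) * (h / M ^ 2) ≤ 0.01548 := by
    have hd : (2 * b + 2 * c : ℝ) ≤ 1.24619 * h / 2.6624 := by
      refine le_trans hl ?_
      apply div_le_div_of_nonneg_left (by positivity) (by norm_num) hX
    calc (2 * b + 2 * c : ℝ) * (h / M ^ 2) ≤ 1.24619 * h / 2.6624 * (h / M ^ 2) := by gcongr
      _ = 1.24619 / 2.6624 * (h / M) ^ 2 := by field_simp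
      _ ≤ 1.24619 / 2.6624 * (1 / 5.5) ^ 2 := by gcongr
      _ ≤ 0.01548 := by norm_num
  have Q2 : x * ((2 * b) * (2 * c) * (2 * b + 2 * c) * (12 * (2 * α) / M ^ 5)) ≤
      3 * ((2 * α) * x * (2 * b + 2 * c : ℝ) ^ 3) / M ^ 5 := by
    have hsq : (2 * b : ℝ) * (2 * c) ≤ (2 * b + 2 * c) ^ 2 / 4 := by nlinarith [sq_nonneg ((b:ℝ) - c)]
    calc _ ≤ x * (((2 * b + 2 * c) ^ 2 / 4) * (2 * b + 2 * c) * (12 * (2 * α) / M ^ 5)) := by gcongr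
      _ = _ := by ring
  have Q3 : 2 * (1 - 0.01548) ≤ 3 * ((2 * α) * x * (2 * b + 2 * c : ℝ) ^ 3) / M ^ 5 := by
    linarith [E.2]
  rw [le_div_iff₀ (by positivity)] at Q3
  have : 0 < M ^ 5 := by positivity
  nlinarith

lemma aux_main {x h M X Q : ℝ} {a : ℤ} (hM : 0 < M) (hx : 0 < x) (hh : 0 < h) (ha : 0 < a)
    (hX : 2.6624 ≤ X) (hXe : (a : ℝ) ^ 3 * x = X * M ^ 4) (hhM : 5.5 * h ≤ M) (hQ : 0 < Q)
    (hQe : Q ^ 3 * ((a : ℝ) * x) = M ^ 5) :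
    ((Tset x h 1.045 M a).ncard : ℝ) <
      (0.1452 * X + 1) * (2 + 2 * ((1.24619 * h / X) / (0.869 * Q))) := by
  have X0 : 0 < X := by linarith
  rcases (Tset x h 1.045 M a).eq_empty_or_nonempty with he | ⟨u0, hu0⟩
  · rw [he]; simp; positivity
  have hS : ∀ u ∈ Tset x h 1.045 M a, u ∈ Sset x h M (1.045 * M) ∧
      u + a ∈ Sset x h M (1.045 * M) := fun u hu => ⟨hu.1.1, hu.2.1.1⟩
  have hgap : ∀ u ∈ Tset x h 1.045 M a, ∀ v ∈ Tset x h 1.045 M a, u < v → u + a ≤ v := by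
    intro u hu v hv huv
    by_contra hcon
    push Not at hcon
    exact hu.2.2 v hv.1 ⟨huv, hcon⟩
  obtain ⟨α, rfl⟩ : ∃ α : ℤ, a = 2 * α := by
    have h1 := (aux_mem (hS u0 hu0).1).1
    have h2 := (aux_mem (hS u0 hu0).2).1
    obtain ⟨k, hk⟩ := h1
    obtain ⟨l, hl⟩ := h2
    exact ⟨l - k, by omega⟩
  have hα : 0 < α := by omega
  have hα' : (0:ℝ) < α := by exact_mod_cast hα
  push_cast at hXe hQe
  have hfin : (Tset x h 1.045 M (2 * α)).Finite := by
    apply (Set.finite_Icc ⌊M⌋ ⌈1.045 * M⌉).subset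
    intro u hu
    obtain ⟨-, h1, h2, -⟩ := aux_mem (hS u hu).1
    constructor
    · exact_mod_cast (Int.floor_le M).trans h1.le
    · exact_mod_cast h2.trans (Int.le_ceil _)
  rw [Set.ncard_eq_toFinset_card _ hfin]
  have hl0 : 0 < 0.045 * M / (0.1452 * X) := by positivity
  apply aux_card_intervals _ M (0.045 * M / (0.1452 * X)) _ _ hl0 (by positivity) (by positivity)
  · intro u hu
    rw [Set.Finite.mem_toFinset] at hu
    obtain ⟨-, h1, h2, -⟩ := aux_mem (hS u hu).1
    refine ⟨h1, ?_⟩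
    rw [mul_div_cancel₀ _ (by positivity)]
    linarith
  intro B hBsub hB
  have hBT : ∀ u ∈ B, u ∈ Tset x h 1.045 M (2 * α) := fun u hu => by
    have := hBsub hu
    rwa [Set.Finite.mem_toFinset] at this
  have hdiam : ∀ u ∈ B, ∀ v ∈ B, (v : ℝ) - u ≤ 1.24619 * h / X := by
    intro u hu v hv
    rcases le_total v u with hvu | huv
    · have : (v : ℝ) ≤ u := by exact_mod_cast hvu
      have : 0 < 1.24619 * h / X := by positivity
      linarith
    · obtain ⟨-, h1, h2, m, hm⟩ := aux_mem (hS u (hBT u hu)).1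
      obtain ⟨-, -, -, n, hn⟩ := aux_mem (hS u (hBT u hu)).2
      obtain ⟨-, -, -, m', hm'⟩ := aux_mem (hS v (hBT v hv)).1
      obtain ⟨-, -, h3, n', hn'⟩ := aux_mem (hS v (hBT v hv)).2
      push_cast at h3
      exact aux_diam hM hx hh hα X0 hXe hhM h1 huv h3 hm hn hm' hn' (hB u hu v hv)
  apply aux_card_triples B _ _ (by positivity) (by positivity) hdiam
  intro u hu v hv w hw huv hvw
  have g1 := hgap u (hBT u hu) v (hBT v hv) huv
  have g2 := hgap v (hBT v hv) w (hBT w hw) hvw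
  have hd := hdiam u hu w hw
  obtain ⟨ou, h1, h2, m, hm⟩ := aux_mem (hS u (hBT u hu)).1
  obtain ⟨-, -, -, n, hn⟩ := aux_mem (hS u (hBT u hu)).2
  obtain ⟨ov, -, -, m', hm'⟩ := aux_mem (hS v (hBT v hv)).1
  obtain ⟨-, -, -, n', hn'⟩ := aux_mem (hS v (hBT v hv)).2
  obtain ⟨ow, -, -, m'', hm''⟩ := aux_mem (hS w (hBT w hw)).1
  obtain ⟨-, -, h3, n'', hn''⟩ := aux_mem (hS w (hBT w hw)).2
  obtain ⟨b, rfl⟩ : ∃ b : ℤ, v = u + 2 * b := by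
    obtain ⟨k, hk⟩ := ou
    obtain ⟨l, hl⟩ := ov
    exact ⟨l - k, by omega⟩
  obtain ⟨c, rfl⟩ : ∃ c : ℤ, w = u + 2 * b + 2 * c := by
    obtain ⟨k, hk⟩ := ov
    obtain ⟨l, hl⟩ := ow
    exact ⟨l - k, by omega⟩
  push_cast at hd h3 ⊢
  have hd' : (2 * b + 2 * c : ℝ) ≤ 1.24619 * h / X := by linarith
  have key := aux_triple hM hx hh hα hX hXe hhM h1 (by omega) (by omega) h3 hm hn hm' hn' hm'' hn'' hd'
  have e : (u : ℝ) + 2 * b + 2 * c - u = 2 * b + 2 * c := by ring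
  rw [e]
  have hbc : (0:ℝ) < 2 * b + 2 * c := by
    have : 0 < 2 * b + 2 * c := by omega
    exact_mod_cast this
  refine le_of_pow_le_pow_left₀ (n := 3) (by norm_num) hbc.le ?_
  have hax : (0:ℝ) < 2 * α * x := by positivity
  refine le_of_mul_le_mul_right ?_ hax
  calc (0.869 * Q) ^ 3 * (2 * α * x) = 0.869 ^ 3 * (Q ^ 3 * (2 * α * x)) := by ring
    _ = 0.869 ^ 3 * M ^ 5 := by rw [hQe]
    _ ≤ 0.6563 * M ^ 5 := by
        apply mul_le_mul_of_nonneg_right _ (by positivity); norm_num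
    _ ≤ _ := key
    _ = _ := by ring

/-- The bound (5.16) on `|T(M; a)|` for `A ≤ a ≤ B`. -/
theorem card_Tset (x M : ℝ) (a : ℤ) (hx : Real.exp 116 ≤ x)
    (hM1 : 5.5 * (11 * x ^ ((1 : ℝ) / 5) * Real.log x) ≤ M) (hM2 : M ≤ x ^ ((2 : ℝ) / 5))
    (ha1 : 1.3860 * x ^ (-(1 : ℝ) / 3) * M ^ ((4 : ℝ) / 3) ≤ (a : ℝ))
    (ha2 : (a : ℝ) ≤ 0.17 * x ^ (-(1 : ℝ) / 5) * M) :
    ((Tset x (11 * x ^ ((1 : ℝ) / 5) * Real.log x) 1.045 M a).ncard : ℝ) <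
      0.4346 * (a : ℝ) ^ ((1 : ℝ) / 3) * (11 * x ^ ((1 : ℝ) / 5) * Real.log x) *
          x ^ ((1 : ℝ) / 3) * M ^ (-(5 : ℝ) / 3) +
        0.2904 * (a : ℝ) ^ 3 * x * M ^ (-(4 : ℝ)) +
        2.9918 * (a : ℝ) ^ (-(8 : ℝ) / 3) * (11 * x ^ ((1 : ℝ) / 5) * Real.log x) *
          x ^ (-(2 : ℝ) / 3) * M ^ ((7 : ℝ) / 3) +
        2 := by
  have hx0 : 0 < x := lt_of_lt_of_le (Real.exp_pos _) hx
  have hlog : 116 ≤ Real.log x := (Real.le_log_iff_exp_le hx0).2 hx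
  have hh : 0 < 11 * x ^ ((1 : ℝ) / 5) * Real.log x := by
    have : 0 < Real.log x := by linarith
    positivity
  generalize 11 * x ^ ((1 : ℝ) / 5) * Real.log x = h at *
  have hM : 0 < M := by linarith
  have haR : (0:ℝ) < a := lt_of_lt_of_le (by positivity) ha1
  have ha : 0 < a := by exact_mod_cast haR
  have pw : ∀ y : ℝ, 0 < y → ∀ p : ℝ, ∀ n : ℕ, (y ^ p) ^ n = y ^ (p * n) := fun y hy p n => by
    rw [Real.rpow_mul_natCast hy.le]
  set X : ℝ := (a : ℝ) ^ 3 * x * M ^ (-(4 : ℝ)) with hXdef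
  have hM4 : M ^ (-(4 : ℝ)) * M ^ 4 = 1 := by
    rw [← Real.rpow_natCast M 4, ← Real.rpow_add hM]; norm_num
  have hXe : (a : ℝ) ^ 3 * x = X * M ^ 4 := by
    rw [hXdef, mul_assoc _ _ (M ^ 4), hM4, mul_one]
  have hX : 2.6624 ≤ X := by
    have h1 := pow_le_pow_left₀ (by positivity) ha1 3
    rw [mul_pow, mul_pow, pw x hx0, pw M hM] at h1
    norm_num at h1
    rw [Real.rpow_neg_one] at h1
    have h2 : M ^ (4:ℝ) = M ^ 4 := by exact_mod_cast Real.rpow_natCast M 4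
    have h3 := mul_le_mul_of_nonneg_right h1 hx0.le
    rw [hXe] at h3
    refine le_of_mul_le_mul_right (le_trans ?_ h3) (show 0 < M ^ 4 by positivity)
    first | rw [h2] | skip
    field_simp
    norm_num
  set Q : ℝ := (a : ℝ) ^ (-(1:ℝ)/3) * x ^ (-(1:ℝ)/3) * M ^ ((5:ℝ)/3) with hQdef
  have hQ : 0 < Q := by positivity
  have hQe : Q ^ 3 * ((a : ℝ) * x) = M ^ 5 := by
    rw [hQdef, mul_pow, mul_pow, pw x hx0, pw M hM, pw a haR]
    norm_num
    rw [Real.rpow_neg_one, Real.rpow_neg_one]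
    have h2 : M ^ (5:ℝ) = M ^ 5 := by exact_mod_cast Real.rpow_natCast M 5
    first | rw [h2] | skip
    field_simp
  have main := aux_main hM hx0 hh ha hX hXe hM1 hQ hQe
  set K : ℝ := (a : ℝ) ^ (-(8 : ℝ) / 3) * h * x ^ (-(2 : ℝ) / 3) * M ^ ((7 : ℝ) / 3) with hK
  have K0 : 0 < K := by positivity
  have X0 : 0 < X := by linarith
  have a3 : (a : ℝ) ^ 3 = (a : ℝ) ^ (3:ℝ) := by exact_mod_cast (Real.rpow_natCast (a : ℝ) 3).symm
  have x1 : x = x ^ (1:ℝ) := (Real.rpow_one x).symm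
  have cmb : ∀ p q r p' q' r' : ℝ, (a : ℝ) ^ p * x ^ q * M ^ r * ((a : ℝ) ^ p' * x ^ q' * M ^ r') =
      (a : ℝ) ^ (p + p') * x ^ (q + q') * M ^ (r + r') := fun p q r p' q' r' => by
    rw [Real.rpow_add haR, Real.rpow_add hx0, Real.rpow_add hM]; ring
  have hX' : X = (a : ℝ) ^ (3:ℝ) * x ^ (1:ℝ) * M ^ (-(4 : ℝ)) := by rw [hXdef, a3, Real.rpow_one]
  have hK' : K = h * ((a : ℝ) ^ (-(8 : ℝ) / 3) * x ^ (-(2 : ℝ) / 3) * M ^ ((7 : ℝ) / 3)) := by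
    rw [hK]; ring
  have hXK : (a : ℝ) ^ ((1 : ℝ) / 3) * h * x ^ ((1 : ℝ) / 3) * M ^ (-(5 : ℝ) / 3) = X * K := by
    rw [hX', hK', mul_left_comm, cmb]; norm_num; ring
  have hXKQ : K * (X * Q) = h := by
    rw [hK', hX', hQdef, mul_assoc, cmb, cmb]; norm_num
  have hKe : 2 * ((1.24619 * h / X) / (0.869 * Q)) = 2 * 1.24619 / 0.869 * K := by
    rw [← hXKQ]; field_simp
  rw [hKe] at main
  refine lt_of_lt_of_le main ?_
  have e : 0.4346 * (a : ℝ) ^ ((1 : ℝ) / 3) * h * x ^ ((1 : ℝ) / 3) * M ^ (-(5 : ℝ) / 3) +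
        0.2904 * (a : ℝ) ^ 3 * x * M ^ (-(4 : ℝ)) +
        2.9918 * (a : ℝ) ^ (-(8 : ℝ) / 3) * h * x ^ (-(2 : ℝ) / 3) * M ^ ((7 : ℝ) / 3) + 2 =
      0.4346 * (X * K) + 0.2904 * X + 2.9918 * K + 2 := by
    rw [← hXK, hXdef, hK]; ring
  rw [e]
  have XK0 : 0 < X * K := mul_pos X0 K0
  norm_num
  nlinarith
end
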